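/- arXiv:2212.00324 — 3 statements merged into one kernel-verified Lean document; each statement's English description precedes it below -/
import Mathlib

section
/- Let N > 1 and let χ be a primitive quadratic Dirichlet character of modulus N (so χ² is trivial and χ is nontrivial). Then ζ(1/2)·L(1/2,χ) = 0 if and only if the derivative at s = 1/2 of the function s ↦ ζ(s)·L(s,χ) is 0. (This is Theorem 2 for quadratic fields K, where ζ_K(s) = ζ(s)L(s,χ) with χ the primitive quadratic character of modulus |d_K|: ζ_K(1/2) = 0 if and only if ζ_K'(1/2) = 0.) -/
section Aux

open Complex Filter Topology HurwitzZeta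

lemma aux_hasSum_congr {ι : Type*} {f g : ι → ℂ} {a : ℂ} (h : ∀ n, f n = g n) (hg : HasSum g a) :
    HasSum f a := by
  rwa [funext h]

lemma aux_theta_hasSum {τ : ℂ} (hτ : 0 < τ.im) :
    HasSum (fun n : ℤ => cexp (Real.pi * I * (n : ℂ) ^ 2 * τ)) (jacobiTheta τ) := by
  have := hasSum_jacobiTheta₂_term 0 hτ
  simpa [jacobiTheta₂_term, ← jacobiTheta_eq_jacobiTheta₂] using this

lemma aux_theta_split (p : ℕ) [NeZero p] {ε : ℝ} (hε : 0 < ε) :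
    jacobiTheta (2 / p + I * ε) =
      ∑ x : ZMod p, ZMod.stdAddChar (x ^ 2) * (evenKernel ((x.val / p : ℝ) : UnitAddCircle) (p ^ 2 * ε) : ℂ) := by
  have hp : (p : ℂ) ≠ 0 := Nat.cast_ne_zero.mpr (NeZero.ne p)
  have hpr : (0 : ℝ) < p := Nat.cast_pos.mpr (Nat.pos_of_ne_zero (NeZero.ne p))
  have h2p : ((2 : ℂ) / p).im = 0 := by
    have : (2 : ℂ) / p = ((2 / p : ℝ) : ℂ) := by push_cast; rfl
    rw [this, ofReal_im]
  have h0 := aux_theta_hasSum (τ := 2 / p + I * ε) (by simp [h2p, hε])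
  let e : Fin p × ℤ ≃ ℤ := (Equiv.prodComm _ _).trans (Int.divModEquiv p).symm
  have h1 := (e.hasSum_iff).mpr h0
  have h2 : ∀ r : Fin p, HasSum (fun k : ℤ => ((fun n : ℤ => cexp (Real.pi * I * (n : ℂ) ^ 2 * (2 / p + I * ε))) ∘ e) (r, k))
      (ZMod.stdAddChar (((r : ℕ) : ZMod p) ^ 2) * (evenKernel (((r : ℕ) / p : ℝ) : UnitAddCircle) (p ^ 2 * ε) : ℂ)) := by
    intro r
    have h3 := hasSum_int_evenKernel ((r : ℕ) / p : ℝ) (t := p ^ 2 * ε) (by positivity)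
    have h4 := (hasSum_ofReal.mpr h3).mul_left (ZMod.stdAddChar (((r : ℕ) : ZMod p) ^ 2))
    refine aux_hasSum_congr (fun k => ?_) h4
    have he : e (r, k) = k * p + (r : ℕ) := by
      simp [e, Int.divModEquiv]
    simp only [Function.comp, he]
    have hs : ZMod.stdAddChar (((r : ℕ) : ZMod p) ^ 2) = ZMod.stdAddChar ((((k * p + (r : ℕ)) ^ 2 : ℤ)) : ZMod p) := by
      simp
    rw [hs, ZMod.stdAddChar_coe, ofReal_exp, ← Complex.exp_add]
    congr 1
    push_cast
    field_simp
    linear_combination (k * p + (r : ℂ)) ^ 2 * ε * p * I_sq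
  have h5 := h1.prod_fiberwise h2
  have h6 := h5.unique (hasSum_fintype _)
  rw [h6]
  obtain ⟨q, rfl⟩ : ∃ q, p = q + 1 := ⟨p - 1, by have := NeZero.pos p; omega⟩
  refine Finset.sum_congr rfl fun x _ => ?_
  have : (((x : Fin (q+1)) : ℕ) : ZMod (q + 1)) = (x : ZMod (q+1)) := ZMod.natCast_zmod_val (n := q+1) x
  rw [this]; rfl

lemma aux_evenKernel_lim (p : ℕ) [NeZero p] (a : UnitAddCircle) :
    Tendsto (fun ε : ℝ => (√ε : ℂ) * (evenKernel a (p ^ 2 * ε) : ℂ)) (𝓝[>] 0) (𝓝 (1 / p)) := by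
  have hpr : (0 : ℝ) < p := Nat.cast_pos.mpr (Nat.pos_of_ne_zero (NeZero.ne p))
  have hc : Tendsto (fun x => cosKernel a x) atTop (𝓝 1) := by
    obtain ⟨c, hc, h⟩ := isBigO_atTop_cosKernel_sub a
    have : Tendsto (fun x => cosKernel a x - 1) atTop (𝓝 0) := by
      refine h.trans_tendsto ?_
      have : Tendsto (fun x : ℝ => c * x) atTop atTop := tendsto_id.const_mul_atTop hc
      refine (Real.tendsto_exp_neg_atTop_nhds_zero.comp this).congr fun x => by simp
    simpa using this.add_const 1
  have h1 : Tendsto (fun ε : ℝ => 1 / (p ^ 2 * ε)) (𝓝[>] 0) atTop := by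
    have : Tendsto (fun ε : ℝ => (p ^ 2 : ℝ)⁻¹ * ε⁻¹) (𝓝[>] 0) atTop :=
      tendsto_inv_nhdsGT_zero.const_mul_atTop (by positivity)
    refine this.congr fun x => ?_
    rw [one_div, mul_inv]
  have h2 : Tendsto (fun ε : ℝ => (1 / p : ℝ) * cosKernel a (1 / (p ^ 2 * ε))) (𝓝[>] 0) (𝓝 (1 / p)) := by
    simpa using (hc.comp h1).const_mul (1 / p : ℝ)
  have h3 : Tendsto (fun ε : ℝ => (((1 / p : ℝ) * cosKernel a (1 / (p ^ 2 * ε)) : ℝ) : ℂ)) (𝓝[>] 0) (𝓝 (1 / p)) := by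
    have := (continuous_ofReal.tendsto _).comp h2
    simpa [Function.comp_def] using this
  refine h3.congr' ?_
  filter_upwards [self_mem_nhdsWithin] with ε (hε : 0 < ε)
  rw [← ofReal_mul, evenKernel_functional_equation, ← Real.sqrt_eq_rpow, Real.sqrt_mul (by positivity), Real.sqrt_sq hpr.le]
  congr 1
  have : √ε ≠ 0 := (Real.sqrt_pos.mpr hε).ne'
  field_simp

lemma aux_theta_lim1 (p : ℕ) [NeZero p] :
    Tendsto (fun ε : ℝ => (√ε : ℂ) * jacobiTheta (2 / p + I * ε)) (𝓝[>] 0)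
      (𝓝 ((∑ x : ZMod p, ZMod.stdAddChar (x ^ 2)) / p)) := by
  have h : Tendsto (fun ε : ℝ => ∑ x : ZMod p, ZMod.stdAddChar (x ^ 2) * ((√ε : ℂ) * (evenKernel ((x.val / p : ℝ) : UnitAddCircle) (p ^ 2 * ε) : ℂ))) (𝓝[>] 0)
      (𝓝 (∑ x : ZMod p, ZMod.stdAddChar (x ^ 2) * (1 / p))) :=
    tendsto_finsetSum _ fun x _ => (aux_evenKernel_lim p _).const_mul _
  rw [← Finset.sum_mul, mul_one_div] at h
  refine h.congr' ?_
  filter_upwards [self_mem_nhdsWithin] with ε (hε : 0 < ε)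
  rw [aux_theta_split p hε, Finset.mul_sum]
  exact Finset.sum_congr rfl fun x _ => by ring

lemma aux_theta_inv {τ : ℂ} (hτ : 0 < τ.im) :
    jacobiTheta (-1 / τ) = (-I * τ) ^ (1 / 2 : ℂ) * jacobiTheta τ := by
  have := jacobiTheta_S_smul ⟨τ, hτ⟩
  rw [UpperHalfPlane.modular_S_smul] at this
  simpa [neg_div, ← inv_neg] using this

lemma aux_theta_half (p : ℕ) {w : ℂ} (hw : 0 < w.im) :
    jacobiTheta (-p / 2 + w) = (-I) ^ p * jacobiTheta w + (1 - (-I) ^ p) * jacobiTheta (4 * w) := by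
  have h2p : (-(p : ℂ) / 2).im = 0 := by
    have : -(p : ℂ) / 2 = ((-p / 2 : ℝ) : ℂ) := by push_cast; rfl
    rw [this, ofReal_im]
  have h0 := aux_theta_hasSum (τ := -p / 2 + w) (by simp [h2p, hw])
  have h1 := (aux_theta_hasSum hw).mul_left ((-I) ^ p)
  have h2 := aux_theta_hasSum (τ := 4 * w) (by simpa using hw)
  have hinj : Function.Injective (fun n : ℤ => 2 * n) := fun a b h => by simpa using h
  let f : ℤ → ℂ := fun n => if Even n then cexp (Real.pi * I * (n : ℂ) ^ 2 * w) else 0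
  have h3 : HasSum f (jacobiTheta (4 * w)) := by
    refine (hinj.hasSum_iff ?_).mp ?_
    · intro x hx
      have : ¬ Even x := fun ⟨y, hy⟩ => hx ⟨y, by simp; omega⟩
      simp [f, this]
    · refine aux_hasSum_congr (fun n => ?_) h2
      simp only [f, Function.comp, even_two_mul, if_true]
      congr 1; push_cast; ring
  have h4 := h1.add (h3.mul_left (1 - (-I) ^ p))
  refine h0.unique ?_
  refine aux_hasSum_congr (fun n => ?_) h4
  have hI : cexp (-(Real.pi / 2 * I)) = -I := by
    rw [Complex.exp_neg, Complex.exp_pi_div_two_mul_I, inv_I]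
  have key : cexp (Real.pi * I * (n : ℂ) ^ 2 * (-p / 2 + w)) = (-I) ^ (p * (n ^ 2).natAbs) * cexp (Real.pi * I * (n : ℂ) ^ 2 * w) := by
    rw [← hI, ← Complex.exp_nat_mul, ← Complex.exp_add]
    congr 1
    have : (((n ^ 2).natAbs : ℕ) : ℂ) = (n : ℂ) ^ 2 := by
      have : (((n ^ 2).natAbs : ℕ) : ℤ) = n ^ 2 := Int.natAbs_of_nonneg (sq_nonneg n)
      rw [← Int.cast_natCast (R := ℂ), this, Int.cast_pow]
    push_cast [this]; ring
  rw [key]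
  have h4 : (-I) ^ 4 = 1 := by rw [neg_pow, I_pow_four]; norm_num
  by_cases hn : Even n
  · simp only [f, hn, if_true]
    obtain ⟨k, rfl⟩ := hn
    have : (((k + k) ^ 2 : ℤ)).natAbs = 4 * (k ^ 2).natAbs := by
      rw [show ((k + k) ^ 2 : ℤ) = 4 * k ^ 2 by ring, Int.natAbs_mul]; rfl
    rw [this, show p * (4 * (k ^ 2).natAbs) = 4 * (p * (k ^ 2).natAbs) by ring, pow_mul, h4, one_pow]
    ring
  · simp only [f, hn, if_false]
    rw [Int.not_even_iff_odd] at hn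
    obtain ⟨k, rfl⟩ := hn
    have : ((2 * k + 1) ^ 2 : ℤ).natAbs = 4 * (k * k + k).natAbs + 1 := by
      have h1 : 0 ≤ k * k + k := by nlinarith [Int.le_self_sq k, sq_nonneg k, Int.le_self_sq (-k)]
      have h2 : ((2 * k + 1) ^ 2 : ℤ) = 4 * (k * k + k) + 1 := by ring
      rw [h2]; omega
    rw [this, show p * (4 * (k * k + k).natAbs + 1) = 4 * (p * (k * k + k).natAbs) + p by ring, pow_add, pow_mul, h4, one_pow]
    ring


lemma aux_theta_lim_w (z : ℝ → ℂ) (z₀ : ℂ) (hz : Tendsto z (𝓝[>] 0) (𝓝 z₀)) (h0 : 0 < z₀.re) :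
    Tendsto (fun ε : ℝ => (√ε : ℂ) * jacobiTheta (I * (ε * z ε))) (𝓝[>] 0) (𝓝 (1 / z₀ ^ (1 / 2 : ℂ))) := by
  have hz0 : z₀ ≠ 0 := by rintro rfl; simp at h0
  have hinv : 0 < (z₀⁻¹).re := by
    rw [inv_re]; exact div_pos h0 (normSq_pos.mpr hz0)
  have hzi : Tendsto (fun ε => (z ε)⁻¹) (𝓝[>] 0) (𝓝 z₀⁻¹) := hz.inv₀ hz0
  have him : Tendsto (fun ε : ℝ => (I * ((ε : ℂ)⁻¹ * (z ε)⁻¹)).im) (𝓝[>] 0) atTop := by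
    have h1 : Tendsto (fun ε : ℝ => ε⁻¹ * ((z ε)⁻¹).re) (𝓝[>] 0) atTop :=
      Tendsto.atTop_mul_pos hinv tendsto_inv_nhdsGT_zero ((continuous_re.tendsto _).comp hzi)
    refine h1.congr fun ε => ?_
    rw [← ofReal_inv, I_mul_im, re_ofReal_mul]
  have hth : Tendsto (fun ε : ℝ => jacobiTheta (I * ((ε : ℂ)⁻¹ * (z ε)⁻¹))) (𝓝[>] 0) (𝓝 1) := by
    have h1 := isBigO_at_im_infty_jacobiTheta_sub_one
    have h2 : Tendsto (fun τ : ℂ => Real.exp (-Real.pi * τ.im)) (comap im atTop) (𝓝 0) := by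
      have h3 : Tendsto (fun τ : ℂ => Real.pi * τ.im) (comap im atTop) atTop :=
        tendsto_comap.const_mul_atTop Real.pi_pos
      refine (Real.tendsto_exp_neg_atTop_nhds_zero.comp h3).congr fun x => by simp
    have h4 := h1.trans_tendsto h2
    have h5 : Tendsto (fun ε : ℝ => I * ((ε : ℂ)⁻¹ * (z ε)⁻¹)) (𝓝[>] 0) (comap im atTop) :=
      tendsto_comap_iff.mpr him
    simpa [Function.comp_def] using (h4.comp h5).add_const 1
  have hpow : Tendsto (fun ε => z ε ^ (1 / 2 : ℂ)) (𝓝[>] 0) (𝓝 (z₀ ^ (1 / 2 : ℂ))) :=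
    hz.cpow tendsto_const_nhds (Or.inl h0)
  have hne : z₀ ^ (1 / 2 : ℂ) ≠ 0 := by simp [cpow_eq_zero_iff, hz0]
  refine (hth.div hpow hne).congr' ?_
  have hev : ∀ᶠ ε in 𝓝[>] (0 : ℝ), 0 < (z ε).re :=
    ((continuous_re.tendsto _).comp hz).eventually (lt_mem_nhds h0)
  filter_upwards [self_mem_nhdsWithin, hev] with ε (hε : 0 < ε) hre
  have hzε : z ε ≠ 0 := by intro h; simp [h] at hre
  have hεc : (ε : ℂ) ≠ 0 := by exact_mod_cast hε.ne'
  have h6 := aux_theta_inv (τ := I * (ε * z ε)) (by rw [I_mul_im, re_ofReal_mul]; positivity)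
  have h7 : -1 / (I * (ε * z ε)) = I * ((ε : ℂ)⁻¹ * (z ε)⁻¹) := by
    field_simp; simp
  have h8 : -I * (I * (ε * z ε)) = ε * z ε := by
    linear_combination (-ε * z ε) * I_sq
  have h9 : ((ε : ℂ) * z ε) ^ (1 / 2 : ℂ) = √ε * z ε ^ (1 / 2 : ℂ) := by
    rw [Real.sqrt_eq_rpow, ofReal_cpow hε.le, cpow_def_of_ne_zero (mul_ne_zero hεc hzε), cpow_def_of_ne_zero hεc,
      cpow_def_of_ne_zero hzε, log_ofReal_mul hε hzε, ← Complex.exp_add, ofReal_log hε.le]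
    congr 1; push_cast; ring
  have h10 : z ε ^ (1 / 2 : ℂ) ≠ 0 := by simp [cpow_eq_zero_iff, hzε]
  rw [h7, h8, h9] at h6
  simp only [Pi.div_apply]
  rw [h6]
  field_simp

theorem aux_quadratic_gauss (p : ℕ) [NeZero p] :
    ∑ x : ZMod p, ZMod.stdAddChar (x ^ 2) = √p * ((1 + (-I) ^ p) / (1 - I)) := by
  have hp : (p : ℂ) ≠ 0 := Nat.cast_ne_zero.mpr (NeZero.ne p)
  have hpr : (0 : ℝ) < p := Nat.cast_pos.mpr (Nat.pos_of_ne_zero (NeZero.ne p))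
  set S := ∑ x : ZMod p, ZMod.stdAddChar (x ^ 2)
  have h2p : (2 : ℂ) / p = ((2 / p : ℝ) : ℂ) := by push_cast; rfl
  have hτ : Tendsto (fun ε : ℝ => (2 / p + I * ε : ℂ)) (𝓝[>] 0) (𝓝 (2 / p)) := by
    have : Continuous (fun ε : ℝ => (2 / p + I * ε : ℂ)) := by fun_prop
    have := (this.tendsto 0).mono_left (nhdsWithin_le_nhds (s := Set.Ioi 0))
    simpa using this
  have h2p0 : (2 : ℂ) / p ≠ 0 := by simp [hp]
  have hz : Tendsto (fun ε : ℝ => (p / 2 / (2 / p + I * ε) : ℂ)) (𝓝[>] 0) (𝓝 (((p / 2) ^ 2 : ℝ) : ℂ)) := by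
    have := (tendsto_const_nhds (x := (p / 2 : ℂ))).div hτ h2p0
    convert! this using 2
    push_cast; field_simp
  have hA := aux_theta_lim_w _ _ hz (by rw [ofReal_re]; positivity)
  have hB := aux_theta_lim_w (fun ε : ℝ => 4 * (p / 2 / (2 / p + I * ε) : ℂ)) ((p ^ 2 : ℝ) : ℂ)
    (by convert! hz.const_mul 4 using 2; push_cast; ring) (by rw [ofReal_re]; positivity)
  have hsq : ∀ x : ℝ, 0 ≤ x → ((x ^ 2 : ℝ) : ℂ) ^ (1 / 2 : ℂ) = x := by
    intro x hx
    rw [show (1 / 2 : ℂ) = ((1 / 2 : ℝ) : ℂ) by push_cast; rfl, ← ofReal_cpow (by positivity), ← Real.sqrt_eq_rpow, Real.sqrt_sq hx]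
  rw [hsq _ (by positivity)] at hA hB
  have hC := aux_theta_lim1 p
  have hpow : Tendsto (fun ε : ℝ => (-I * (2 / p + I * ε : ℂ)) ^ (1 / 2 : ℂ)) (𝓝[>] 0) (𝓝 ((-I * (2 / p)) ^ (1 / 2 : ℂ))) := by
    refine (hτ.const_mul (-I)).cpow tendsto_const_nhds (Or.inr ?_)
    rw [h2p]; simp [hpr.ne']
  have hL := hpow.mul hC
  have hR := (hA.const_mul ((-I) ^ p)).add (hB.const_mul (1 - (-I) ^ p))
  have hLR := hR.congr' (f₂ := fun ε : ℝ => (-I * (2 / p + I * ε : ℂ)) ^ (1 / 2 : ℂ) * ((√ε : ℂ) * jacobiTheta (2 / p + I * ε))) (by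
    filter_upwards [self_mem_nhdsWithin] with ε (hε : 0 < ε)
    have hτim : 0 < (2 / p + I * ε : ℂ).im := by rw [h2p]; simp [hε]
    have hτ0 : (2 / p + I * ε : ℂ) ≠ 0 := by intro h; rw [h] at hτim; simp at hτim
    have e1 := aux_theta_inv hτim
    have hw : 0 < (I * (ε * (p / 2 / (2 / p + I * ε) : ℂ))).im := by
      rw [I_mul_im, re_ofReal_mul, show (p / 2 : ℂ) = ((p / 2 : ℝ) : ℂ) by push_cast; rfl, div_eq_mul_inv, re_ofReal_mul, inv_re]
      have : 0 < (2 / p + I * ε : ℂ).re := by rw [h2p]; simp [hpr]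
      have := normSq_pos.mpr hτ0
      positivity
    have e2 := aux_theta_half p hw
    have e3 : -p / 2 + I * (ε * (p / 2 / (2 / p + I * ε) : ℂ)) = -1 / (2 / p + I * ε : ℂ) := by
      have h' : I * (ε * (p / 2 / (2 / p + I * ε) : ℂ)) = ((2 / p + I * ε) - 2 / p) * (p / 2 / (2 / p + I * ε)) := by ring
      rw [h']
      generalize (2 / p + I * ε : ℂ) = A at *
      field_simp
      ring
    rw [e3, e1] at e2
    have e4 : 4 * (I * (ε * (p / 2 / (2 / p + I * ε) : ℂ))) = I * (ε * (4 * (p / 2 / (2 / p + I * ε) : ℂ))) := by ring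
    rw [e4] at e2
    linear_combination -(√ε : ℂ) * e2)
  have hfin := tendsto_nhds_unique hL hLR
  have hs : (√p : ℂ) ^ 2 = p := by exact_mod_cast congrArg (ofReal) (Real.sq_sqrt hpr.le)
  have hs0 : (√p : ℂ) ≠ 0 := by intro h; rw [h] at hs; simp at hs; exact hp hs.symm
  have hroot : (-I * (2 / p)) ^ (1 / 2 : ℂ) = (1 - I) / √p := by
    have hsq2 : (-I * (2 / p)) = ((1 - I) / √p) ^ 2 := by
      rw [div_pow, hs]; field_simp; linear_combination -I_sq
    rw [hsq2, one_div, sq_cpow_two_inv]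
    rw [div_ofReal_re]
    have := Real.sqrt_pos.mpr hpr
    simp [this]
  rw [hroot] at hfin
  have h1I : (1 - I : ℂ) ≠ 0 := by intro h; simpa using congrArg re h
  push_cast at hfin
  change _ / _ * (S / _) = _ at hfin
  field_simp at hfin ⊢
  linear_combination hfin


lemma aux_prim_iff {R : Type*} [CommRing R] [Nontrivial R] {N : ℕ} [NeZero N] (χ : DirichletCharacter R N) :
    χ.IsPrimitive ↔ ∀ d, d ∣ N → (∀ a : ℕ, a.Coprime N → a ≡ 1 [MOD d] → χ a = 1) → d = N := by
  have key : ∀ d, d ∣ N → (χ.FactorsThrough d ↔ ∀ a : ℕ, a.Coprime N → a ≡ 1 [MOD d] → χ a = 1) := by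
    intro d hd
    rw [DirichletCharacter.factorsThrough_iff_ker_unitsMap hd]
    constructor
    · intro h a ha had
      have h1 : ZMod.unitOfCoprime a ha ∈ (ZMod.unitsMap hd).ker := by
        rw [MonoidHom.mem_ker]
        ext
        rw [ZMod.unitsMap_val, ZMod.coe_unitOfCoprime, ZMod.cast_natCast hd, Units.val_one]
        have := (ZMod.natCast_eq_natCast_iff a 1 d).mpr had
        simpa using this
      have h2 := h h1
      rw [MonoidHom.mem_ker] at h2
      have := congrArg Units.val h2
      simpa using this
    · intro h u hu
      rw [MonoidHom.mem_ker] at hu ⊢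
      have h1 := congrArg Units.val hu
      rw [ZMod.unitsMap_val, Units.val_one] at h1
      have h2 := h (u : ZMod N).val (ZMod.val_coe_unit_coprime u) (by
        rw [← ZMod.natCast_eq_natCast_iff]
        rw [ZMod.natCast_val, h1]; simp)
      ext
      simpa using h2
  constructor
  · intro h d hd ha
    have h1 : χ.conductor ≤ d := Nat.sInf_le ((key d hd).mpr ha)
    rw [(χ.isPrimitive_def).mp h] at h1
    exact le_antisymm (Nat.le_of_dvd (NeZero.pos N) hd) h1
  · intro h
    exact h _ χ.conductor_dvd_level ((key _ χ.conductor_dvd_level).mp χ.factorsThrough_conductor)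

lemma aux_gauss_sq {R : Type*} [CommRing R] [IsDomain R] {N : ℕ} [NeZero N] {χ : DirichletCharacter R N}
    (hχ : χ.IsPrimitive) (hq : χ ^ 2 = 1) {ψ : AddChar (ZMod N) R} (hψ : ψ.IsPrimitive) :
    gaussSum χ ψ ^ 2 = χ (-1) * N := by
  have hinv : χ⁻¹ = χ := by
    rw [inv_eq_iff_mul_eq_one, ← sq, hq]
  have h1 : gaussSum χ ψ ^ 2 = ∑ a, ψ a * gaussSum χ (ψ.mulShift a) := by
    rw [sq]
    conv_lhs => enter [1]; rw [gaussSum]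
    rw [Finset.sum_mul]
    refine Finset.sum_congr rfl fun a _ => ?_
    rw [gaussSum_mulShift_of_isPrimitive ψ hχ, hinv]; ring
  rw [h1]
  simp only [gaussSum, Finset.mul_sum, AddChar.mulShift_apply]
  rw [Finset.sum_comm]
  have h2 : ∀ b : ZMod N, ∑ a, ψ a * (χ b * ψ (a * b)) = χ b * if b = -1 then (N : R) else 0 := by
    intro b
    have h3 := AddChar.sum_mulShift (b + 1) hψ
    rw [ZMod.card] at h3
    simp only [← eq_neg_iff_add_eq_zero] at h3
    have : (if b = -1 then (N : R) else 0) = ((if b = -1 then N else 0 : ℕ) : R) := by split_ifs <;> simp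
    rw [this, ← h3, Finset.mul_sum]
    refine Finset.sum_congr rfl fun a _ => ?_
    rw [mul_add, mul_one, AddChar.map_add_eq_mul]; ring
  simp [h2]

lemma aux_quad_values {N : ℕ} {χ : DirichletCharacter ℂ N} (hq : χ ^ 2 = 1) (a : ZMod N) (ha : IsUnit a) :
    χ a = 1 ∨ χ a = -1 := by
  have : (χ ^ 2) a = 1 := by rw [hq, MulChar.one_apply ha]
  rw [MulChar.pow_apply' _ two_ne_zero] at this
  have h : (χ a - 1) * (χ a + 1) = 0 := by linear_combination this
  rcases mul_eq_zero.mp h with h | h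
  · exact Or.inl (sub_eq_zero.mp h)
  · exact Or.inr (eq_neg_of_add_eq_zero_left h)

/-- integer version of a quadratic character -/
lemma aux_int_char {N : ℕ} {χ : DirichletCharacter ℂ N} (hq : χ ^ 2 = 1) :
    ∃ χ' : MulChar (ZMod N) ℤ, χ'.IsQuadratic ∧ ∀ a, ((χ' a : ℤ) : ℂ) = χ a := by
  classical
  have hv : ∀ a, χ a = 0 ∨ χ a = 1 ∨ χ a = -1 := by
    intro a
    by_cases ha : IsUnit a
    · exact Or.inr (aux_quad_values hq a ha)
    · exact Or.inl (MulChar.map_nonunit _ ha)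
  let f : ZMod N → ℤ := fun a => if χ a = 0 then 0 else if χ a = 1 then 1 else -1
  have hf : ∀ a, ((f a : ℤ) : ℂ) = χ a := by
    intro a
    rcases hv a with h | h | h
    · simp [f, h]
    · simp [f, h]
    · have : (-1 : ℂ) ≠ 1 := by norm_num
      simp [f, h, this]
  refine ⟨⟨⟨⟨f, ?_⟩, ?_⟩, ?_⟩, ?_, hf⟩
  · apply Int.cast_injective (α := ℂ); simp [hf]
  · intro x y; apply Int.cast_injective (α := ℂ)
    push_cast
    simp [hf]
  · intro a ha
    apply Int.cast_injective (α := ℂ)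
    change ((f a : ℤ) : ℂ) = _
    rw [hf, MulChar.map_nonunit _ ha]; simp
  · intro a
    change f a = 0 ∨ f a = 1 ∨ f a = -1
    simp only [f]; split_ifs <;> simp

lemma aux_recip {N p : ℕ} [NeZero N] [Fact p.Prime] (hp2 : p ≠ 2) (hpN : ¬ p ∣ N)
    {χ : DirichletCharacter ℂ N} (hχ : χ.IsPrimitive) (hq : χ ^ 2 = 1) (s : ℤ) (hs : (s : ℂ) = χ (-1)) :
    ((legendreSym p (s * N) : ℤ) : ℂ) = χ p := by
  have hpp : p.Prime := Fact.out
  obtain ⟨χ', hχ'q, hχ'⟩ := aux_int_char hq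
  let F := AlgebraicClosure (ZMod p)
  haveI : CharP F p := charP_of_injective_algebraMap (algebraMap (ZMod p) F).injective p
  have hF2 : ringChar F ≠ 2 := by rw [ringChar.eq F p]; exact hp2
  haveI : NeZero ((N : ℕ) : F) := ⟨by rwa [Ne, CharP.cast_eq_zero_iff F p]⟩
  obtain ⟨ζ, hζ⟩ := HasEnoughRootsOfUnity.exists_primitiveRoot F N
  let ψ : AddChar (ZMod N) F := AddChar.zmodChar N ((IsPrimitiveRoot.iff_def ζ N).mp hζ).left
  have hψ : ψ.IsPrimitive := AddChar.zmodChar_primitive_of_primitive_root N hζ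
  let χF : DirichletCharacter F N := χ'.ringHomComp (Int.castRingHom F)
  have hχFq : χF.IsQuadratic := hχ'q.comp _
  have hne : (-1 : F) ≠ 1 := by
    exact Ring.neg_one_ne_one_of_char_ne_two hF2
  have hχF : ∀ a, χF a = ((χ' a : ℤ) : F) := fun a => rfl
  have hprimF : χF.IsPrimitive := by
    rw [aux_prim_iff] at hχ ⊢
    intro d hd h
    refine hχ d hd fun a ha had => ?_
    have h1 := h a ha had
    rw [hχF] at h1
    rw [← hχ']
    rcases hχ'q (a : ZMod N) with h2 | h2 | h2
    · rw [h2] at h1; simp at h1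
    · rw [h2]; simp
    · rw [h2] at h1; push_cast at h1; exact absurd h1 hne
  have hsq := aux_gauss_sq hprimF hχFq.sq_eq_one hψ
  have hunit : IsUnit (p : ZMod N) := by
    rw [ZMod.isUnit_iff_coprime]
    exact (Nat.Prime.coprime_iff_not_dvd hpp).mpr hpN
  have h := Char.card_pow_char_pow hχFq ψ p 1 hunit hp2 (by rw [ZMod.card]; exact hsq)
  rw [pow_one, pow_one, ZMod.card, hχF, hχF] at h
  have hs' : χ' (-1) = s := by
    apply Int.cast_injective (α := ℂ); rw [hχ', hs]
  rw [hs'] at h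
  have h3 := congrArg (algebraMap (ZMod p) F) (legendreSym.eq_pow p (s * N))
  rw [map_intCast, map_pow, map_intCast] at h3
  push_cast at h3
  rw [h] at h3
  rw [← hχ']
  congr 1
  have hu : χ' p = 1 ∨ χ' p = -1 := by
    rcases hχ'q (p : ZMod N) with h2 | h2
    · exfalso
      have := (hunit.map χ').ne_zero
      exact this h2
    · exact h2
  have hl : legendreSym p (s * N) = 0 ∨ legendreSym p (s * N) = 1 ∨ legendreSym p (s * N) = -1 := quadraticChar_isQuadratic _ _
  rcases hu with hu | hu <;> rcases hl with hl | hl | hl <;> rw [hu, hl] at h3 <;> rw [hu, hl] <;> exfalso <;> push_cast at h3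
  · simp at h3
  · exact hne h3
  · simp at h3
  · exact hne h3.symm


lemma aux_crt_split {m n : ℕ} [NeZero m] [NeZero n] (h : m.Coprime n) (χ : DirichletCharacter ℂ (m * n)) :
    ∃ (χ1 : DirichletCharacter ℂ m) (χ2 : DirichletCharacter ℂ n),
      ∀ a : ℤ, χ a = χ1 a * χ2 a := by
  let e := ZMod.chineseRemainder h
  have hu : ∀ x : ZMod m × ZMod n, ¬ IsUnit x → χ (e.symm x) = 0 := by
    intro x hx
    apply MulChar.map_nonunit
    intro h1
    apply hx
    have := h1.map e
    simpa using this
  let χ1 : DirichletCharacter ℂ m :=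
    { toFun := fun a => χ (e.symm (a, 1))
      map_one' := by
        have : ((1, 1) : ZMod m × ZMod n) = 1 := rfl
        rw [this, map_one, map_one]
      map_mul' := fun x y => by
        rw [← map_mul, ← map_mul]; simp
      map_nonunit' := fun a ha => by
        apply hu
        rw [Prod.isUnit_iff]; exact fun h => ha h.1 }
  let χ2 : DirichletCharacter ℂ n :=
    { toFun := fun a => χ (e.symm (1, a))
      map_one' := by
        have : ((1, 1) : ZMod m × ZMod n) = 1 := rfl
        rw [this, map_one, map_one]
      map_mul' := fun x y => by
        rw [← map_mul, ← map_mul]; simp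
      map_nonunit' := fun a ha => by
        apply hu
        rw [Prod.isUnit_iff]; exact fun h => ha h.2 }
  refine ⟨χ1, χ2, fun a => ?_⟩
  change χ a = χ (e.symm (a, 1)) * χ (e.symm (1, a))
  rw [← map_mul, ← map_mul]
  congr 1
  rw [RingEquiv.eq_symm_apply, map_intCast]
  ext <;> simp

lemma aux_gauss_crt {m n : ℕ} [NeZero m] [NeZero n] (h : m.Coprime n) {χ : DirichletCharacter ℂ (m * n)}
    {χ1 : DirichletCharacter ℂ m} {χ2 : DirichletCharacter ℂ n} (hχ : ∀ a : ℤ, χ a = χ1 a * χ2 a) :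
    gaussSum χ ZMod.stdAddChar = χ1 n * χ2 m * gaussSum χ1 ZMod.stdAddChar * gaussSum χ2 ZMod.stdAddChar := by
  let e := ZMod.chineseRemainder h
  let u : (ZMod m × ZMod n)ˣ := MulEquiv.prodUnits.symm (ZMod.unitOfCoprime n h.symm, ZMod.unitOfCoprime m h)
  have hu : ∀ x : ZMod m × ZMod n, u.mulLeft x = (n * x.1, m * x.2) := fun x => rfl
  have key : ∀ x : ZMod m × ZMod n, e.symm (u.mulLeft x) = ((n * x.1.val + m * x.2.val : ℤ) : ZMod (m * n)) := by
    intro x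
    rw [RingEquiv.symm_apply_eq, map_intCast, hu]
    ext <;> simp
  have hm : (m : ℂ) ≠ 0 := Nat.cast_ne_zero.mpr (NeZero.ne m)
  have hn : (n : ℂ) ≠ 0 := Nat.cast_ne_zero.mpr (NeZero.ne n)
  have hstd : ∀ (k : ℕ) [NeZero k] (x : ZMod k), ZMod.stdAddChar x = cexp (2 * Real.pi * I * x.val / k) := by
    intro k _ x
    have := ZMod.stdAddChar_coe (N := k) (x.val : ℤ)
    simpa using this
  unfold gaussSum
  rw [← Equiv.sum_comp (u.mulLeft.trans e.symm.toEquiv)]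
  rw [Fintype.sum_prod_type, mul_assoc, Finset.sum_mul_sum, Finset.mul_sum]
  refine Finset.sum_congr rfl fun a _ => ?_
  rw [Finset.mul_sum]
  refine Finset.sum_congr rfl fun b _ => ?_
  change χ (e.symm (u.mulLeft (a, b))) * ZMod.stdAddChar (e.symm (u.mulLeft (a, b))) = _
  rw [key, hχ, ZMod.stdAddChar_coe, hstd m a, hstd n b]
  have h1 : cexp (2 * Real.pi * I * ((n * a.val + m * b.val : ℤ) : ℂ) / ((m * n : ℕ) : ℂ)) =
      cexp (2 * Real.pi * I * a.val / m) * cexp (2 * Real.pi * I * b.val / n) := by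
    rw [← Complex.exp_add]; congr 1; push_cast; field_simp
  rw [h1]
  simp only [Int.cast_add, Int.cast_mul, Int.cast_natCast, ZMod.natCast_val, CharP.cast_eq_zero, zero_mul,
    add_zero, zero_add, ZMod.cast_id, map_mul, id]
  have h2 : ((n : ZMod m) * (a.val : ZMod m)) = n * a := by simp
  simp
  ring

lemma aux_crt_prim {m n : ℕ} [NeZero m] [NeZero n] (h : m.Coprime n) {χ : DirichletCharacter ℂ (m * n)}
    {χ1 : DirichletCharacter ℂ m} {χ2 : DirichletCharacter ℂ n} (hχ : ∀ a : ℤ, χ a = χ1 a * χ2 a)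
    (hp : χ.IsPrimitive) : χ1.IsPrimitive ∧ χ2.IsPrimitive := by
  rw [aux_prim_iff] at hp ⊢
  rw [aux_prim_iff]
  have hm := NeZero.pos m
  have hn := NeZero.pos n
  constructor
  · intro d hd hda
    have := hp (d * n) (mul_dvd_mul_right hd n) fun a ha had => by
      have h1 : (a : ZMod n) = 1 := by
        simpa using (ZMod.natCast_eq_natCast_iff a 1 n).mpr (had.of_mul_left d)
      have h2 := hda a ha.coprime_mul_right_right (had.of_mul_right n)
      have := hχ a
      simp only [Int.cast_natCast] at this
      rw [this, h1, h2, map_one, one_mul]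
    exact Nat.eq_of_mul_eq_mul_right hn this
  · intro d hd hda
    have := hp (m * d) (mul_dvd_mul_left m hd) fun a ha had => by
      have h1 : (a : ZMod m) = 1 := by
        simpa using (ZMod.natCast_eq_natCast_iff a 1 m).mpr (had.of_mul_right d)
      have h2 := hda a ha.coprime_mul_left_right (had.of_mul_left m)
      have := hχ a
      simp only [Int.cast_natCast] at this
      rw [this, h1, h2, map_one, one_mul]
    exact Nat.eq_of_mul_eq_mul_left hm this

lemma aux_crt_quad {m n : ℕ} [NeZero m] [NeZero n] (h : m.Coprime n) {χ : DirichletCharacter ℂ (m * n)}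
    {χ1 : DirichletCharacter ℂ m} {χ2 : DirichletCharacter ℂ n} (hχ : ∀ a : ℤ, χ a = χ1 a * χ2 a)
    (hq : χ ^ 2 = 1) : χ1 ^ 2 = 1 ∧ χ2 ^ 2 = 1 := by
  have key : ∀ (u : (ZMod m)ˣ) (v : (ZMod n)ˣ), (χ1 u * χ2 v) ^ 2 = 1 := by
    intro u v
    let e := ZMod.chineseRemainder h
    have hw : IsUnit (e.symm ((u : ZMod m), (v : ZMod n))) := by
      apply IsUnit.map
      rw [Prod.isUnit_iff]; exact ⟨u.isUnit, v.isUnit⟩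
    set w := e.symm ((u : ZMod m), (v : ZMod n)) with hwd
    obtain ⟨z, hz⟩ := ZMod.intCast_surjective w
    have h1 : e (z : ZMod (m * n)) = ((u : ZMod m), (v : ZMod n)) := by rw [hz, hwd]; simp
    rw [map_intCast] at h1
    have h2 : (z : ZMod m) = u := by simpa using congrArg Prod.fst h1
    have h3 : (z : ZMod n) = v := by simpa using congrArg Prod.snd h1
    rw [← h2, ← h3, ← hχ, hz, ← MulChar.pow_apply' _ two_ne_zero, hq, MulChar.one_apply hw]
  constructor
  · ext u
    have := key u 1
    rw [MulChar.pow_apply' _ two_ne_zero, MulChar.one_apply u.isUnit]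
    simpa using this
  · ext u
    have := key 1 u
    rw [MulChar.pow_apply' _ two_ne_zero, MulChar.one_apply u.isUnit]
    simpa using this

lemma aux_prime_legendre {p : ℕ} [Fact p.Prime] (hp2 : p ≠ 2) {χ : DirichletCharacter ℂ p}
    (hq : χ ^ 2 = 1) (h1 : χ ≠ 1) (a : ZMod p) : χ a = ((quadraticChar (ZMod p) a : ℤ) : ℂ) := by
  let η : DirichletCharacter ℂ p := (quadraticChar (ZMod p)).ringHomComp (Int.castRingHom ℂ)
  have hη : ∀ a, η a = ((quadraticChar (ZMod p) a : ℤ) : ℂ) := fun a => rfl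
  have hchar : ringChar (ZMod p) ≠ 2 := by rwa [ZMod.ringChar_zmod_n]
  have hηq : η ^ 2 = 1 := ((quadraticChar_isQuadratic (ZMod p)).comp _).sq_eq_one
  have hη1 : η ≠ 1 := by
    intro h
    obtain ⟨a, ha⟩ := quadraticChar_exists_neg_one hchar
    have h2 := hη a
    have hau : IsUnit a := by
      by_contra hc
      rw [MulChar.map_nonunit _ hc] at ha; norm_num at ha
    rw [ha, h, MulChar.one_apply hau] at h2
    norm_num at h2
  obtain ⟨g, hg⟩ := IsCyclic.exists_generator (α := (ZMod p)ˣ)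
  have hval : ∀ θ : DirichletCharacter ℂ p, θ ^ 2 = 1 → θ ≠ 1 → θ g = -1 := by
    intro θ h2 h3
    rcases aux_quad_values h2 g g.isUnit with h4 | h4
    · exfalso; apply h3
      rw [MulChar.eq_iff hg, h4, MulChar.one_apply g.isUnit]
    · exact h4
  have : χ = η := by
    rw [MulChar.eq_iff hg, hval χ hq h1, hval η hηq hη1]
  rw [this, hη]

lemma aux_prime_gauss {p : ℕ} [Fact p.Prime] (hp2 : p ≠ 2) {χ : DirichletCharacter ℂ p}
    (hq : χ ^ 2 = 1) (h1 : χ ≠ 1) :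
    gaussSum χ ZMod.stdAddChar = √p * (if χ (-1) = 1 then 1 else I) := by
  have hpp : p.Prime := Fact.out
  have hchar : ringChar (ZMod p) ≠ 2 := by rwa [ZMod.ringChar_zmod_n]
  have hs : gaussSum χ ZMod.stdAddChar = ∑ x : ZMod p, ZMod.stdAddChar (x ^ 2) := by
    have h2 : ∑ x : ZMod p, ZMod.stdAddChar (x ^ 2) =
        ∑ a : ZMod p, (((quadraticChar (ZMod p) a + 1 : ℤ) : ℂ)) * ZMod.stdAddChar a := by
      rw [← Finset.sum_fiberwise_of_maps_to (g := fun x : ZMod p => x ^ 2) (t := Finset.univ)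
        (fun _ _ => Finset.mem_univ _)]
      refine Finset.sum_congr rfl fun a _ => ?_
      rw [← quadraticChar_card_sqrts hchar a]
      rw [Finset.sum_congr rfl (g := fun _ => (ZMod.stdAddChar a : ℂ)) (fun x hx => by
        rw [(Finset.mem_filter.mp hx).2]), Finset.sum_const, nsmul_eq_mul]
      congr 2
      push_cast
      congr 2
      ext x; simp
    rw [h2]
    have h3 : ∑ a : ZMod p, (ZMod.stdAddChar a : ℂ) = 0 := by
      apply AddChar.sum_eq_zero_of_ne_one
      have := ZMod.isPrimitive_stdAddChar p (a := 1) one_ne_zero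
      simpa using this
    simp only [Int.cast_add, Int.cast_one, add_mul, one_mul, Finset.sum_add_distrib, h3, add_zero]
    unfold gaussSum
    exact Finset.sum_congr rfl fun a _ => by rw [aux_prime_legendre hp2 hq h1]
  rw [hs, aux_quadratic_gauss p]
  congr 1
  rw [aux_prime_legendre hp2 hq h1, quadraticChar_neg_one hchar, ZMod.card]
  have hodd := hpp.eq_two_or_odd.resolve_left hp2
  have hI : (1 - I : ℂ) ≠ 0 := by
    intro h; have := congrArg Complex.re h; simp at this
  have hp4 : p = 4 * (p / 4) + p % 4 := by omega
  have hI4 : (-I) ^ 4 = (1 : ℂ) := by rw [neg_pow, I_pow_four]; norm_num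
  have h5 : (-I) ^ p = (-I) ^ (p % 4) := by
    conv_lhs => rw [hp4]
    rw [pow_add, pow_mul, hI4, one_pow, one_mul]
  rw [h5, ZMod.χ₄_nat_mod_four]
  have : p % 4 = 1 ∨ p % 4 = 3 := by omega
  rcases this with h | h <;> rw [h]
  · have : ZMod.χ₄ ((1 : ℕ) : ZMod 4) = 1 := by decide
    rw [this, pow_one]
    field_simp
    simp [sub_eq_add_neg]
  · have : ZMod.χ₄ ((3 : ℕ) : ZMod 4) = -1 := by decide
    rw [this]
    have h6 : ¬ (((-1 : ℤ) : ℂ) = 1) := by norm_num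
    rw [if_neg h6, div_eq_iff hI]
    have : (-I) ^ 3 = I := by rw [neg_pow, I_pow_three]; norm_num
    rw [this, mul_sub, I_mul_I]; ring


lemma aux_not_sq {N p : ℕ} [NeZero N] (hp : p.Prime) (hp2 : p ≠ 2) {χ : DirichletCharacter ℂ N}
    (hχ : χ.IsPrimitive) (hq : χ ^ 2 = 1) : ¬ p * p ∣ N := by
  rintro ⟨k, hk⟩
  have hN := NeZero.pos N
  have h := (aux_prim_iff χ).mp hχ (p * k) ⟨p, by rw [hk]; ring⟩ fun a ha had => by
    obtain ⟨t, ht⟩ := Nat.modEq_iff_dvd.mp had.symm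
    have hN0 : ((p : ZMod N) * p * k) = 0 := by
      have h1 : ((p * p * k : ℕ) : ZMod N) = 0 := (congrArg Nat.cast hk.symm).trans (ZMod.natCast_self N)
      simpa using h1
    have ha1 : (a : ZMod N) = 1 + p * k * t := by
      have := congrArg (Int.cast : ℤ → ZMod N) ht
      push_cast at this
      linear_combination this
    have hx2 : ((p : ZMod N) * k * t) * (p * k * t) = 0 := by
      linear_combination (k * t ^ 2 : ZMod N) * hN0
    have hpow : ∀ j : ℕ, (1 + (p : ZMod N) * k * t) ^ j = 1 + j * (p * k * t) := by
      intro j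
      induction j with
      | zero => simp
      | succ j ih =>
        rw [pow_succ, ih]; push_cast
        linear_combination (j : ZMod N) * hx2
    have hap : (a : ZMod N) ^ p = 1 := by
      rw [ha1, hpow]; linear_combination (t : ZMod N) * hN0
    have hca : χ a ^ p = 1 := by rw [← map_pow, hap, map_one]
    rcases aux_quad_values hq a ((ZMod.isUnit_iff_coprime a N).mpr ha) with h | h
    · exact h
    · rw [h, (hp.odd_of_ne_two hp2).neg_one_pow] at hca
      norm_num at hca
  rw [hk] at hN h
  have hpk : 0 < p * k := by
    rw [mul_assoc] at hN
    exact Nat.pos_of_mul_pos_left hN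
  have := hp.two_le
  nlinarith

lemma aux_not_sixteen {N : ℕ} [NeZero N] {χ : DirichletCharacter ℂ N}
    (hχ : χ.IsPrimitive) (hq : χ ^ 2 = 1) : ¬ 16 ∣ N := by
  rintro ⟨k, hk⟩
  have hN := NeZero.pos N
  have h := (aux_prim_iff χ).mp hχ (8 * k) ⟨2, by rw [hk]; ring⟩ fun a ha had => by
    obtain ⟨t, ht⟩ := Nat.modEq_iff_dvd.mp had.symm
    have hN0 : ((16 : ZMod N) * k) = 0 := by
      have h1 : ((16 * k : ℕ) : ZMod N) = 0 := (congrArg Nat.cast hk.symm).trans (ZMod.natCast_self N)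
      simpa using h1
    have ha1 : (a : ZMod N) = (1 + 4 * k * t) ^ 2 := by
      have := congrArg (Int.cast : ℤ → ZMod N) ht
      push_cast at this
      linear_combination this - (k * t ^ 2 : ZMod N) * hN0
    have hu : IsUnit ((1 + 4 * k * t) : ZMod N) := by
      have := (ZMod.isUnit_iff_coprime a N).mpr ha
      rw [ha1] at this
      exact (isUnit_pow_iff two_ne_zero).mp this
    rw [ha1, map_pow, ← MulChar.pow_apply' _ two_ne_zero, hq, MulChar.one_apply hu]
  omega

lemma aux_std_pow {N : ℕ} [NeZero N] (k : ℕ) :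
    (ZMod.stdAddChar (k : ZMod N) : ℂ) = (ZMod.stdAddChar (1 : ZMod N) : ℂ) ^ k := by
  rw [← AddChar.map_nsmul_eq_pow]; simp

lemma aux_std_one {N : ℕ} [NeZero N] :
    (ZMod.stdAddChar (1 : ZMod N) : ℂ) = cexp (2 * Real.pi * I / N) := by
  have := ZMod.stdAddChar_coe (N := N) 1
  simpa using this

lemma aux_gauss_four {χ : DirichletCharacter ℂ 4} (hχ : χ.IsPrimitive) (hq : χ ^ 2 = 1) :
    gaussSum χ ZMod.stdAddChar = √(4 : ℕ) * (if χ (-1) = 1 then 1 else I) := by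
  have h3 : χ 3 = -1 := by
    rcases aux_quad_values hq 3 (by decide) with h | h
    · exfalso
      have := (aux_prim_iff χ).mp hχ 1 (by norm_num) fun a ha _ => by
        have hu := (ZMod.isUnit_iff_coprime a 4).mpr ha
        have : ∀ x : ZMod 4, IsUnit x → x = 1 ∨ x = 3 := by decide
        rcases this _ hu with h' | h' <;> rw [h']
        · simp
        · exact h
      norm_num at this
    · exact h
  have hm : (-1 : ZMod 4) = 3 := by decide
  have h0 : χ 0 = 0 := MulChar.map_nonunit _ (by decide)
  have h2 : χ 2 = 0 := MulChar.map_nonunit _ (by decide)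
  have hz : (ZMod.stdAddChar (1 : ZMod 4) : ℂ) = I := by
    rw [aux_std_one]; refine Eq.trans ?_ Complex.exp_pi_div_two_mul_I; congr 1; push_cast; ring
  have hz3 := aux_std_pow (N := 4) 3
  rw [hz, I_pow_three] at hz3
  unfold gaussSum
  have : ∀ f : ZMod 4 → ℂ, ∑ a, f a = f 0 + f 1 + f 2 + f 3 := fun f => Fin.sum_univ_four f
  rw [this, h0, h2, map_one, h3, hz, hm, h3]
  have hz3' : (ZMod.stdAddChar (3 : ZMod 4) : ℂ) = -I := by simpa using hz3
  rw [hz3', if_neg (by norm_num)]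
  have : √((4 : ℕ) : ℝ) = 2 := by
    rw [show ((4 : ℕ) : ℝ) = 2 ^ 2 by norm_num, Real.sqrt_sq (by norm_num)]
  rw [this]; push_cast; ring

lemma aux_gauss_eight {χ : DirichletCharacter ℂ 8} (hχ : χ.IsPrimitive) (hq : χ ^ 2 = 1) :
    gaussSum χ ZMod.stdAddChar = √(8 : ℕ) * (if χ (-1) = 1 then 1 else I) := by
  have h5 : χ 5 = -1 := by
    rcases aux_quad_values hq 5 (by decide) with h | h
    · exfalso
      have := (aux_prim_iff χ).mp hχ 4 (by norm_num) fun a ha had => by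
        have : (a : ZMod 8) = 1 ∨ (a : ZMod 8) = 5 := by
          have h8 : a % 8 = 1 ∨ a % 8 = 5 := by
            have : a % 4 = 1 := had
            omega
          rw [← ZMod.natCast_mod a 8]
          rcases h8 with h8 | h8 <;> rw [h8] <;> simp
        rcases this with h' | h' <;> rw [h']
        · simp
        · exact h
      norm_num at this
    · exact h
  have hm : (-1 : ZMod 8) = 7 := by decide
  have h0 : χ 0 = 0 := MulChar.map_nonunit _ (by decide)
  have h2 : χ 2 = 0 := MulChar.map_nonunit _ (by decide)
  have h4 : χ 4 = 0 := MulChar.map_nonunit _ (by decide)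
  have h6 : χ 6 = 0 := MulChar.map_nonunit _ (by decide)
  have h7 : χ 7 = - χ 3 := by
    have : (7 : ZMod 8) = 3 * 5 := by decide
    rw [this, map_mul, h5]; ring
  set ζ : ℂ := ZMod.stdAddChar (1 : ZMod 8) with hζ
  have hz : ζ = √2 / 2 * (1 + I) := by
    rw [hζ, aux_std_one]
    have : 2 * (Real.pi : ℂ) * I / ((8 : ℕ) : ℂ) = ((Real.pi / 4 : ℝ) : ℂ) * I := by push_cast; ring
    rw [this, Complex.exp_mul_I, ← Complex.ofReal_cos, ← Complex.ofReal_sin, Real.cos_pi_div_four,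
      Real.sin_pi_div_four]
    push_cast; ring
  have hs2 : ((√2 : ℝ) : ℂ) ^ 2 = 2 := by
    rw [← ofReal_pow, Real.sq_sqrt (by norm_num)]; norm_num
  have hζ2 : ζ ^ 2 = I := by
    rw [hz]
    linear_combination ((1 + I) ^ 2 / 4) * hs2 + (1 / 2 : ℂ) * I_sq
  have hz3 : (ZMod.stdAddChar (3 : ZMod 8) : ℂ) = ζ * I := by
    have := aux_std_pow (N := 8) 3
    rw [← hζ, pow_succ, hζ2] at this
    rw [mul_comm]; simpa using this
  have hz5 : (ZMod.stdAddChar (5 : ZMod 8) : ℂ) = - ζ := by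
    have := aux_std_pow (N := 8) 5
    rw [← hζ, show ζ ^ 5 = (ζ ^ 2) ^ 2 * ζ by ring, hζ2, I_sq] at this
    simpa using this
  have hz7 : (ZMod.stdAddChar (7 : ZMod 8) : ℂ) = - ζ * I := by
    have := aux_std_pow (N := 8) 7
    rw [← hζ, show ζ ^ 7 = (ζ ^ 2) ^ 3 * ζ by ring, hζ2, I_pow_three] at this
    rw [show -ζ * I = -I * ζ by ring]
    simpa using this
  unfold gaussSum
  have : ∀ f : ZMod 8 → ℂ, ∑ a, f a = f 0 + f 1 + f 2 + f 3 + f 4 + f 5 + f 6 + f 7 :=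
    fun f => Fin.sum_univ_eight f
  rw [this, h0, h2, h4, h6, map_one, h5, hm, h7, hz3, hz5, hz7, ← hζ]
  have h8 : √((8 : ℕ) : ℝ) = 2 * √2 := by
    rw [show ((8 : ℕ) : ℝ) = 2 ^ 2 * 2 by norm_num, Real.sqrt_mul (by norm_num), Real.sqrt_sq (by norm_num)]
  rw [h8, hz]
  push_cast
  rcases aux_quad_values hq 3 (by decide) with h | h
  · rw [h, if_neg (by norm_num)]
    linear_combination (√2 : ℂ) * I_sq
  · rw [h, if_pos (by norm_num)]
    linear_combination (-√2 : ℂ) * I_sq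

theorem aux_gauss_sign (N : ℕ) : ∀ [NeZero N] (χ : DirichletCharacter ℂ N), χ.IsPrimitive → χ ^ 2 = 1 →
    gaussSum χ ZMod.stdAddChar = √N * (if χ (-1) = 1 then 1 else I) := by
  induction N using Nat.strong_induction_on with
  | _ N ih =>
  intro _ χ hχ hq
  rcases Nat.eq_two_pow_or_exists_odd_prime_and_dvd N with ⟨k, hk⟩ | ⟨p, hp, hpN, hpodd⟩
  · have hk4 : k < 4 := by
      by_contra hc
      apply aux_not_sixteen hχ hq
      rw [hk]
      exact pow_dvd_pow 2 (show 4 ≤ k by omega)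
    interval_cases k
    · subst hk
      have : ∀ x : ZMod (2 ^ 0), x = 1 := by decide
      rw [this (-1), map_one, if_pos rfl]
      unfold gaussSum
      have h2 : ∀ f : ZMod (2 ^ 0) → ℂ, ∑ a, f a = f 0 := fun f => Fin.sum_univ_one f
      rw [h2, AddChar.map_zero_eq_one, this 0, map_one]; simp
    · exfalso
      subst hk
      have := (aux_prim_iff χ).mp hχ 1 (by norm_num) fun a ha _ => by
        have hu := (ZMod.isUnit_iff_coprime a _).mpr ha
        have : ∀ x : ZMod (2 ^ 1), IsUnit x → x = 1 := by decide
        rw [this _ hu]; simp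
      norm_num at this
    · have : N = 4 := hk
      subst this
      exact aux_gauss_four hχ hq
    · have : N = 8 := hk
      subst this
      exact aux_gauss_eight hχ hq
  · have hp2 : p ≠ 2 := by rintro rfl; exact absurd hpodd (by decide)
    obtain ⟨m, rfl⟩ := hpN
    have hpm : ¬ p ∣ m := fun h => aux_not_sq hp hp2 hχ hq (mul_dvd_mul_left p h)
    have hco : p.Coprime m := (Nat.Prime.coprime_iff_not_dvd hp).mpr hpm
    have hm : m ≠ 0 := by rintro rfl; exact hpm (dvd_zero p)
    have : NeZero m := ⟨hm⟩
    have : Fact p.Prime := ⟨hp⟩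
    obtain ⟨χ1, χ2, h12⟩ := aux_crt_split hco χ
    obtain ⟨hP1, hP2⟩ := aux_crt_prim hco h12 hχ
    obtain ⟨hQ1, hQ2⟩ := aux_crt_quad hco h12 hq
    have hne : χ1 ≠ 1 := by
      rintro rfl
      have h1 := (DirichletCharacter.isPrimitive_def _).mp hP1
      rw [DirichletCharacter.conductor_one] at h1
      · exact hp.one_lt.ne h1
    have hI := ih m (by have := hp.two_le; have := Nat.pos_of_ne_zero hm; nlinarith) χ2 hP2 hQ2
    have hneg : χ (-1) = χ1 (-1) * χ2 (-1) := by
      have := h12 (-1); simpa using this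
    rw [aux_gauss_crt hco h12, hI, aux_prime_gauss hp2 hQ1 hne, hneg]
    have hsq : ((√((p * m : ℕ) : ℝ) : ℝ) : ℂ) = √(p : ℝ) * √(m : ℝ) := by
      push_cast; rw [Real.sqrt_mul (by positivity)]; push_cast; rfl
    rw [hsq]
    have hleg : ∀ a : ℤ, ((legendreSym p a : ℤ) : ℂ) = χ1 a := fun a => by
      rw [aux_prime_legendre hp2 hQ1 hne]; rfl
    have hunit : IsUnit (m : ZMod p) := (ZMod.isUnit_iff_coprime m p).mpr hco.symm
    have h1m : χ1 m * χ1 m = 1 := by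
      rcases aux_quad_values hQ1 m hunit with h | h <;> rw [h] <;> norm_num
    rcases aux_quad_values hQ2 (-1) isUnit_one.neg with h2 | h2
    · have hr := aux_recip hp2 hpm hP2 hQ2 1 (by rw [h2]; simp)
      rw [hleg] at hr
      push_cast at hr
      rw [one_mul] at hr
      rw [← hr, h1m, h2]
      simp only [mul_one, if_true]
      ring
    · have hr := aux_recip hp2 hpm hP2 hQ2 (-1) (by rw [h2]; simp)
      rw [hleg] at hr
      push_cast at hr
      rw [map_mul] at hr
      rw [← hr, h2]
      rw [show χ1 m * (χ1 (-1) * χ1 m) = χ1 (-1) * (χ1 m * χ1 m) by ring, h1m]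
      rcases aux_quad_values hQ1 (-1) isUnit_one.neg with h1 | h1
      · rw [h1]
        rw [if_pos rfl, if_neg (by norm_num), if_neg (by norm_num)]
        ring
      · rw [h1]
        rw [if_neg (by norm_num), if_pos (by norm_num)]
        linear_combination (-√(p : ℝ) * √(m : ℝ) : ℂ) * I_sq


lemma aux_hasDerivAt_Gamma {s : ℂ} (hs : 0 < s.re) : HasDerivAt Complex.Gamma (Complex.Gamma s * digamma s) s := by
  have hd : DifferentiableAt ℂ Complex.Gamma s := by
    apply Complex.differentiableAt_Gamma
    rintro m rfl
    simp at hs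
    linarith [(Nat.cast_nonneg m : (0 : ℝ) ≤ m)]
  have := hd.hasDerivAt
  rwa [digamma_def, logDeriv_apply, mul_div_cancel₀ _ (Complex.Gamma_ne_zero_of_re_pos hs)]

lemma aux_hasDerivAt_Gammaℝ {s : ℂ} (hs : 0 < s.re) :
    HasDerivAt Gammaℝ (Gammaℝ s * (digamma (s / 2) / 2 - Complex.log Real.pi / 2)) s := by
  have hpi : (Real.pi : ℂ) ≠ 0 := by exact_mod_cast Real.pi_ne_zero
  have h2 : 0 < (s / 2).re := by
    have : (s / 2).re = s.re / 2 := by simp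
    rw [this]; linarith
  have h1 : HasDerivAt (fun z : ℂ => z / 2) (1 / 2) s := (hasDerivAt_id s).div_const 2
  have h1' : HasDerivAt (fun z : ℂ => -z / 2) (-1 / 2) s := (hasDerivAt_id s).neg.div_const 2
  have h3 := (h1'.const_cpow (c := (Real.pi : ℂ)) (Or.inl hpi)).mul
    ((aux_hasDerivAt_Gamma h2).comp s h1)
  have h4 : Gammaℝ = (fun z : ℂ => (Real.pi : ℂ) ^ (-z / 2)) * (Complex.Gamma ∘ fun z => z / 2) := by
    ext z; simp [Gammaℝ_def]
  rw [h4]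
  refine h3.congr_deriv ?_
  simp only [Pi.mul_apply, Function.comp]
  ring

lemma aux_digamma_sub : digamma (1 / 4) - digamma (3 / 4) = - Real.pi := by
  have hpi : (Real.pi : ℂ) ≠ 0 := by exact_mod_cast Real.pi_ne_zero
  have h1 := aux_hasDerivAt_Gamma (s := 1 / 4) (by norm_num)
  have h2 : HasDerivAt Complex.Gamma (Complex.Gamma (3 / 4) * digamma (3 / 4)) (1 - 1 / 4) := by
    have := aux_hasDerivAt_Gamma (s := 1 - 1 / 4) (by norm_num)
    convert this using 3 <;> norm_num
  have h3 := h1.mul (h2.comp_const_sub 1 (1 / 4))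
  have hs : HasDerivAt (fun z : ℂ => Complex.sin (Real.pi * z)) (Complex.cos (Real.pi * (1 / 4)) * (Real.pi * 1)) (1 / 4) :=
    ((hasDerivAt_id (1 / 4 : ℂ)).const_mul (Real.pi : ℂ)).csin
  have e1 : Complex.sin (Real.pi * (1 / 4)) = ((√2 / 2 : ℝ) : ℂ) := by
    rw [← Real.sin_pi_div_four]; push_cast; congr 1; ring
  have e2 : Complex.cos (Real.pi * (1 / 4)) = ((√2 / 2 : ℝ) : ℂ) := by
    rw [← Real.cos_pi_div_four]; push_cast; congr 1; ring
  have hr0 : ((√2 / 2 : ℝ) : ℂ) ≠ 0 := by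
    have : (√2 / 2 : ℝ) ≠ 0 := by positivity
    exact_mod_cast this
  have h4 := (hasDerivAt_const (1 / 4 : ℂ) (Real.pi : ℂ)).div hs (by rw [e1]; exact hr0)
  have h5 : (Complex.Gamma * fun x => Complex.Gamma (1 - x)) =
      (fun _ => (Real.pi : ℂ)) / (fun z : ℂ => Complex.sin (Real.pi * z)) := by
    ext z; simp [Complex.Gamma_mul_Gamma_one_sub]
  rw [h5] at h3
  have h6 := h3.unique h4
  have h7 := Complex.Gamma_mul_Gamma_one_sub (1 / 4)
  rw [show (1 - 1 / 4 : ℂ) = 3 / 4 by norm_num] at h6 h7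
  rw [e1, e2] at h6
  rw [e1] at h7
  have hG : Complex.Gamma (1 / 4) * Complex.Gamma (3 / 4) ≠ 0 := by
    rw [h7]; exact div_ne_zero hpi hr0
  apply mul_left_cancel₀ hG
  have h8 : Complex.Gamma (1 / 4) * Complex.Gamma (3 / 4) * (digamma (1 / 4) - digamma (3 / 4)) =
    (0 * ((√2 / 2 : ℝ) : ℂ) - ↑Real.pi * (((√2 / 2 : ℝ) : ℂ) * (↑Real.pi * 1))) / ((√2 / 2 : ℝ) : ℂ) ^ 2 := by
    rw [← h6]; ring
  rw [h8, h7]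
  field_simp
  ring

lemma aux_digamma_add : digamma (1 / 4) + digamma (3 / 4) =
    2 * (-2 * Complex.log 2 - Real.eulerMascheroniConstant) - 2 * Complex.log 2 := by
  have h1 := aux_hasDerivAt_Gamma (s := 1 / 4) (by norm_num)
  have h2 : HasDerivAt Complex.Gamma (Complex.Gamma (3 / 4) * digamma (3 / 4)) (1 / 4 + 1 / 2) := by
    have := aux_hasDerivAt_Gamma (s := 1 / 4 + 1 / 2) (by norm_num)
    convert this using 3 <;> norm_num
  have h3 := h1.mul (h2.comp_add_const (1 / 4) (1 / 2))
  have hm : HasDerivAt (fun z : ℂ => 2 * z) (2 * 1) (1 / 4) := (hasDerivAt_id _).const_mul 2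
  have hg : HasDerivAt Complex.Gamma (Complex.Gamma (1 / 2) * digamma (1 / 2)) (2 * (1 / 4)) := by
    have := aux_hasDerivAt_Gamma (s := 2 * (1 / 4)) (by norm_num)
    convert this using 3 <;> norm_num
  have hg2 := hg.comp (1 / 4 : ℂ) hm
  have hm2 : HasDerivAt (fun z : ℂ => 1 - 2 * z) (-(2 * 1)) (1 / 4) := hm.const_sub 1
  have hc := hm2.const_cpow (c := (2 : ℂ)) (Or.inl two_ne_zero)
  have h4 := (hg2.mul hc).mul_const ((√Real.pi : ℝ) : ℂ)
  have h5 : (Complex.Gamma * fun x => Complex.Gamma (x + 1 / 2)) =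
      (fun y => ((Complex.Gamma ∘ fun z : ℂ => 2 * z) * fun z : ℂ => (2 : ℂ) ^ (1 - 2 * z)) y * ((√Real.pi : ℝ) : ℂ)) := by
    ext z; simpa using Complex.Gamma_mul_Gamma_add_half z
  rw [h5] at h3
  have h6 := h3.unique h4
  have h7 := Complex.Gamma_mul_Gamma_add_half (1 / 4)
  simp only [Function.comp] at h6
  rw [show (1 / 4 + 1 / 2 : ℂ) = 3 / 4 by norm_num, show (2 * (1 / 4) : ℂ) = 1 / 2 by norm_num] at h6 h7
  rw [digamma_one_half] at h6
  have hG : Complex.Gamma (1 / 4) * Complex.Gamma (3 / 4) ≠ 0 :=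
    mul_ne_zero (Complex.Gamma_ne_zero_of_re_pos (by norm_num)) (Complex.Gamma_ne_zero_of_re_pos (by norm_num))
  apply mul_left_cancel₀ hG
  have h8 : Complex.Gamma (1 / 4) * Complex.Gamma (3 / 4) * (digamma (1 / 4) + digamma (3 / 4)) = _ := Eq.trans (by ring) h6
  rw [h8, h7]
  ring

lemma aux_rootNumber {N : ℕ} [NeZero N] {χ : DirichletCharacter ℂ N} (hχ : χ.IsPrimitive) (hq : χ ^ 2 = 1) :
    χ.rootNumber = 1 := by
  unfold DirichletCharacter.rootNumber
  rw [aux_gauss_sign N χ hχ hq]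
  have hN : (0 : ℝ) < N := Nat.cast_pos.mpr (NeZero.pos N)
  have h1 : (N : ℂ) ^ (1 / 2 : ℂ) = ((√N : ℝ) : ℂ) := by
    rw [Real.sqrt_eq_rpow, Complex.ofReal_cpow hN.le]; push_cast; rfl
  rw [h1]
  have h2 : ((√N : ℝ) : ℂ) ≠ 0 := by
    have := (Real.sqrt_pos.mpr hN).ne'
    exact_mod_cast this
  by_cases he : χ.Even
  · have : χ (-1) = 1 := he
    rw [if_pos he, if_pos this]; simp [h2]
  · have : ¬ χ (-1) = 1 := he
    rw [if_neg he, if_neg this]; field_simp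

/-- The functional equation forces a relation between value and derivative at the centre. -/
lemma aux_deriv_relation {N : ℕ} [NeZero N] (χ : DirichletCharacter ℂ N) (hprim : χ.IsPrimitive)
    (hquad : χ ^ 2 = 1) (hnontriv : χ ≠ 1) :
    deriv (fun s : ℂ => riemannZeta s * DirichletCharacter.LFunction χ s) (1 / 2) =
      - (riemannZeta (1 / 2) * DirichletCharacter.LFunction χ (1 / 2)) *
        ((Real.log N : ℂ) / 2 - Real.log Real.pi + digamma (1 / 4) / 2 +
          digamma (if χ (-1) = 1 then 1 / 4 else 3 / 4) / 2) := by
  have hN0 : (N : ℂ) ≠ 0 := Nat.cast_ne_zero.mpr (NeZero.ne N)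
  have hinv : χ⁻¹ = χ := by
    rw [inv_eq_iff_mul_eq_one, ← sq, hquad]
  set F : ℂ → ℂ := fun s => riemannZeta s * DirichletCharacter.LFunction χ s with hF
  have hFd : DifferentiableAt ℂ F (1 / 2) :=
    (differentiableAt_riemannZeta (by norm_num)).mul
      (DirichletCharacter.differentiable_LFunction hnontriv _)
  -- derivative of the gamma factor
  obtain ⟨hg0, hgd⟩ : χ.gammaFactor (1 / 2) ≠ 0 ∧ HasDerivAt χ.gammaFactor (χ.gammaFactor (1 / 2) *
      (digamma (if χ (-1) = 1 then 1 / 4 else 3 / 4) / 2 - Complex.log Real.pi / 2)) (1 / 2) := by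
    rcases χ.even_or_odd with he | ho
    · have : χ.gammaFactor = Gammaℝ := funext he.gammaFactor_def
      rw [this, if_pos (show χ (-1) = 1 from he)]
      refine ⟨Gammaℝ_ne_zero_of_re_pos (by norm_num), ?_⟩
      have := aux_hasDerivAt_Gammaℝ (s := 1 / 2) (by norm_num)
      rwa [show (1 / 2 / 2 : ℂ) = 1 / 4 by norm_num] at this
    · have hne : ¬ χ (-1) = 1 := by
        intro h1
        have h2 : χ (-1) = -1 := ho
        rw [h1] at h2; norm_num at h2
      have : χ.gammaFactor = fun s => Gammaℝ (s + 1) := funext ho.gammaFactor_def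
      rw [this, if_neg hne]
      refine ⟨Gammaℝ_ne_zero_of_re_pos (by norm_num), ?_⟩
      have := (aux_hasDerivAt_Gammaℝ (s := 1 / 2 + 1) (by norm_num)).comp_add_const (1 / 2) 1
      rwa [show ((1 / 2 + 1) / 2 : ℂ) = 3 / 4 by norm_num] at this
  have hG := aux_hasDerivAt_Gammaℝ (s := 1 / 2) (by norm_num)
  rw [show (1 / 2 / 2 : ℂ) = 1 / 4 by norm_num] at hG
  have hG0 : Gammaℝ (1 / 2) ≠ 0 := Gammaℝ_ne_zero_of_re_pos (by norm_num)
  have hp : HasDerivAt (fun z : ℂ => (N : ℂ) ^ (z / 2)) ((N : ℂ) ^ ((1 / 2 : ℂ) / 2) * Complex.log N * (1 / 2)) (1 / 2) :=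
    ((hasDerivAt_id (1 / 2 : ℂ)).div_const 2).const_cpow (Or.inl hN0)
  let ξ : ℂ → ℂ := fun s => (N : ℂ) ^ (s / 2) * completedRiemannZeta s * DirichletCharacter.completedLFunction χ s
  have hξsymm : ∀ s, ξ (1 - s) = ξ s := by
    intro s
    simp only [ξ]
    rw [completedRiemannZeta_one_sub, hprim.completedLFunction_one_sub, aux_rootNumber hprim hquad, hinv]
    have : (N : ℂ) ^ ((1 - s) / 2) * (N : ℂ) ^ (s - 1 / 2) = (N : ℂ) ^ (s / 2) := by
      rw [← Complex.cpow_add _ _ hN0]; congr 1; ring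
    rw [← this]; ring
  have hξd : DifferentiableAt ℂ ξ (1 / 2) :=
    (hp.differentiableAt.mul (differentiableAt_completedZeta (by norm_num) (by norm_num))).mul
      (DirichletCharacter.differentiable_completedLFunction hnontriv _)
  have hξ0 : deriv ξ (1 / 2) = 0 := by
    have h1 := hξd.hasDerivAt
    have h2 : HasDerivAt ξ (deriv ξ (1 / 2)) (1 - 1 / 2) := by
      rw [show (1 - 1 / 2 : ℂ) = 1 / 2 by norm_num]; exact h1
    have h3 := h2.comp_const_sub 1 (1 / 2)
    rw [funext hξsymm] at h3
    have := h1.unique h3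
    have h4 : (2 : ℂ) * deriv ξ (1 / 2) = 0 := by linear_combination this
    simpa using h4
  have hN1 : N ≠ 1 := by
    rintro rfl
    exact hnontriv (DirichletCharacter.level_one χ)
  have hprod := ((hp.mul hG).mul hgd).mul hFd.hasDerivAt
  have hev : ξ =ᶠ[𝓝 (1 / 2)] ((((fun z : ℂ => (N : ℂ) ^ (z / 2)) * Gammaℝ) * χ.gammaFactor) * F) := by
    have h1 : ∀ᶠ s : ℂ in 𝓝 (1 / 2), s ≠ 0 := eventually_ne_nhds (by norm_num)
    have h2 := hG.continuousAt.eventually_ne hG0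
    have h3 := hgd.continuousAt.eventually_ne hg0
    filter_upwards [h1, h2, h3] with s h1 h2 h3
    simp only [Pi.mul_apply, ξ, hF]
    rw [riemannZeta_def_of_ne_zero h1, DirichletCharacter.LFunction_eq_completed_div_gammaFactor χ s (Or.inr hN1)]
    field_simp
  have h5 := (hprod.congr_of_eventuallyEq hev).deriv
  rw [hξ0] at h5
  simp only [Pi.mul_apply] at h5
  have hNp : (N : ℂ) ^ ((1 / 2 : ℂ) / 2) ≠ 0 := by
    rw [Complex.cpow_ne_zero_iff_of_exponent_ne_zero (by norm_num)]; exact hN0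
  have hA : (N : ℂ) ^ ((1 / 2 : ℂ) / 2) * Gammaℝ (1 / 2) * χ.gammaFactor (1 / 2) ≠ 0 :=
    mul_ne_zero (mul_ne_zero hNp hG0) hg0
  apply mul_left_cancel₀ hA
  have hlN : ((Real.log N : ℝ) : ℂ) = Complex.log N := by
    rw [Complex.ofReal_log (Nat.cast_nonneg N)]; simp
  have hlp : ((Real.log Real.pi : ℝ) : ℂ) = Complex.log Real.pi := Complex.ofReal_log Real.pi_pos.le
  rw [hlN, hlp]
  change _ = _ * (-F (1 / 2) * _)
  linear_combination -h5

lemma aux_reduce {N : ℕ} [NeZero N] (χ : DirichletCharacter ℂ N) (hprim : χ.IsPrimitive)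
    (hquad : χ ^ 2 = 1) (hnontriv : χ ≠ 1)
    (hE : Real.log N ≠ 2 * Real.log Real.pi + 2 * Real.eulerMascheroniConstant + Real.pi + 6 * Real.log 2)
    (hO : Real.log N ≠ 2 * Real.log Real.pi + 2 * Real.eulerMascheroniConstant + 6 * Real.log 2) :
    riemannZeta (1 / 2) * DirichletCharacter.LFunction χ (1 / 2) = 0 ↔
      deriv (fun s : ℂ => riemannZeta s * DirichletCharacter.LFunction χ s) (1 / 2) = 0 := by
  rw [aux_deriv_relation χ hprim hquad hnontriv]
  have hl2 : Complex.log 2 = ((Real.log 2 : ℝ) : ℂ) := by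
    rw [Complex.ofReal_log (by norm_num)]; simp
  have ha := aux_digamma_add
  have hs := aux_digamma_sub
  rw [hl2] at ha
  have h1 : digamma (1 / 4) = ((-Real.eulerMascheroniConstant - Real.pi / 2 - 3 * Real.log 2 : ℝ) : ℂ) := by
    push_cast; linear_combination (ha + hs) / 2
  have h3 : digamma (3 / 4) = ((-Real.eulerMascheroniConstant + Real.pi / 2 - 3 * Real.log 2 : ℝ) : ℂ) := by
    push_cast; linear_combination (ha - hs) / 2
  have hc : ((Real.log N : ℂ) / 2 - Real.log Real.pi + digamma (1 / 4) / 2 +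
          digamma (if χ (-1) = 1 then 1 / 4 else 3 / 4) / 2) ≠ 0 := by
    split_ifs with he
    · rw [h1]
      intro h
      apply hE
      have h' : Real.log N / 2 - Real.log Real.pi + (-Real.eulerMascheroniConstant - Real.pi / 2 - 3 * Real.log 2) / 2 +
        (-Real.eulerMascheroniConstant - Real.pi / 2 - 3 * Real.log 2) / 2 = 0 := by exact_mod_cast h
      linarith
    · rw [h1, h3]
      intro h
      apply hO
      have h' : Real.log N / 2 - Real.log Real.pi + (-Real.eulerMascheroniConstant - Real.pi / 2 - 3 * Real.log 2) / 2 +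
        (-Real.eulerMascheroniConstant + Real.pi / 2 - 3 * Real.log 2) / 2 = 0 := by exact_mod_cast h
      linarith
  rw [mul_eq_zero_iff_right hc, neg_eq_zero]


lemma aux_log_ratio {n : ℕ} (hn : 0 < n) :
    (1 / n + 1 / (n + 1)) / 2 - (1 / n ^ 2 - 1 / (n + 1) ^ 2) / 12 ≤ Real.log (n + 1) - Real.log n ∧
    Real.log (n + 1) - Real.log n ≤
      (1 / n + 1 / (n + 1)) / 2 - (1 / n ^ 2 - 1 / (n + 1) ^ 2) / 12 +
        ((1 / n ^ 4 - 1 / (n + 1) ^ 4) / 120 : ℝ) := by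
  have hn' : (0 : ℝ) < n := Nat.cast_pos.mpr hn
  set t : ℝ := 1 / (2 * n + 1) with ht
  have ht0 : 0 < t := by positivity
  have ht1 : t < 1 := by rw [ht, div_lt_one (by positivity)]; linarith
  have hnt : (n : ℝ) = (1 - t) / (2 * t) := by rw [ht]; field_simp; ring
  have hlog : Real.log (n + 1) - Real.log n = Real.log (1 + t) - Real.log (1 - t) := by
    have h1 : 1 + t = (n + 1) * (2 * t) := by rw [hnt]; field_simp; ring
    have h2 : 1 - t = n * (2 * t) := by rw [hnt]; field_simp
    rw [h1, h2, Real.log_mul (x := (n : ℝ) + 1) (by positivity) (by positivity),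
      Real.log_mul (x := (n : ℝ)) (by positivity) (by positivity)]
    ring
  rw [hlog]
  have hS := Real.hasSum_log_sub_log_of_abs_lt_one (x := t) (by rw [abs_of_pos ht0]; exact ht1)
  have hlow : 2 * t + 2 / 3 * t ^ 3 ≤ Real.log (1 + t) - Real.log (1 - t) := by
    have := sum_le_hasSum (Finset.range 2) (fun i _ => by positivity) hS
    rw [Finset.sum_range_succ, Finset.sum_range_one] at this
    norm_num at this
    linarith
  have hup : Real.log (1 + t) - Real.log (1 - t) ≤ 2 * t + 2 / 3 * t ^ 3 + 2 / 5 * t ^ 5 * (1 - t ^ 2)⁻¹ := by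
    have h1 := (hasSum_nat_add_iff' 2).mpr hS
    have h2 := (hasSum_geometric_of_lt_one (r := t ^ 2) (by positivity) (by nlinarith)).mul_left (2 / 5 * t ^ 5)
    have h3 := hasSum_le (fun k => by
      have : 2 / 5 * t ^ 5 * (t ^ 2) ^ k = 2 * (1 / 5) * t ^ (2 * (k + 2) + 1) := by
        rw [← pow_mul]; ring
      rw [this]
      apply mul_le_mul_of_nonneg_right _ (by positivity)
      apply mul_le_mul_of_nonneg_left _ (by positivity)
      apply one_div_le_one_div_of_le (by norm_num)
      push_cast
      linarith [(Nat.cast_nonneg k : (0 : ℝ) ≤ k)]) h1 h2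
    rw [Finset.sum_range_succ, Finset.sum_range_one] at h3
    norm_num at h3
    linarith
  have hu : 0 < 1 - t ^ 2 := by nlinarith
  have h1t : 0 < 1 - t := by linarith
  have e1 : (1 / n + 1 / (n + 1)) / 2 - (1 / n ^ 2 - 1 / (n + 1) ^ 2) / 12 =
      (2 * t * (1 - t ^ 2) - 4 / 3 * t ^ 3) / (1 - t ^ 2) ^ 2 := by
    rw [hnt, show (1 - t) / (2 * t) + 1 = (1 + t) / (2 * t) by field_simp; ring,
      show 1 - t ^ 2 = (1 - t) * (1 + t) by ring]
    field_simp
    ring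
  have e2 : ((1 / n ^ 4 - 1 / (n + 1) ^ 4) / 120 : ℝ) = 16 / 15 * t ^ 5 * (1 + t ^ 2) / (1 - t ^ 2) ^ 4 := by
    rw [hnt, show (1 - t) / (2 * t) + 1 = (1 + t) / (2 * t) by field_simp; ring,
      show 1 - t ^ 2 = (1 - t) * (1 + t) by ring]
    field_simp
    ring
  rw [e1, e2]
  constructor
  · refine le_trans ?_ hlow
    rw [div_le_iff₀ (by positivity)]
    have : (2 * t + 2 / 3 * t ^ 3) * (1 - t ^ 2) ^ 2 - (2 * t * (1 - t ^ 2) - 4 / 3 * t ^ 3) =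
      2 / 3 * t ^ 5 + 2 / 3 * t ^ 7 := by ring
    have : 0 < 2 / 3 * t ^ 5 + 2 / 3 * t ^ 7 := by positivity
    linarith
  · refine le_trans hup ?_
    have hu1 : t ^ 2 < 1 := by linarith
    have : (2 * t * (1 - t ^ 2) - 4 / 3 * t ^ 3) / (1 - t ^ 2) ^ 2 + 16 / 15 * t ^ 5 * (1 + t ^ 2) / (1 - t ^ 2) ^ 4 -
        (2 * t + 2 / 3 * t ^ 3 + 2 / 5 * t ^ 5 * (1 - t ^ 2)⁻¹) =
        t ^ 5 * (16 / 15 * (1 + t ^ 2) - (2 / 3 + 2 / 3 * t ^ 2) * (1 - t ^ 2) ^ 2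
          - 2 / 5 * (1 - t ^ 2) ^ 3) / (1 - t ^ 2) ^ 4 := by
      field_simp
      ring
    have h2 : 0 ≤ 16 / 15 * (1 + t ^ 2) - (2 / 3 + 2 / 3 * t ^ 2) * (1 - t ^ 2) ^ 2
          - 2 / 5 * (1 - t ^ 2) ^ 3 := by
      have a1 : (1 - t ^ 2) ^ 2 ≤ 1 := pow_le_one₀ hu.le (by nlinarith)
      have a2 : (1 - t ^ 2) ^ 3 ≤ 1 := pow_le_one₀ hu.le (by nlinarith)
      nlinarith [sq_nonneg t]
    have h3 : 0 ≤ t ^ 5 * (16 / 15 * (1 + t ^ 2) - (2 / 3 + 2 / 3 * t ^ 2) * (1 - t ^ 2) ^ 2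
          - 2 / 5 * (1 - t ^ 2) ^ 3) / (1 - t ^ 2) ^ 4 := by positivity
    linarith

noncomputable def auxB (n : ℕ) : ℝ :=
  (harmonic (n + 1) : ℝ) - Real.log ((n + 1 : ℕ) : ℝ) - 1 / (2 * ((n + 1 : ℕ) : ℝ)) + 1 / (12 * ((n + 1 : ℕ) : ℝ) ^ 2)

lemma auxB_anti : Antitone auxB := by
  refine antitone_nat_of_succ_le fun n => ?_
  have h := (aux_log_ratio (n := n + 1) (by omega)).1
  unfold auxB
  rw [harmonic_succ (n + 1)]
  push_cast at h ⊢
  have hn : (0 : ℝ) < n + 1 := by positivity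
  have hn2 : (0 : ℝ) < n + 1 + 1 := by positivity
  have : ∀ x : ℝ, 0 < x → 1 / (2 * x) = 1 / x / 2 ∧ 1 / (12 * x ^ 2) = 1 / x ^ 2 / 12 ∧ x⁻¹ = 1 / x := by
    intro x hx; refine ⟨?_, ?_, ?_⟩ <;> field_simp
  obtain ⟨a1, a2, -⟩ := this _ hn
  obtain ⟨b1, b2, b3⟩ := this _ hn2
  rw [a1, a2, b1, b2, b3]
  linarith

lemma auxB_mono : Monotone fun n => auxB n - 1 / (120 * ((n + 1 : ℕ) : ℝ) ^ 4) := by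
  refine monotone_nat_of_le_succ fun n => ?_
  have h := (aux_log_ratio (n := n + 1) (by omega)).2
  unfold auxB
  rw [harmonic_succ (n + 1)]
  push_cast at h ⊢
  have hn : (0 : ℝ) < n + 1 := by positivity
  have hn2 : (0 : ℝ) < n + 1 + 1 := by positivity
  have : ∀ x : ℝ, 0 < x → 1 / (2 * x) = 1 / x / 2 ∧ 1 / (12 * x ^ 2) = 1 / x ^ 2 / 12 ∧
      1 / (120 * x ^ 4) = 1 / x ^ 4 / 120 ∧ x⁻¹ = 1 / x := by
    intro x hx; refine ⟨?_, ?_, ?_, ?_⟩ <;> field_simp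
  obtain ⟨a1, a2, a4, -⟩ := this _ hn
  obtain ⟨b1, b2, b4, b3⟩ := this _ hn2
  rw [a1, a2, a4, b1, b2, b4, b3]
  linarith

lemma auxB_tendsto : Tendsto auxB atTop (𝓝 Real.eulerMascheroniConstant) ∧
    Tendsto (fun n => auxB n - 1 / (120 * ((n + 1 : ℕ) : ℝ) ^ 4)) atTop (𝓝 Real.eulerMascheroniConstant) := by
  have h0 := (tendsto_add_atTop_iff_nat 1).mpr Real.tendsto_harmonic_sub_log
  have hc : Tendsto (fun n : ℕ => ((n + 1 : ℕ) : ℝ)⁻¹) atTop (𝓝 0) :=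
    (tendsto_add_atTop_iff_nat 1).mpr tendsto_inv_atTop_nhds_zero_nat
  have hB : Tendsto auxB atTop (𝓝 Real.eulerMascheroniConstant) := by
    have h := (h0.sub (hc.const_mul (1 / 2))).add ((hc.pow 2).const_mul (1 / 12))
    simp only [mul_zero, sub_zero, ne_eq, OfNat.ofNat_ne_zero, not_false_eq_true, zero_pow, add_zero] at h
    refine h.congr fun n => ?_
    unfold auxB
    have : ((n + 1 : ℕ) : ℝ) ≠ 0 := by positivity
    field_simp
  refine ⟨hB, ?_⟩
  have h := hB.sub ((hc.pow 4).const_mul (1 / 120))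
  simp only [mul_zero, sub_zero, ne_eq, OfNat.ofNat_ne_zero, not_false_eq_true, zero_pow] at h
  refine h.congr fun n => ?_
  have : ((n + 1 : ℕ) : ℝ) ≠ 0 := by positivity
  field_simp

lemma aux_gamma_bounds :
    Real.eulerMascheroniConstant ≤ 2436559 / 720720 - 4 * Real.log 2 - 1 / 32 + 1 / 3072 ∧
    2436559 / 720720 - 4 * Real.log 2 - 1 / 32 + 1 / 3072 - 1 / 7864320 ≤ Real.eulerMascheroniConstant := by
  have h1 := auxB_anti.le_of_tendsto auxB_tendsto.1 15
  have h2 := auxB_mono.ge_of_tendsto auxB_tendsto.2 15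
  have hB : auxB 15 = 2436559 / 720720 - 4 * Real.log 2 - 1 / 32 + 1 / 3072 := by
    unfold auxB
    have hh : harmonic (15 + 1) = 2436559 / 720720 := by
      simp only [harmonic, Finset.sum_range_succ, Finset.sum_range_zero]; norm_num
    rw [hh]
    have : Real.log (((15 + 1 : ℕ)) : ℝ) = 4 * Real.log 2 := by
      rw [show (((15 + 1 : ℕ)) : ℝ) = 2 ^ 4 by norm_num, Real.log_pow]; norm_num
    rw [this]; push_cast; norm_num
  rw [hB] at h1
  simp only [hB] at h2
  norm_num at h1 h2
  constructor <;> linarith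

lemma aux_log_z (M : ℝ) (hM : 0 < M) (k j : ℕ) :
    Real.log ((4 * M) ^ k / (Real.pi ^ (2 * k) * 2 ^ j)) =
      k * (2 * Real.log 2 + Real.log M) - 2 * k * Real.log Real.pi - j * Real.log 2 := by
  have hpi := Real.pi_pos
  rw [Real.log_div (by positivity) (by positivity), Real.log_mul (by positivity) (by positivity),
    Real.log_pow, Real.log_pow, Real.log_pow, Real.log_mul (by norm_num) hM.ne',
    show (4 : ℝ) = 2 ^ 2 by norm_num, Real.log_pow]
  push_cast; ring

lemma aux_log_z_bounds (M : ℝ) (hM : 0 < M) (k j : ℕ) :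
    1 - Real.pi ^ (2 * k) * 2 ^ j / (4 * M) ^ k ≤
      k * (2 * Real.log 2 + Real.log M) - 2 * k * Real.log Real.pi - j * Real.log 2 ∧
      k * (2 * Real.log 2 + Real.log M) - 2 * k * Real.log Real.pi - j * Real.log 2 ≤
    (4 * M) ^ k / (Real.pi ^ (2 * k) * 2 ^ j) - 1 := by
  have hpi := Real.pi_pos
  rw [← aux_log_z M hM k j]
  have hz : 0 < (4 * M) ^ k / (Real.pi ^ (2 * k) * 2 ^ j) := by positivity
  constructor
  · have := Real.one_sub_inv_le_log_of_pos hz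
    rwa [inv_div] at this
  · exact Real.log_le_sub_one_of_pos hz

lemma aux_pi_pow (k : ℕ) : (3.14159265358 : ℝ) ^ k ≤ Real.pi ^ k ∧ Real.pi ^ k ≤ (3.1415926536 : ℝ) ^ k := by
  have h1 := Real.pi_gt_d20
  have h2 := Real.pi_lt_d20
  constructor
  · exact pow_le_pow_left₀ (by norm_num) (by linarith) k
  · exact pow_le_pow_left₀ Real.pi_pos.le (by linarith) k

lemma aux_even_num (N : ℕ) (hN : 0 < N)
    (h : Real.log N = 2 * Real.log Real.pi + 2 * Real.eulerMascheroniConstant + Real.pi + 6 * Real.log 2) :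
    N = 46368 := by
  obtain ⟨g1, g2⟩ := aux_gamma_bounds
  have l1 := Real.log_two_gt_d9
  have l2 := Real.log_two_lt_d9
  have p1 := Real.pi_gt_d20
  have p2 := Real.pi_lt_d20
  obtain ⟨q1, q2⟩ := aux_pi_pow (2 * 5)
  have hN' : (0 : ℝ) < N := Nat.cast_pos.mpr hN
  have hlt : N < 46369 := by
    by_contra hc
    have hc' : (46369 : ℝ) ≤ N := by exact_mod_cast not_lt.mp hc
    have hl := Real.log_le_log (by norm_num) hc'
    have hz := (aux_log_z_bounds 46369 (by norm_num) 5 71).1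
    have hb : Real.pi ^ (2 * 5) * 2 ^ 71 / (4 * 46369) ^ 5 ≤ (3.1415926536 : ℝ) ^ (2 * 5) * 2 ^ 71 / (4 * 46369) ^ 5 := by
      gcongr
    norm_num at hb hz
    linarith
  have hgt : 46367 < N := by
    by_contra hc
    have hc' : (N : ℝ) ≤ 46367 := by exact_mod_cast not_lt.mp hc
    have hl := Real.log_le_log hN' hc'
    have hz := (aux_log_z_bounds 46367 (by norm_num) 5 71).2
    have hb : (4 * 46367) ^ 5 / (Real.pi ^ (2 * 5) * 2 ^ 71) ≤ (4 * 46367) ^ 5 / ((3.14159265358 : ℝ) ^ (2 * 5) * 2 ^ 71) := by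
      gcongr
    norm_num at hb hz
    linarith
  omega

lemma aux_odd_num (N : ℕ) (hN : 0 < N)
    (h : Real.log N = 2 * Real.log Real.pi + 2 * Real.eulerMascheroniConstant + 6 * Real.log 2) : False := by
  obtain ⟨g1, g2⟩ := aux_gamma_bounds
  have l1 := Real.log_two_gt_d9
  have l2 := Real.log_two_lt_d9
  obtain ⟨q1, q2⟩ := aux_pi_pow (2 * 3)
  have hN' : (0 : ℝ) < N := Nat.cast_pos.mpr hN
  have hlt : N < 2004 := by
    by_contra hc
    have hc' : (2004 : ℝ) ≤ N := by exact_mod_cast not_lt.mp hc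
    have hl := Real.log_le_log (by norm_num) hc'
    have hz := (aux_log_z_bounds 2004 (by norm_num) 3 29).1
    have hb : Real.pi ^ (2 * 3) * 2 ^ 29 / (4 * 2004) ^ 3 ≤ (3.1415926536 : ℝ) ^ (2 * 3) * 2 ^ 29 / (4 * 2004) ^ 3 := by
      gcongr
    norm_num at hb hz
    linarith
  have hgt : 2003 < N := by
    by_contra hc
    have hc' : (N : ℝ) ≤ 2003 := by exact_mod_cast not_lt.mp hc
    have hl := Real.log_le_log hN' hc'
    have hz := (aux_log_z_bounds 2003 (by norm_num) 3 29).2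
    have hb : (4 * 2003) ^ 3 / (Real.pi ^ (2 * 3) * 2 ^ 29) ≤ (4 * 2003) ^ 3 / ((3.14159265358 : ℝ) ^ (2 * 3) * 2 ^ 29) := by
      gcongr
    norm_num at hb hz
    linarith
  omega

end Aux

theorem zeta_mul_LFunction_half_eq_zero_iff_deriv_eq_zero {N : ℕ} [NeZero N] (hN : 1 < N)
    (χ : DirichletCharacter ℂ N) (hprim : χ.IsPrimitive)
    (hquad : χ ^ 2 = 1) (hnontriv : χ ≠ 1) :
    riemannZeta (1 / 2) * DirichletCharacter.LFunction χ (1 / 2) = 0 ↔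
      deriv (fun s : ℂ => riemannZeta s * DirichletCharacter.LFunction χ s) (1 / 2) = 0 := by
  refine aux_reduce χ hprim hquad hnontriv (fun h => ?_) (fun h => aux_odd_num N (by omega) h)
  have h1 := aux_even_num N (by omega) h
  exact aux_not_sq Nat.prime_three (by norm_num) hprim hquad ⟨5152, by rw [h1]⟩
end

section
/- Let χ₁ and χ₂ be primitive quadratic Dirichlet characters of moduli N₁ > 1 and N₂ > 1 respectively, such that (N₁, χ₁(−1)) ≠ (N₂, χ₂(−1)). Assume ζ(1/2)·L(1/2,χ₁) ≠ 0 and ζ(1/2)·L(1/2,χ₂) ≠ 0. Then the logarithmic derivatives at s = 1/2 of the functions s ↦ ζ(s)·L(s,χ₁) and s ↦ ζ(s)·L(s,χ₂) are different, i.e., (d/ds)[ζ(s)L(s,χ₁)]|_{s=1/2} / (ζ(1/2)L(1/2,χ₁)) ≠ (d/ds)[ζ(s)L(s,χ₂)]|_{s=1/2} / (ζ(1/2)L(1/2,χ₂)). (This is Theorem 1 in the language of L-functions: for distinct quadratic fields K, L with ζ_K(1/2)ζ_L(1/2) ≠ 0 one has ζ_K'(1/2)/ζ_K(1/2) ≠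 ζ_L'(1/2)/ζ_L(1/2).) -/
/-- An entire function vanishing on a finite set is divisible by the corresponding product. -/
lemma entire_factor (F : ℂ → ℂ) (hF : Differentiable ℂ F) (Z : Finset ℂ) :
    (∀ z ∈ Z, F z = 0) → ∃ G : ℂ → ℂ, Differentiable ℂ G ∧
      ∀ z, F z = (∏ c ∈ Z, (z - c)) * G z := by
  classical
  induction Z using Finset.induction_on with
  | empty => intro _; exact ⟨F, hF, by simp⟩
  | insert a Z ha ih =>
    intro h
    obtain ⟨G, hG, hFG⟩ := ih (fun z hz => h z (Finset.mem_insert_of_mem hz))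
    have hGa : G a = 0 := by
      have h1 := h a (Finset.mem_insert_self _ _)
      rw [hFG a] at h1
      rcases mul_eq_zero.mp h1 with h2 | h2
      · obtain ⟨c, hc, hc'⟩ := Finset.prod_eq_zero_iff.mp h2
        rw [sub_eq_zero] at hc'
        exact absurd (hc' ▸ hc) ha
      · exact h2
    refine ⟨dslope G a, ?_, ?_⟩
    · rw [← differentiableOn_univ]
      exact (Complex.differentiableOn_dslope Filter.univ_mem).mpr hG.differentiableOn
    · intro z
      have h3 := sub_smul_dslope G a z
      rw [hGa, sub_zero, smul_eq_mul] at h3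
      rw [Finset.prod_insert ha, hFG z, ← h3]
      ring

lemma entire_schwarz (F : ℂ → ℂ) (hF : Differentiable ℂ F) (Z : Finset ℂ)
    (hZ : ∀ z ∈ Z, F z = 0) (r M : ℝ) (hr : 0 < r) (hZr : ∀ z ∈ Z, ‖z‖ ≤ r)
    (hM : ∀ z, ‖z‖ = 7 * r → ‖F z‖ ≤ M) (w : ℂ) (hw : ‖w‖ ≤ r) :
    ‖F w‖ * 3 ^ Z.card ≤ M := by
  obtain ⟨G, hG, hFG⟩ := entire_factor F hF Z hZ
  have hGw : ‖G w‖ ≤ M / (6 * r) ^ Z.card := by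
    refine Complex.norm_le_of_forall_mem_frontier_norm_le (U := Metric.ball (0 : ℂ) (7 * r))
      Metric.isBounded_ball hG.diffContOnCl ?_ ?_
    · intro z hz
      rw [frontier_ball _ (by positivity)] at hz
      have hz' : ‖z‖ = 7 * r := by simpa using hz
      rw [le_div_iff₀ (by positivity)]
      have h1 := hM z hz'
      rw [hFG z, norm_mul, norm_prod] at h1
      have h2 : (6 * r) ^ Z.card ≤ ∏ c ∈ Z, ‖z - c‖ := by
        rw [← Finset.prod_const]
        refine Finset.prod_le_prod (fun _ _ => by positivity) (fun c hc => ?_)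
        have := norm_sub_norm_le z c
        have := hZr c hc
        linarith
      calc ‖G z‖ * (6 * r) ^ Z.card ≤ ‖G z‖ * ∏ c ∈ Z, ‖z - c‖ := by gcongr
        _ ≤ M := by linarith
    · apply subset_closure
      simp
      linarith
  have h4 : ‖F w‖ ≤ (2 * r) ^ Z.card * (M / (6 * r) ^ Z.card) := by
    rw [hFG w, norm_mul, norm_prod]
    refine mul_le_mul ?_ hGw (norm_nonneg _) (by positivity)
    rw [← Finset.prod_const]
    refine Finset.prod_le_prod (fun _ _ => norm_nonneg _) (fun c hc => ?_)
    have := norm_sub_le w c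
    have := hZr c hc
    linarith
  have h5 : (6 * r) ^ Z.card = (2 * r) ^ Z.card * 3 ^ Z.card := by
    rw [← mul_pow]; ring_nf
  rw [h5] at h4
  have h6 : (2 * r) ^ Z.card * (M / ((2 * r) ^ Z.card * 3 ^ Z.card)) = M / 3 ^ Z.card := by
    field_simp
  rw [h6, le_div_iff₀ (by positivity)] at h4
  exact h4

/-- The parameter choice. -/
lemma param_choice (u : ℕ) (hu : 1 ≤ u) : ∃ t : ℕ, 1 ≤ t ∧ ∀ T : ℕ, t ^ 2 ≤ T → ∀ v : ℕ, v ≤ u →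
    (4 * t ^ 4 : ℝ) * ((4 * t ^ 4 : ℝ) * ((2 * t ^ 2 : ℝ) ^ (4 * t ^ 3) * (u : ℝ) ^ (t * t ^ 2))) *
      ((14 * T : ℝ) ^ (4 * t ^ 3) * Real.exp (Real.pi * t * (14 * T))) * (v : ℝ) ^ (t * T)
      < 3 ^ (T ^ 2) := by
  obtain ⟨T0, hT0⟩ : ∃ T0 : ℕ, ∀ T : ℕ, T0 ≤ T →
      12 * Real.log (14 * T) + (2 * Real.log u + 56) < Real.sqrt T := by
    have h1 : Filter.Tendsto (fun x : ℝ => (12 * Real.log (14 * x) + (2 * Real.log u + 56))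
        / Real.sqrt x) Filter.atTop (nhds 0) := by
      have e1 : Filter.Tendsto (fun x : ℝ => 12 * (Real.log x / x ^ (1 / 2 : ℝ)) +
          (12 * Real.log 14 + (2 * Real.log u + 56)) * (x ^ (1 / 2 : ℝ))⁻¹)
          Filter.atTop (nhds (12 * 0 + (12 * Real.log 14 + (2 * Real.log u + 56)) * 0)) := by
        refine Filter.Tendsto.add (Filter.Tendsto.const_mul _ ?_) (Filter.Tendsto.const_mul _ ?_)
        · exact (isLittleO_log_rpow_atTop (by norm_num)).tendsto_div_nhds_zero
        · exact (tendsto_rpow_atTop (by norm_num)).inv_tendsto_atTop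
      simp only [mul_zero, add_zero] at e1
      refine e1.congr' ?_
      filter_upwards [Filter.eventually_gt_atTop 0] with x hx
      rw [Real.log_mul (by norm_num) hx.ne', Real.sqrt_eq_rpow]
      ring
    have h2 := (h1.comp (tendsto_natCast_atTop_atTop (R := ℝ))).eventually
      (gt_mem_nhds (zero_lt_one))
    obtain ⟨T0, h3⟩ := Filter.eventually_atTop.mp (h2.and (Filter.eventually_gt_atTop 0))
    refine ⟨T0, fun T hT => ?_⟩
    obtain ⟨h4, h5⟩ := h3 T hT
    have : 0 < Real.sqrt T := Real.sqrt_pos.mpr (by exact_mod_cast h5)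
    simpa [div_lt_one this] using h4
  refine ⟨T0 + 1, by omega, fun T hT v hv => ?_⟩
  have hTT0 : T0 ≤ T := by nlinarith
  have key := hT0 T hTT0
  set t := T0 + 1 with ht
  have ht1 : 1 ≤ t := by omega
  have hT1 : 1 ≤ T := by nlinarith
  have htR : (1 : ℝ) ≤ t := by exact_mod_cast ht1
  have hTR : (1 : ℝ) ≤ T := by exact_mod_cast hT1
  have huR : (1 : ℝ) ≤ u := by exact_mod_cast hu
  have htT : (t : ℝ) ^ 2 ≤ T := by exact_mod_cast hT
  have ht3 : 1 ≤ t ^ 3 := Nat.one_le_pow _ _ ht1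
  have hts : (t : ℝ) ≤ Real.sqrt T := Real.le_sqrt_of_sq_le htT
  have ht4 : (4 * t ^ 4 : ℝ) ≤ (14 * T : ℝ) ^ (2 * t ^ 3) := by
    calc (4 * t ^ 4 : ℝ) = 4 * (t ^ 2) ^ 2 := by ring
      _ ≤ 4 * (T : ℝ) ^ 2 := by gcongr
      _ ≤ (14 * T : ℝ) ^ 2 := by nlinarith
      _ ≤ _ := pow_le_pow_right₀ (by linarith) (by omega)
  have hv' : (v : ℝ) ≤ u := by exact_mod_cast hv
  have hutT : (u : ℝ) ^ (t * t ^ 2) ≤ (u : ℝ) ^ (t * T) :=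
    pow_le_pow_right₀ huR (Nat.mul_le_mul_left _ hT)
  have hexp : Real.exp (Real.pi * t * (14 * T)) ≤ Real.exp (56 * (t * T)) := by
    apply Real.exp_le_exp.mpr
    have := Real.pi_le_four
    have h0 : (0 : ℝ) ≤ t * T := by positivity
    nlinarith
  calc (4 * t ^ 4 : ℝ) * ((4 * t ^ 4 : ℝ) * ((2 * t ^ 2 : ℝ) ^ (4 * t ^ 3) * (u : ℝ) ^ (t * t ^ 2))) *
      ((14 * T : ℝ) ^ (4 * t ^ 3) * Real.exp (Real.pi * t * (14 * T))) * (v : ℝ) ^ (t * T)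
      ≤ (14 * T : ℝ) ^ (2 * t ^ 3) * ((14 * T : ℝ) ^ (2 * t ^ 3) * ((14 * T : ℝ) ^ (4 * t ^ 3)
        * (u : ℝ) ^ (t * T))) *
      ((14 * T : ℝ) ^ (4 * t ^ 3) * Real.exp (56 * (t * T))) * (u : ℝ) ^ (t * T) := by
        gcongr
        linarith
    _ = (14 * T : ℝ) ^ (12 * t ^ 3) * (u : ℝ) ^ (2 * (t * T)) * Real.exp (56 * (t * T)) := by
        ring
    _ = Real.exp (Real.log (14 * T) * ((12 * t ^ 3 : ℕ) : ℝ) +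
          Real.log u * ((2 * (t * T) : ℕ) : ℝ) + 56 * (t * T)) := by
        rw [Real.exp_add, Real.exp_add, Real.exp_mul (Real.log (14 * T)), Real.exp_mul (Real.log u),
          Real.exp_log (by linarith), Real.exp_log (by linarith), Real.rpow_natCast,
          Real.rpow_natCast]
    _ < Real.exp ((T ^ 2 : ℕ) : ℝ) := by
        apply Real.exp_lt_exp.mpr
        push_cast
        have hl : 0 ≤ Real.log (14 * T) := Real.log_nonneg (by linarith)
        have h0 : (0 : ℝ) < t * T := by positivity
        have h1 : (t : ℝ) ^ 3 ≤ t * T := by nlinarith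
        have h2 : (t : ℝ) * T * Real.sqrt T ≤ T ^ 2 := by
          have := Real.mul_self_sqrt (by linarith : (0:ℝ) ≤ T)
          calc (t : ℝ) * T * Real.sqrt T ≤ Real.sqrt T * T * Real.sqrt T := by gcongr
            _ = (Real.sqrt T * Real.sqrt T) * T := by ring
            _ = _ := by rw [this]; ring
        have h3 := mul_lt_mul_of_pos_left key h0
        have h4 := mul_le_mul_of_nonneg_left h1 hl
        nlinarith
    _ ≤ 3 ^ (T ^ 2) := by
        rw [← Real.exp_one_pow]
        gcongr
        exact Real.exp_one_lt_d9.le.trans (by norm_num)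

section SiegelHalf

attribute [local instance] Matrix.seminormedAddCommGroup

/-- Siegel's lemma with twice as many unknowns as equations. -/
lemma siegel_half {α β : Type*} [Fintype α] [Fintype β] (A : Matrix α β ℤ)
    (hcard : Fintype.card β = 2 * Fintype.card α) (hpos : 0 < Fintype.card α) (C : ℝ) (hC : 1 ≤ C)
    (hA : ∀ i j, ‖A i j‖ ≤ C) :
    ∃ p : β → ℤ, p ≠ 0 ∧ A.mulVec p = 0 ∧ ∀ j, ‖p j‖ ≤ Fintype.card β * C := by
  obtain ⟨p, hp, hAp, hb⟩ := Int.Matrix.exists_ne_zero_int_vec_norm_le A (by omega) hpos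
  refine ⟨p, hp, hAp, fun j => (norm_le_pi_norm p j).trans (hb.trans ?_)⟩
  have hp' : (0 : ℝ) < Fintype.card α := by exact_mod_cast hpos
  have he : ((Fintype.card α : ℝ) / ((Fintype.card β : ℝ) - Fintype.card α)) = 1 := by
    rw [hcard]; push_cast; rw [div_eq_one_iff_eq (by linarith)]; ring
  rw [he, Real.rpow_one]
  gcongr
  refine max_le hC ?_
  exact (Matrix.norm_le_iff (by linarith)).mpr hA

end SiegelHalf

/-- The cleared-denominator value of `z ^ j * exp (π k z)` at `a + b i`. -/
def gE (u v D T a b j k : ℕ) : GaussianInt :=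
  (⟨a, b⟩ : GaussianInt) ^ j * (((-1) ^ (k * b) * u ^ (k * a) * v ^ (D * T - k * a) : ℤ) : GaussianInt)

/-- The auxiliary function. -/
noncomputable def auxF {D₁ D₂ : ℕ} (p : Fin D₁ × Fin D₂ → ℤ) (z : ℂ) : ℂ :=
  ∑ x, (p x : ℂ) * (z ^ (x.1 : ℕ) * Complex.exp (Real.pi * (x.2 : ℕ) * z))

lemma auxF_diff {D₁ D₂ : ℕ} (p : Fin D₁ × Fin D₂ → ℤ) : Differentiable ℂ (auxF p) := by
  unfold auxF
  fun_prop

lemma exp_gauss (k a b : ℕ) : Complex.exp (Real.pi * k * (a + b * Complex.I)) =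
    (-1) ^ (k * b) * (Real.exp Real.pi : ℂ) ^ (k * a) := by
  rw [Complex.ofReal_exp, ← Complex.exp_pi_mul_I, ← Complex.exp_nat_mul, ← Complex.exp_nat_mul,
    ← Complex.exp_add]
  congr 1
  push_cast
  ring

lemma auxF_eval {D₁ D₂ : ℕ} (p : Fin D₁ × Fin D₂ → ℤ) (u v T a b : ℕ)
    (h : (v : ℝ) * Real.exp Real.pi = u) (ha : a ≤ T) :
    (v : ℂ) ^ (D₂ * T) * auxF p (a + b * Complex.I) =
      GaussianInt.toComplex (∑ x, (p x : GaussianInt) * gE u v D₂ T a b x.1 x.2) := by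
  unfold auxF
  rw [map_sum, Finset.mul_sum]
  refine Finset.sum_congr rfl fun x _ => ?_
  have hle : (x.2 : ℕ) * a ≤ D₂ * T := Nat.mul_le_mul x.2.2.le ha
  have hC : (v : ℂ) * (Real.exp Real.pi : ℂ) = u := by exact_mod_cast congrArg Complex.ofReal h
  have hv : (v : ℂ) ^ (D₂ * T) = v ^ (D₂ * T - x.2 * a) * v ^ ((x.2 : ℕ) * a) := by
    rw [← pow_add]; congr 1; omega
  have hab : GaussianInt.toComplex ⟨a, b⟩ = a + b * Complex.I := by
    simp [GaussianInt.toComplex_def]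
  rw [exp_gauss, hv, gE, map_mul, map_mul, map_pow, hab, map_intCast, map_intCast]
  simp only [Int.cast_mul, Int.cast_pow, Int.cast_neg, Int.cast_one, Int.cast_natCast]
  rw [← hC, mul_pow]
  ring

lemma norm_gauss_le (a b T : ℕ) (ha : a ≤ T) (hb : b ≤ T) :
    ‖(a + b * Complex.I : ℂ)‖ ≤ 2 * T := by
  have ha' : (a : ℝ) ≤ T := by exact_mod_cast ha
  have hb' : (b : ℝ) ≤ T := by exact_mod_cast hb
  calc ‖(a + b * Complex.I : ℂ)‖ ≤ ‖(a : ℂ)‖ + ‖(b * Complex.I : ℂ)‖ := norm_add_le _ _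
    _ = a + b := by simp
    _ ≤ _ := by linarith

lemma gE_norm (u v D₁ D T a b j k : ℕ) (hu : 1 ≤ u) (hvu : v ≤ u) (hT : 1 ≤ T) (ha : a ≤ T)
    (hb : b ≤ T) (hj : j ≤ D₁) (hk : k ≤ D) :
    ‖GaussianInt.toComplex (gE u v D T a b j k)‖ ≤ (2 * T : ℝ) ^ D₁ * (u : ℝ) ^ (D * T) := by
  have hab : GaussianInt.toComplex ⟨a, b⟩ = a + b * Complex.I := by
    simp [GaussianInt.toComplex_def]
  have hle : k * a ≤ D * T := Nat.mul_le_mul hk ha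
  have huR : (1 : ℝ) ≤ u := by exact_mod_cast hu
  have hvR : (v : ℝ) ≤ u := by exact_mod_cast hvu
  have hTR : (1 : ℝ) ≤ T := by exact_mod_cast hT
  rw [gE, map_mul, map_pow, hab, map_intCast, norm_mul, norm_pow]
  push_cast
  rw [norm_mul, norm_mul, norm_pow, norm_pow, norm_pow]
  simp only [norm_neg, norm_one, one_pow, one_mul, Complex.norm_natCast]
  gcongr
  · calc ‖(a + b * Complex.I : ℂ)‖ ^ j ≤ (2 * T : ℝ) ^ j := by
          gcongr; exact norm_gauss_le a b T ha hb
      _ ≤ _ := pow_le_pow_right₀ (by linarith) hj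
  · calc (u : ℝ) ^ (k * a) * (v : ℝ) ^ (D * T - k * a) ≤
          (u : ℝ) ^ (k * a) * (u : ℝ) ^ (D * T - k * a) := by gcongr
      _ = _ := by rw [← pow_add]; congr 1; omega

lemma gauss_eq_zero (g : GaussianInt) (h : ‖GaussianInt.toComplex g‖ < 1) : g = 0 := by
  have h1 : |(GaussianInt.toComplex g).re| < 1 := (Complex.abs_re_le_norm _).trans_lt h
  have h2 : |(GaussianInt.toComplex g).im| < 1 := (Complex.abs_im_le_norm _).trans_lt h
  rw [← GaussianInt.intCast_re] at h1
  rw [← GaussianInt.intCast_im] at h2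
  have h3 : |g.re| < 1 := by exact_mod_cast h1
  have h4 : |g.im| < 1 := by exact_mod_cast h2
  ext
  · simpa using Int.abs_lt_one_iff.mp h3
  · simpa using Int.abs_lt_one_iff.mp h4

lemma auxF_bound {D₁ D₂ : ℕ} (p : Fin D₁ × Fin D₂ → ℤ) (B R : ℝ) (hR : 1 ≤ R)
    (hp : ∀ x, ‖p x‖ ≤ B) (z : ℂ) (hz : ‖z‖ = R) :
    ‖auxF p z‖ ≤ (D₁ * D₂ : ℕ) * B * (R ^ D₁ * Real.exp (Real.pi * D₂ * R)) := by
  unfold auxF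
  calc _ ≤ ∑ x : Fin D₁ × Fin D₂, B * (R ^ D₁ * Real.exp (Real.pi * D₂ * R)) := by
        refine norm_sum_le_of_le _ fun x _ => ?_
        rw [norm_mul, norm_mul, norm_pow, hz, Complex.norm_exp]
        have hB : 0 ≤ B := (norm_nonneg _).trans (hp x)
        have h1 : ‖(p x : ℂ)‖ ≤ B := by
          rw [Complex.norm_intCast]; exact hp x
        have hx2 : ((x.2 : ℕ) : ℝ) ≤ D₂ := by exact_mod_cast x.2.2.le
        have h2 : (Real.pi * (x.2 : ℕ) * z : ℂ).re ≤ Real.pi * D₂ * R := by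
          calc (Real.pi * (x.2 : ℕ) * z : ℂ).re ≤ ‖(Real.pi * (x.2 : ℕ) * z : ℂ)‖ :=
                Complex.re_le_norm _
            _ = Real.pi * (x.2 : ℕ) * R := by
                rw [norm_mul, norm_mul, hz, Complex.norm_natCast, Complex.norm_real,
                  Real.norm_of_nonneg Real.pi_pos.le]
            _ ≤ _ := by
              have := Real.pi_pos
              gcongr
        gcongr
        exact x.1.2.le
    _ = _ := by
        simp; ring

lemma auxF_zero {D₁ D₂ : ℕ} (p : Fin D₁ × Fin D₂ → ℤ)
    (h : ∀ a b : ℕ, auxF p (a + b * Complex.I) = 0) : p = 0 := by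
  have hq : (1 : ℝ) < Real.exp Real.pi := Real.one_lt_exp_iff.mpr Real.pi_pos
  have h1 : ∀ a : ℕ, ∀ j : Fin D₁,
      ∑ k : Fin D₂, ((Real.exp Real.pi : ℂ) ^ a) ^ (k : ℕ) * (p (j, k) : ℂ) = 0 := by
    intro a
    have := Matrix.eq_zero_of_forall_index_sum_pow_mul_eq_zero
      (f := fun b : Fin D₁ => (a + (2 * (b : ℕ) : ℕ) * Complex.I : ℂ))
      (v := fun j => ∑ k : Fin D₂, ((Real.exp Real.pi : ℂ) ^ a) ^ (k : ℕ) * (p (j, k) : ℂ))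
      (by
        intro b c hbc
        have := congrArg Complex.im hbc
        simp at this
        exact Fin.ext this)
      (by
        intro b
        rw [← h a (2 * (b : ℕ)), auxF, Fintype.sum_prod_type]
        refine Finset.sum_congr rfl fun j _ => ?_
        rw [Finset.mul_sum]
        refine Finset.sum_congr rfl fun k _ => ?_
        simp only
        rw [exp_gauss, mul_left_comm (k : ℕ) 2, pow_mul (-1 : ℂ) 2, neg_one_sq, one_pow, ← pow_mul,
          mul_comm a]
        ring)
    intro j
    exact congrFun this j
  funext x
  obtain ⟨j, k⟩ := x
  have := Matrix.eq_zero_of_forall_index_sum_pow_mul_eq_zero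
      (f := fun a : Fin D₂ => ((Real.exp Real.pi : ℂ) ^ (a : ℕ)))
      (v := fun k => (p (j, k) : ℂ))
      (by
        intro b c hbc
        simp only at hbc
        have h2 : Real.exp Real.pi ^ (b : ℕ) = Real.exp Real.pi ^ (c : ℕ) := by exact_mod_cast hbc
        exact Fin.ext (pow_right_injective₀ (by linarith) hq.ne' h2))
      (fun a => h1 a j)
  have h3 := congrFun this k
  simpa using h3

/-- `exp π` is irrational. -/
theorem exp_pi_irr (u v : ℕ) (hv : 0 < v) : (v : ℝ) * Real.exp Real.pi ≠ u := by
  intro h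
  have hq : (1 : ℝ) < Real.exp Real.pi := Real.one_lt_exp_iff.mpr Real.pi_pos
  have hvR : (1 : ℝ) ≤ v := by exact_mod_cast hv
  have hvu : v ≤ u := by
    have : (v : ℝ) ≤ u := by rw [← h]; nlinarith
    exact_mod_cast this
  have hu : 1 ≤ u := by omega
  have huR : (1 : ℝ) ≤ u := by exact_mod_cast hu
  obtain ⟨t, ht, hpar⟩ := param_choice u hu
  have htR : (1 : ℝ) ≤ t := by exact_mod_cast ht
  have hS : 1 ≤ t ^ 2 := Nat.one_le_pow _ _ ht
  set C : ℝ := (2 * t ^ 2 : ℝ) ^ (4 * t ^ 3) * (u : ℝ) ^ (t * t ^ 2) with hC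
  have hC1 : 1 ≤ C := by
    have h1 : (1 : ℝ) ≤ (2 * t ^ 2 : ℝ) := by nlinarith
    exact one_le_mul_of_one_le_of_one_le (one_le_pow₀ h1) (one_le_pow₀ huR)
  let A : Matrix ((Fin (t ^ 2) × Fin (t ^ 2)) × Bool) (Fin (4 * t ^ 3) × Fin t) ℤ :=
    fun y x => if y.2 then (gE u v t (t ^ 2) y.1.1 y.1.2 x.1 x.2).re
      else (gE u v t (t ^ 2) y.1.1 y.1.2 x.1 x.2).im
  obtain ⟨p, hp0, hAp, hpb⟩ := siegel_half A (by simp; ring) (by simp; positivity) C hC1 (by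
    intro y x
    have hg := gE_norm u v (4 * t ^ 3) t (t ^ 2) y.1.1 y.1.2 x.1 x.2 hu hvu hS y.1.1.2.le
      y.1.2.2.le x.1.2.le x.2.2.le
    push_cast at hg
    rw [← hC] at hg
    refine le_trans ?_ hg
    simp only [A]
    split_ifs
    · have := Complex.abs_re_le_norm
        (GaussianInt.toComplex (gE u v t (t ^ 2) y.1.1 y.1.2 x.1 x.2))
      rwa [← GaussianInt.intCast_re] at this
    · have := Complex.abs_im_le_norm
        (GaussianInt.toComplex (gE u v t (t ^ 2) y.1.1 y.1.2 x.1 x.2))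
      rwa [← GaussianInt.intCast_im] at this)
  have hvC : (v : ℂ) ≠ 0 := by exact_mod_cast hv.ne'
  have hvan : ∀ T : ℕ, t ^ 2 ≤ T → ∀ a b : ℕ, a < T → b < T →
      auxF p (a + b * Complex.I) = 0 := by
    intro T hT
    induction T, hT using Nat.le_induction with
    | base =>
      intro a b ha hb
      have he := auxF_eval p u v (t ^ 2) a b h ha.le
      have hz : (∑ x, (p x : GaussianInt) * gE u v t (t ^ 2) a b x.1 x.2) = 0 := by
        have hre := congrFun hAp ((⟨a, ha⟩, ⟨b, hb⟩), true)
        have him := congrFun hAp ((⟨a, ha⟩, ⟨b, hb⟩), false)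
        simp only [Matrix.mulVec, dotProduct, A, if_true, Pi.zero_apply, Bool.false_eq_true,
          if_false] at hre him
        have sre : ∀ (f : Fin (4 * t ^ 3) × Fin t → GaussianInt),
            (∑ x, f x).re = ∑ x, (f x).re := fun f =>
          map_sum (⟨⟨fun g : GaussianInt => g.re, rfl⟩, fun _ _ => rfl⟩ : GaussianInt →+ ℤ) f _
        have sim : ∀ (f : Fin (4 * t ^ 3) × Fin t → GaussianInt),
            (∑ x, f x).im = ∑ x, (f x).im := fun f =>
          map_sum (⟨⟨fun g : GaussianInt => g.im, rfl⟩, fun _ _ => rfl⟩ : GaussianInt →+ ℤ) f _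
        ext
        · rw [sre]
          simp only [Zsqrtd.re_mul, Zsqrtd.re_intCast, Zsqrtd.im_intCast, mul_zero, zero_mul,
            add_zero, Zsqrtd.re_zero]
          rw [← hre]
          exact Finset.sum_congr rfl fun _ _ => mul_comm _ _
        · rw [sim]
          simp only [Zsqrtd.im_mul, Zsqrtd.re_intCast, Zsqrtd.im_intCast, mul_zero, zero_mul,
            add_zero, Zsqrtd.im_zero]
          rw [← him]
          exact Finset.sum_congr rfl fun _ _ => mul_comm _ _
      rw [hz, map_zero] at he
      exact (mul_eq_zero.mp he).resolve_left (pow_ne_zero _ hvC)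
    | succ T hT ih =>
      intro a b ha hb
      have hT1 : 1 ≤ T := hS.trans hT
      have hTR : (1 : ℝ) ≤ T := by exact_mod_cast hT1
      have he := auxF_eval p u v T a b h (by omega)
      set Z : Finset ℂ := (Finset.range T ×ˢ Finset.range T).image
        (fun y : ℕ × ℕ => (y.1 + y.2 * Complex.I : ℂ)) with hZ
      have hZcard : Z.card = T ^ 2 := by
        rw [hZ, Finset.card_image_of_injective, Finset.card_product, Finset.card_range, sq]
        intro x y hxy
        have h1 := congrArg Complex.re hxy
        have h2 := congrArg Complex.im hxy
        simp at h1 h2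
        exact Prod.ext h1 h2
      have hsch := entire_schwarz (auxF p) (auxF_diff p) Z (by
          intro z hz
          obtain ⟨y, hy, rfl⟩ := Finset.mem_image.mp hz
          rw [Finset.mem_product, Finset.mem_range, Finset.mem_range] at hy
          exact ih _ _ hy.1 hy.2) (2 * T) _ (by linarith) (by
          intro z hz
          obtain ⟨y, hy, rfl⟩ := Finset.mem_image.mp hz
          rw [Finset.mem_product, Finset.mem_range, Finset.mem_range] at hy
          exact norm_gauss_le _ _ _ hy.1.le hy.2.le)
          (fun z hz => auxF_bound p _ _ (by linarith) hpb z hz) (a + b * Complex.I)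
          (norm_gauss_le a b T (by omega) (by omega))
      rw [hZcard] at hsch
      have hcard : (Fintype.card (Fin (4 * t ^ 3) × Fin t) : ℝ) = 4 * t ^ 4 := by
        simp; ring
      have hcard' : ((4 * t ^ 3 * t : ℕ) : ℝ) = 4 * t ^ 4 := by
        push_cast; ring
      rw [hcard, hcard', show (7 * (2 * T) : ℝ) = 14 * T by ring] at hsch
      have hp1 := hpar T hT v hvu
      have hlt : ‖(v : ℂ) ^ (t * T) * auxF p (a + b * Complex.I)‖ < 1 := by
        rw [norm_mul, norm_pow, Complex.norm_natCast]
        have h3 : (0 : ℝ) < 3 ^ (T ^ 2) := by positivity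
        have hvp : (0 : ℝ) ≤ (v : ℝ) ^ (t * T) := by positivity
        have h4 := mul_le_mul_of_nonneg_right hsch hvp
        have h5 := h4.trans_lt hp1
        by_contra hcon
        rw [not_lt] at hcon
        have h6 := mul_le_mul_of_nonneg_right hcon h3.le
        linarith
      rw [he] at hlt
      rw [gauss_eq_zero _ hlt, map_zero] at he
      exact (mul_eq_zero.mp he).resolve_left (pow_ne_zero _ hvC)
  apply hp0
  apply auxF_zero
  intro a b
  exact hvan (t ^ 2 + a + b + 1) (by omega) a b (by omega) (by omega)

section LPart

open Complex DirichletCharacter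

lemma logDeriv_Gammaℝ_diff :
    logDeriv Gammaℝ (3 / 2) - logDeriv Gammaℝ (1 / 2) = Real.pi / 2 := by
  have hd : ∀ s : ℂ, 0 < s.re → DifferentiableAt ℂ Gammaℝ s := by
    intro s hs
    have h := (differentiable_Gammaℝ_inv s).inv (inv_ne_zero (Gammaℝ_ne_zero_of_re_pos hs))
    rwa [show (fun s : ℂ => (Gammaℝ s)⁻¹)⁻¹ = Gammaℝ from by ext; simp] at h
  have h1 : HasDerivAt Gammaℝ (deriv Gammaℝ (1 / 2)) (1 - 1 / 2) := by
    have := (hd (1 / 2) (by norm_num)).hasDerivAt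
    rwa [show (1 - 1 / 2 : ℂ) = 1 / 2 by norm_num]
  have h2 : HasDerivAt Gammaℝ (deriv Gammaℝ (3 / 2)) (1 + 1 / 2) := by
    have := (hd (3 / 2) (by norm_num)).hasDerivAt
    rwa [show (1 + 1 / 2 : ℂ) = 3 / 2 by norm_num]
  have h3 := (h1.comp_const_sub 1 (1 / 2)).mul (h2.comp_const_add 1 (1 / 2))
  have hc : Complex.cos (Real.pi * (1 / 2) / 2) = ((Real.sqrt 2 / 2 : ℝ) : ℂ) := by
    rw [← Real.cos_pi_div_four, Complex.ofReal_cos]; congr 1; push_cast; ring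
  have hs : Complex.sin (Real.pi * (1 / 2) / 2) = ((Real.sqrt 2 / 2 : ℝ) : ℂ) := by
    rw [← Real.sin_pi_div_four, Complex.ofReal_sin]; congr 1; push_cast; ring
  have hne : ((Real.sqrt 2 / 2 : ℝ) : ℂ) ≠ 0 := by
    norm_cast; positivity
  have h4 : HasDerivAt (fun s : ℂ => (Complex.cos (Real.pi * s / 2))⁻¹)
      (-(-Complex.sin (Real.pi * (1 / 2) / 2) * (Real.pi * 1 / 2)) /
        Complex.cos (Real.pi * (1 / 2) / 2) ^ 2) (1 / 2) := by
    refine HasDerivAt.inv (c := fun s : ℂ => Complex.cos (Real.pi * s / 2)) ?_ (by rw [hc]; exact hne)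
    exact (((hasDerivAt_id (1 / 2 : ℂ)).const_mul (Real.pi : ℂ)).div_const 2).ccos
  have h5 : (fun s : ℂ => Gammaℝ (1 - s) * Gammaℝ (1 + s)) =
      fun s : ℂ => (Complex.cos (Real.pi * s / 2))⁻¹ := by
    funext s; exact Gammaℝ_one_sub_mul_Gammaℝ_one_add s
  have h6 : (-(-Complex.sin (Real.pi * (1 / 2) / 2) * (Real.pi * 1 / 2)) /
        Complex.cos (Real.pi * (1 / 2) / 2) ^ 2) = _ := h4.unique (by rw [← h5]; exact h3)
  have h7 := Gammaℝ_one_sub_mul_Gammaℝ_one_add (1 / 2)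
  rw [hc] at h7
  rw [hc, hs] at h6
  have e1 : (1 - 1 / 2 : ℂ) = 1 / 2 := by norm_num
  have e2 : (1 + 1 / 2 : ℂ) = 3 / 2 := by norm_num
  rw [e1, e2] at h6 h7
  have n1 : Gammaℝ (1 / 2) ≠ 0 := Gammaℝ_ne_zero_of_re_pos (by norm_num)
  have n2 : Gammaℝ (3 / 2) ≠ 0 := Gammaℝ_ne_zero_of_re_pos (by norm_num)
  rw [logDeriv_apply, logDeriv_apply, div_sub_div _ _ n2 n1, div_eq_iff (mul_ne_zero n2 n1),
    mul_comm (Gammaℝ (3 / 2)) (Gammaℝ (1 / 2)), h7]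
  generalize ((Real.sqrt 2 / 2 : ℝ) : ℂ) = q at *
  have h8 : -(-q * (Real.pi * 1 / 2)) / q ^ 2 = (Real.pi / 2 : ℂ) * q⁻¹ := by
    field_simp
  rw [← h8, h6]
  ring

lemma logDeriv_LFunction_half {N : ℕ} [NeZero N] (hN : 1 < N) (χ : DirichletCharacter ℂ N)
    (hprim : χ.IsPrimitive) (hquad : χ ^ 2 = 1) (hnt : χ ≠ 1) (h : LFunction χ (1 / 2) ≠ 0) :
    logDeriv (LFunction χ) (1 / 2) = - (Real.log N / 2 : ℝ) - logDeriv (gammaFactor χ) (1 / 2) := by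
  have hinv : χ⁻¹ = χ := by
    rw [inv_eq_iff_mul_eq_one, ← pow_two, hquad]
  have hL : LFunction χ = fun s => completedLFunction χ s / gammaFactor χ s := by
    funext s; exact LFunction_eq_completed_div_gammaFactor χ s (Or.inr (by omega))
  have hΛ : completedLFunction χ (1 / 2) ≠ 0 := by
    intro h0; apply h; rw [hL]; simp only [h0, zero_div, div_zero]
  have hγ : gammaFactor χ (1 / 2) ≠ 0 := by
    intro h0; apply h; rw [hL]; simp only [h0, zero_div, div_zero]
  have hγd : DifferentiableAt ℂ (gammaFactor χ) (1 / 2) := by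
    have hd : ∀ s : ℂ, 0 < s.re → DifferentiableAt ℂ Gammaℝ s := by
      intro s hs
      have h := (differentiable_Gammaℝ_inv s).inv (inv_ne_zero (Gammaℝ_ne_zero_of_re_pos hs))
      rwa [show (fun s : ℂ => (Gammaℝ s)⁻¹)⁻¹ = Gammaℝ from by ext; simp] at h
    rcases χ.even_or_odd with he | ho
    · have : gammaFactor χ = Gammaℝ := funext he.gammaFactor_def
      rw [this]; exact hd _ (by norm_num)
    · have : gammaFactor χ = fun s => Gammaℝ (s + 1) := funext ho.gammaFactor_def
      rw [this]
      exact (hd _ (by norm_num)).comp _ (by fun_prop)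
  have hΛd := differentiable_completedLFunction hnt
  have hfe := hprim.completedLFunction_one_sub
  rw [hinv] at hfe
  have hW : rootNumber χ = 1 := by
    have := hfe (1 / 2)
    rw [show (1 - 1 / 2 : ℂ) = 1 / 2 by norm_num, sub_self, Complex.cpow_zero, one_mul] at this
    exact (mul_right_cancel₀ hΛ (by rw [one_mul]; exact this)).symm
  rw [hW] at hfe
  have hN0 : (N : ℂ) ≠ 0 := NeZero.ne _
  have hΛ1 : HasDerivAt (completedLFunction χ) (deriv (completedLFunction χ) (1 / 2)) (1 - 1 / 2) := by
    have := (hΛd (1 / 2)).hasDerivAt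
    rwa [show (1 - 1 / 2 : ℂ) = 1 / 2 by norm_num]
  have d1 := hΛ1.comp_const_sub 1 (1 / 2)
  have d2 : HasDerivAt (fun s : ℂ => (N : ℂ) ^ (s - 1 / 2) * 1) 
      ((N : ℂ) ^ ((1 / 2 : ℂ) - 1 / 2) * Complex.log N * 1 * 1) (1 / 2) :=
    ((((hasDerivAt_id (1 / 2 : ℂ)).sub_const (1 / 2)).const_cpow (Or.inl hN0))).mul_const 1
  have d3 := d2.mul (hΛd (1 / 2)).hasDerivAt
  have d4 := d1.unique (by rw [funext hfe]; exact d3)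
  have hlog : logDeriv (completedLFunction χ) (1 / 2) = - (Real.log N / 2 : ℝ) := by
    rw [logDeriv_apply, div_eq_iff hΛ]
    have : Complex.log N = (Real.log N : ℝ) := by
      simp
    rw [this] at d4
    simp only [sub_self, Complex.cpow_zero, mul_one, one_mul] at d4
    rw [Complex.ofReal_div, Complex.ofReal_ofNat]
    linear_combination (-1 / 2) * d4
  rw [hL, logDeriv_div _ hΛ hγ (hΛd _) hγd, hlog]

open Classical in
lemma logDeriv_zeta_mul {N : ℕ} [NeZero N] (hN : 1 < N) (χ : DirichletCharacter ℂ N)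
    (hprim : χ.IsPrimitive) (hquad : χ ^ 2 = 1) (hnt : χ ≠ 1)
    (h : riemannZeta (1 / 2) * LFunction χ (1 / 2) ≠ 0) :
    deriv (fun s : ℂ => riemannZeta s * LFunction χ s) (1 / 2) /
        (riemannZeta (1 / 2) * LFunction χ (1 / 2)) =
      logDeriv riemannZeta (1 / 2) - (Real.log N / 2 : ℝ) -
        (if χ.Even then logDeriv Gammaℝ (1 / 2) else logDeriv Gammaℝ (3 / 2)) := by
  have h1 := logDeriv_mul (f := riemannZeta) (g := LFunction χ) (1 / 2) (left_ne_zero_of_mul h)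
    (right_ne_zero_of_mul h) (differentiableAt_riemannZeta (by norm_num))
    (differentiable_LFunction hnt _)
  rw [logDeriv_apply] at h1
  rw [h1, logDeriv_LFunction_half hN χ hprim hquad hnt (right_ne_zero_of_mul h)]
  have : logDeriv (gammaFactor χ) (1 / 2) =
    (if χ.Even then logDeriv Gammaℝ (1 / 2) else logDeriv Gammaℝ (3 / 2)) := by
    rcases χ.even_or_odd with he | ho
    · have : gammaFactor χ = Gammaℝ := funext he.gammaFactor_def
      rw [this, if_pos he]
    · have : gammaFactor χ = fun s => Gammaℝ (s + 1) := funext ho.gammaFactor_def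
      rw [this, if_neg ho.not_even, logDeriv_apply, logDeriv_apply, deriv_comp_add_const]
      norm_num
  rw [this]
  ring


lemma no_mixed {N₁ N₂ : ℕ} [NeZero N₁] [NeZero N₂] (z : ℂ)
   (h : z - (Real.log N₁ / 2 : ℝ) - logDeriv Gammaℝ (1 / 2) = 
     z - (Real.log N₂ / 2 : ℝ) - logDeriv Gammaℝ (3 / 2)) : False := by
  have h1 := logDeriv_Gammaℝ_diff
  have h2 : (Real.log N₁ : ℂ) = ((Real.log N₂ + Real.pi : ℝ) : ℂ) := by
    push_cast at h ⊢
    linear_combination (-2) * h + 2 * h1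
  have h3 : Real.log N₁ = Real.log N₂ + Real.pi := by exact_mod_cast h2
  have p1 : (0 : ℝ) < N₁ := by exact_mod_cast Nat.pos_of_neZero N₁
  have p2 : (0 : ℝ) < N₂ := by exact_mod_cast Nat.pos_of_neZero N₂
  have h4 := congrArg Real.exp h3
  rw [Real.exp_add, Real.exp_log p1, Real.exp_log p2] at h4
  exact exp_pi_irr N₁ N₂ (Nat.pos_of_neZero N₂) h4.symm

end LPart

/-- **Theorem 1 in the language of L-functions.** Let `χ₁`, `χ₂` be primitive quadratic
Dirichlet characters of moduli `N₁, N₂ > 1` with `(N₁, χ₁(−1)) ≠ (N₂, χ₂(−1))`, such that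
`ζ(1/2)L(1/2,χ₁) ≠ 0` and `ζ(1/2)L(1/2,χ₂) ≠ 0`. Then the logarithmic derivatives at
`s = 1/2` of `s ↦ ζ(s)L(s,χ₁)` and `s ↦ ζ(s)L(s,χ₂)` differ. -/
theorem log_deriv_zeta_mul_LFunction_ne {N₁ N₂ : ℕ} [NeZero N₁] [NeZero N₂] (hN₁ : 1 < N₁) (hN₂ : 1 < N₂)
    (χ₁ : DirichletCharacter ℂ N₁) (χ₂ : DirichletCharacter ℂ N₂)
    (hprim₁ : χ₁.IsPrimitive) (hprim₂ : χ₂.IsPrimitive)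
    (hquad₁ : χ₁ ^ 2 = 1) (hquad₂ : χ₂ ^ 2 = 1)
    (hnontriv₁ : χ₁ ≠ 1) (hnontriv₂ : χ₂ ≠ 1)
    (hdistinct : (N₁, χ₁ (-1)) ≠ (N₂, χ₂ (-1)))
    (h₁ : riemannZeta (1 / 2) * DirichletCharacter.LFunction χ₁ (1 / 2) ≠ 0)
    (h₂ : riemannZeta (1 / 2) * DirichletCharacter.LFunction χ₂ (1 / 2) ≠ 0) :
    deriv (fun s : ℂ => riemannZeta s * DirichletCharacter.LFunction χ₁ s) (1 / 2) /
        (riemannZeta (1 / 2) * DirichletCharacter.LFunction χ₁ (1 / 2)) ≠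
      deriv (fun s : ℂ => riemannZeta s * DirichletCharacter.LFunction χ₂ s) (1 / 2) /
        (riemannZeta (1 / 2) * DirichletCharacter.LFunction χ₂ (1 / 2)) := by
  rw [logDeriv_zeta_mul hN₁ χ₁ hprim₁ hquad₁ hnontriv₁ h₁,
    logDeriv_zeta_mul hN₂ χ₂ hprim₂ hquad₂ hnontriv₂ h₂]
  intro heq
  have same : (Real.log N₁ / 2 : ℝ) = (Real.log N₂ / 2 : ℝ) → N₁ = N₂ := by
    intro h
    have h' : Real.log N₁ = Real.log N₂ := by linarith
    have := Real.log_injOn_pos (by simp; omega) (by simp; omega) h'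
    exact_mod_cast this
  rcases χ₁.even_or_odd with e1 | o1 <;> rcases χ₂.even_or_odd with e2 | o2
  · rw [if_pos e1, if_pos e2] at heq
    have : ((Real.log N₁ / 2 : ℝ) : ℂ) = (Real.log N₂ / 2 : ℝ) := by linear_combination -heq
    exact hdistinct (Prod.ext (same (by exact_mod_cast this)) (by rw [e1, e2]))
  · rw [if_pos e1, if_neg o2.not_even] at heq
    exact no_mixed _ heq
  · rw [if_neg o1.not_even, if_pos e2] at heq
    exact no_mixed _ heq.symm
  · rw [if_neg o1.not_even, if_neg o2.not_even] at heq
    have : ((Real.log N₁ / 2 : ℝ) : ℂ) = (Real.log N₂ / 2 : ℝ) := by linear_combination -heq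
    exact hdistinct (Prod.ext (same (by exact_mod_cast this)) (by rw [o1, o2]))
end

section
/- Let K and L be number fields of degrees n and m respectively such that |d_K| and |d_L| are multiplicatively independent, i.e., for all integers a, b, |d_K|^a = |d_L|^b implies a = b = 0. Then at least one of the two real numbers x_K := (1/2)(r₁(K)·π/2 + n·(log(8π)+γ) − log|d_K|) and x_L := (1/2)(r₁(L)·π/2 + m·(log(8π)+γ) − log|d_L|) is transcendental. (This is the pairwise form of Corollary 8, since x_K = ζ_K'(1/2)/ζ_K(1/2) whenever ζ_K(1/2) ≠ 0.) -/
open Polynomial NumberField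

namespace BakerTwo

lemma siegel (K : Type*) [Field K] [NumberField K] : ∃ c : ℝ, 1 ≤ c ∧
    ∀ (p : ℕ) (α β : Type) [Fintype α] [Fintype β] (_ : Fintype.card α = p)
      (_ : Fintype.card β = 2 * p) (_ : 0 < p) (a : Matrix α β (𝓞 K)) (_ : a ≠ 0) (A : ℝ)
      (_ : ∀ k l, ∀ σ : K →+* ℂ, ‖σ (a k l)‖ ≤ A),
      ∃ ξ : β → 𝓞 K, ξ ≠ 0 ∧ a.mulVec ξ = 0 ∧
        ∀ l, ∀ σ : K →+* ℂ, ‖σ (ξ l)‖ ≤ c * (p * A) := by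
  classical
  have key : ∃ c : ℝ, ∀ (p : ℕ) (α β : Type) [Fintype α] [Fintype β] (_ : Fintype.card α = p)
      (_ : Fintype.card β = 2 * p) (_ : 0 < p) (a : Matrix α β (𝓞 K)) (_ : a ≠ 0) (A : ℝ)
      (_ : ∀ k l, house (algebraMap (𝓞 K) K (a k l)) ≤ A),
      ∃ ξ : β → 𝓞 K, ξ ≠ 0 ∧ a.mulVec ξ = 0 ∧ ∀ l, house (ξ l).1 ≤
        c * ((c * (2 * p : ℕ) * A) ^ ((p : ℝ) / ((2 * p : ℕ) - p))) := by
    exact ⟨_, fun p α β _ _ hα hβ hp a ha A hA => NumberField.house.exists_ne_zero_int_vec_house_le K a ha hp (by omega) hβ hA hα⟩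
  obtain ⟨c, hc⟩ := key
  refine ⟨2 * c ^ 2 + 1, by nlinarith [sq_nonneg c], ?_⟩
  intro p α β _ _ hα hβ hp a ha A hA
  have hA' : ∀ k l, house (algebraMap (𝓞 K) K (a k l)) ≤ A := by
    intro k l
    rw [house_eq_sup']
    obtain ⟨σ, _, hσ⟩ := Finset.exists_mem_eq_sup' (Finset.univ_nonempty)
      (fun φ : K →+* ℂ ↦ ‖φ (algebraMap (𝓞 K) K (a k l))‖₊)
    rw [hσ]
    exact hA k l σ
  obtain ⟨ξ, h1, h2, h3⟩ := hc p α β hα hβ hp a ha A hA'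
  refine ⟨ξ, h1, h2, fun l σ => ?_⟩
  have hA0 : 0 ≤ A := by
    have ⟨k⟩ := Fintype.card_pos_iff.1 (hα ▸ hp)
    have ⟨l⟩ : Nonempty β := Fintype.card_pos_iff.1 (by omega)
    exact le_trans (house_nonneg _) (hA' k l)
  have hp' : (p : ℝ) ≠ 0 := by positivity
  have he : (p : ℝ) / ((2 * p : ℕ) - p) = 1 := by
    push_cast
    rw [show (2 * p - p : ℝ) = p by ring]
    exact div_self hp'
  have := (norm_embedding_le_house (ξ l).1 σ).trans (h3 l)
  rw [he, Real.rpow_one] at this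
  refine this.trans ?_
  push_cast
  have : 0 ≤ p * A := by positivity
  nlinarith

lemma liouville {K : Type*} [Field K] [NumberField K] (x : 𝓞 K) (hx : x ≠ 0) (B : ℝ)
    (hB : ∀ σ : K →+* ℂ, ‖σ x‖ ≤ B) (φ : K →+* ℂ) :
    1 ≤ ‖φ x‖ * B ^ (Module.finrank ℚ K - 1) := by
  have h1 := norm_norm_le_norm_mul_house_pow (x : K) φ
  have hB' : house (x : K) ≤ B := by
    rw [house_eq_sup']
    obtain ⟨σ, _, hσ⟩ := Finset.exists_mem_eq_sup' (Finset.univ_nonempty)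
      (fun φ : K →+* ℂ ↦ ‖φ (x : K)‖₊)
    rw [hσ]
    exact hB σ
  have h2 : (1 : ℝ) ≤ ‖Algebra.norm ℚ (x : K)‖ := by
    rw [← Algebra.coe_norm_int]
    have : Algebra.norm ℤ x ≠ 0 := by
      rw [Ne, Algebra.norm_eq_zero_iff]; exact hx
    have h3 := Int.one_le_abs this
    rw [← Rat.norm_cast_real, Real.norm_eq_abs]
    exact_mod_cast h3
  refine h2.trans (h1.trans ?_)
  gcongr
  exact house_nonneg _

lemma factor_one (f : ℂ → ℂ) (hf : Differentiable ℂ f) (a : ℂ) (T : ℕ)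
    (h : (T : ℕ∞) ≤ analyticOrderAt f a) :
    ∃ g : ℂ → ℂ, Differentiable ℂ g ∧ ∀ z, f z = (z - a) ^ T * g z := by
  induction T with
  | zero => exact ⟨f, hf, by simp⟩
  | succ T ih =>
    obtain ⟨g, hg, hfg⟩ := ih (le_trans (by exact_mod_cast Nat.le_succ T) h)
    have hga : g a = 0 := by
      by_contra hne
      have hgA : AnalyticAt ℂ g a := hg.analyticAt a
      have : analyticOrderAt f a = T := by
        rw [AnalyticAt.analyticOrderAt_eq_natCast (hf.analyticAt a)]
        exact ⟨g, hgA, hne, Filter.Eventually.of_forall fun z => by simp [hfg z]⟩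
      rw [this] at h
      have : T + 1 ≤ T := by exact_mod_cast h
      omega
    refine ⟨dslope g a, ?_, fun z => ?_⟩
    · rw [← differentiableOn_univ] at hg ⊢
      exact (Complex.differentiableOn_dslope (by simp)).2 hg
    · have := sub_smul_dslope g a z
      rw [hga, sub_zero, smul_eq_mul] at this
      rw [hfg, ← this]; ring

lemma factor_many (f : ℂ → ℂ) (hf : Differentiable ℂ f) (T : ℕ) (s : Finset ℂ)
    (h : ∀ a ∈ s, (T : ℕ∞) ≤ analyticOrderAt f a) :
    ∃ g : ℂ → ℂ, Differentiable ℂ g ∧ ∀ z, f z = (∏ a ∈ s, (z - a) ^ T) * g z := by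
  classical
  induction s using Finset.induction_on with
  | empty => exact ⟨f, hf, by simp⟩
  | insert a s ha ih =>
    obtain ⟨g, hg, hfg⟩ := ih (fun b hb => h b (Finset.mem_insert_of_mem hb))
    have hprod : Differentiable ℂ (fun z : ℂ => ∏ a ∈ s, (z - a) ^ T) := by fun_prop
    have ho : analyticOrderAt f a = analyticOrderAt g a := by
      have : f = (fun z : ℂ => ∏ a ∈ s, (z - a) ^ T) * g := by ext z; simp [hfg z]
      rw [this, analyticOrderAt_mul (hprod.analyticAt a) (hg.analyticAt a)]
      have h0 : analyticOrderAt (fun z : ℂ => ∏ a ∈ s, (z - a) ^ T) a = 0 := by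
        rw [AnalyticAt.analyticOrderAt_eq_zero (hprod.analyticAt a)]
        rw [Finset.prod_ne_zero_iff]
        intro b hb
        apply pow_ne_zero
        rw [sub_ne_zero]
        rintro rfl
        exact ha hb
      rw [h0, zero_add]
    obtain ⟨g', hg', hgg'⟩ := factor_one g hg a T (ho ▸ h a (Finset.mem_insert_self _ _))
    refine ⟨g', hg', fun z => ?_⟩
    rw [Finset.prod_insert ha, hfg, hgg']; ring

lemma schwarz (f : ℂ → ℂ) (hf : Differentiable ℂ f) (T S : ℕ) (r M : ℝ) (hr : 0 < r)
    (hSr : S ≤ r)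
    (h : ∀ l < S, ∀ t < T, iteratedDeriv t f (l : ℂ) = 0)
    (hM : ∀ z : ℂ, ‖z‖ ≤ 5 * r → ‖f z‖ ≤ M) (z : ℂ) (hz : ‖z‖ ≤ r) :
    ‖f z‖ ≤ M / 2 ^ (T * S) := by
  classical
  let s : Finset ℂ := (Finset.range S).image (fun l : ℕ => (l : ℂ))
  have hs : ∀ F : ℂ → ℂ, ∏ a ∈ s, F a = ∏ l ∈ Finset.range S, F (l : ℂ) := by
    intro F
    exact Finset.prod_image (by intro a _ b _ hab; exact Nat.cast_injective hab)
  obtain ⟨g, hg, hfg⟩ := factor_many f hf T s (by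
    intro a ha
    obtain ⟨l, hl, rfl⟩ := Finset.mem_image.1 ha
    rw [natCast_le_analyticOrderAt_iff_iteratedDeriv_eq_zero (hf.analyticAt _)]
    exact h l (Finset.mem_range.1 hl))
  simp only [hs] at hfg
  have hl : ∀ l ∈ Finset.range S, ‖(l : ℂ)‖ ≤ r := by
    intro l hl
    rw [Complex.norm_natCast]
    have : (l : ℝ) ≤ S := by exact_mod_cast (Finset.mem_range.1 hl).le
    linarith
  have hgb : ‖g z‖ ≤ M / (4 * r) ^ (T * S) := by
    refine Complex.norm_le_of_forall_mem_frontier_norm_le (U := Metric.ball 0 (5 * r))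
      Metric.isBounded_ball hg.diffContOnCl ?_ (subset_closure (by simp; linarith))
    intro w hw
    rw [frontier_ball _ (by positivity)] at hw
    have hw' : ‖w‖ = 5 * r := by simpa using hw
    have h1 := hM w hw'.le
    rw [hfg, norm_mul] at h1
    have h2 : (4 * r) ^ (T * S) ≤ ‖∏ l ∈ Finset.range S, (w - (l : ℂ)) ^ T‖ := by
      rw [norm_prod]
      calc (4 * r) ^ (T * S) = ∏ l ∈ Finset.range S, (4 * r) ^ T := by
            simp [pow_mul]
        _ ≤ _ := by
            apply Finset.prod_le_prod
            · intros; positivity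
            · intro l hl'
              rw [norm_pow]
              gcongr
              have := norm_sub_norm_le w (l : ℂ)
              have := hl l hl'
              linarith
    rw [le_div_iff₀ (by positivity)]
    calc ‖g w‖ * (4 * r) ^ (T * S) ≤ ‖g w‖ * ‖∏ l ∈ Finset.range S, (w - (l : ℂ)) ^ T‖ := by gcongr
      _ ≤ M := by rw [mul_comm]; exact h1
  have h3 : ‖∏ l ∈ Finset.range S, (z - (l : ℂ)) ^ T‖ ≤ (2 * r) ^ (T * S) := by
    rw [norm_prod]
    calc _ ≤ ∏ l ∈ Finset.range S, (2 * r) ^ T := by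
            apply Finset.prod_le_prod
            · intros; positivity
            · intro l hl'
              rw [norm_pow]
              gcongr
              have := norm_sub_le z (l : ℂ)
              have := hl l hl'
              linarith
      _ = _ := by simp [pow_mul]
  rw [hfg, norm_mul]
  calc _ ≤ (2 * r) ^ (T * S) * (M / (4 * r) ^ (T * S)) := by gcongr
    _ = M / 2 ^ (T * S) := by
      rw [show 4 * r = 2 * (2 * r) by ring, mul_pow 2 (2 * r)]
      field_simp

lemma expPoly {F : Type*} [Field F] [CharZero F] (s : Finset F) (hs : ∀ x ∈ s, x ≠ 0) (N : ℕ) :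
    ∀ (d : F → ℕ) (R : F → F[X]), (∀ x ∈ s, (R x).degree < d x) → (∑ x ∈ s, d x = N) →
      (∀ l < N, ∑ x ∈ s, (R x).eval (l : F) * x ^ l = 0) → ∀ x ∈ s, R x = 0 := by
  classical
  induction N with
  | zero =>
    intro d R hd hN _ x hx
    have : d x = 0 := by
      have := Finset.sum_eq_zero_iff.1 hN x hx
      exact this
    have h := hd x hx
    rw [this] at h
    by_contra hne
    rw [degree_eq_natDegree hne] at h
    exact absurd h (by simp)
  | succ N ih =>
    intro d R hd hN hl
    obtain ⟨x₀, hx₀, hd0⟩ : ∃ x ∈ s, d x ≠ 0 := by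
      by_contra! hcon
      rw [Finset.sum_eq_zero hcon] at hN
      omega
    set R' : F → F[X] := fun x => C x * (R x).comp (X + 1) - C x₀ * R x with hR'
    have hdeg : ∀ P : F[X], (P.comp (X + 1)).degree ≤ P.degree := by
      intro P
      have : (P.comp (X + 1)) = taylor 1 P := by simp [taylor_apply]
      rw [this, degree_taylor]
    have key := ih (Function.update d x₀ (d x₀ - 1)) R' ?_ ?_ ?_
    · have hne : ∀ x ∈ s, x ≠ x₀ → R x = 0 := by
        intro x hx hxx
        have h := key x hx
        by_contra h0
        have h' : C x * taylor 1 (R x) = C x₀ * R x := by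
          rw [taylor_apply]; simpa [hR', sub_eq_zero] using h
        have h'' := congrArg leadingCoeff h'
        rw [leadingCoeff_mul, leadingCoeff_mul, leadingCoeff_C, leadingCoeff_C,
          leadingCoeff_taylor] at h''
        exact hxx (mul_right_cancel₀ (leadingCoeff_ne_zero.2 h0) h'')
      have h0 : R x₀ = 0 := by
        have h := key x₀ hx₀
        have h' : (R x₀).comp (X + 1) = R x₀ := by
          have : C x₀ * ((R x₀).comp (X + 1) - R x₀) = 0 := by rw [mul_sub]; exact h
          rcases mul_eq_zero.1 this with h1 | h1
          · exact absurd (C_eq_zero.1 h1) (hs _ hx₀)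
          · exact sub_eq_zero.1 h1
        have hz : (R x₀).eval 0 = 0 := by
          have := hl 0 (by omega)
          rw [Finset.sum_eq_single x₀] at this
          · simpa using this
          · intro x hx hxx; simp [hne x hx hxx]
          · intro h; exact absurd hx₀ h
        have hn : ∀ n : ℕ, (R x₀).eval (n : F) = 0 := by
          intro n
          induction n with
          | zero => simpa using hz
          | succ n ihn =>
            rw [← h'] at ihn
            simpa using ihn
        apply Polynomial.eq_zero_of_infinite_isRoot
        refine Set.Infinite.mono (s := Set.range (fun n : ℕ => (n : F))) ?_
          (Set.infinite_range_of_injective Nat.cast_injective)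
        rintro _ ⟨n, rfl⟩
        exact hn n
      intro x hx
      by_cases hxx : x = x₀
      · rw [hxx, h0]
      · exact hne x hx hxx
    · intro x hx
      by_cases hxx : x = x₀
      · subst hxx
        rw [Function.update_self]
        have hdx := hd x hx
        by_cases hR0 : R x = 0
        · simp [hR', hR0]; 
        have h1 : R' x = C x * (taylor 1 (R x) - R x) := by
          simp only [hR', taylor_apply]; rw [mul_sub, C_1]
        rw [h1, degree_C_mul (hs x hx)]
        have h2 : (taylor 1 (R x) - R x).degree < (taylor 1 (R x)).degree := by
          apply degree_sub_lt_left
          · rw [degree_taylor]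
          · intro h; apply hR0; simpa using h
          · rw [leadingCoeff_taylor]
        rw [degree_taylor] at h2
        rw [degree_eq_natDegree hR0] at h2 hdx
        refine h2.trans_le ?_
        have : (R x).natDegree < d x := by exact_mod_cast hdx
        exact_mod_cast (by omega : (R x).natDegree ≤ d x - 1)
      · rw [Function.update_of_ne hxx]
        refine (degree_sub_le _ _).trans_lt (max_lt ?_ ?_)
        · refine lt_of_le_of_lt ?_ (hd x hx)
          rw [← smul_eq_C_mul]
          exact (degree_smul_le _ _).trans (hdeg _)
        · refine lt_of_le_of_lt ?_ (hd x hx)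
          rw [← smul_eq_C_mul]
          exact degree_smul_le _ _
    · rw [Finset.sum_update_of_mem hx₀]
      rw [← Finset.add_sum_erase s d hx₀, Finset.erase_eq] at hN
      omega
    · intro l hlN
      have h1 := hl l (by omega)
      have h2 := hl (l + 1) (by omega)
      calc ∑ x ∈ s, (R' x).eval (l : F) * x ^ l
          = ∑ x ∈ s, (R x).eval ((l + 1 : ℕ) : F) * x ^ (l + 1)
            - x₀ * ∑ x ∈ s, (R x).eval (l : F) * x ^ l := by
            rw [Finset.mul_sum, ← Finset.sum_sub_distrib]
            refine Finset.sum_congr rfl fun x _ => ?_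
            simp [hR']; ring
        _ = 0 := by rw [h1, h2]; simp


lemma expPoly' {F : Type*} [Field F] [CharZero F] (L : ℕ) (x : Fin L → F)
    (hx : Function.Injective x) (hx0 : ∀ k, x k ≠ 0) (R : Fin L → F[X])
    (hR : ∀ k, (R k).degree < L)
    (h : ∀ l < L * L, ∑ k, (R k).eval (l : F) * x k ^ l = 0) : ∀ k, R k = 0 := by
  classical
  rcases Nat.eq_zero_or_pos L with rfl | hL
  · intro k; exact k.elim0
  have : Nonempty (Fin L) := ⟨⟨0, hL⟩⟩
  have hinv : ∀ k, Function.invFun x (x k) = k := Function.leftInverse_invFun hx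
  have := expPoly (Finset.univ.image x) (by
      intro y hy
      obtain ⟨k, _, rfl⟩ := Finset.mem_image.1 hy
      exact hx0 k) (L * L) (fun _ => L) (fun y => R (Function.invFun x y))
      (fun y _ => hR _) (by
        rw [Finset.sum_const, Finset.card_image_of_injective _ hx]; simp) (by
        intro l hl
        rw [Finset.sum_image (fun a _ b _ hab => hx hab)]
        simp only [hinv]
        exact h l hl)
  intro k
  have h2 := this (x k) (Finset.mem_image_of_mem _ (Finset.mem_univ _))
  simpa [hinv] using h2

section algebra

variable {R : Type*} [CommRing R]

/-- The operator `d/dX + k b₀` on polynomials. -/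
noncomputable def Dk (b0 : R) (k : ℕ) : R[X] →ₗ[R] R[X] :=
  derivative + ((k : R) * b0) • LinearMap.id

lemma Dk_apply (b0 : R) (k : ℕ) (P : R[X]) :
    Dk b0 k P = derivative P + C ((k : R) * b0) * P := by
  simp [Dk, smul_eq_C_mul]

lemma Dk_succ (b0 : R) (k m : ℕ) (P : R[X]) :
    (Dk b0 k ^ (m + 1)) P = derivative ((Dk b0 k ^ m) P) + C ((k : R) * b0) * (Dk b0 k ^ m) P := by
  rw [pow_succ', Module.End.mul_apply, Dk_apply]

lemma coeff_bound (σ : R →+* ℂ) (b0 : R) (B : ℝ) (hB : ‖σ b0‖ ≤ B) (L k : ℕ) (hk : k ≤ L)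
    (P : R[X]) (H : ℝ) (hdeg : ∀ n ≥ L, P.coeff n = 0) (hH : ∀ n, ‖σ (P.coeff n)‖ ≤ H) (m : ℕ) :
    (∀ n ≥ L, ((Dk b0 k ^ m) P).coeff n = 0) ∧
      ∀ n, ‖σ (((Dk b0 k ^ m) P).coeff n)‖ ≤ ((1 + B) * L) ^ m * H := by
  have hB0 : 0 ≤ B := (norm_nonneg _).trans hB
  have hH0 : 0 ≤ H := (norm_nonneg _).trans (hH 0)
  induction m with
  | zero => simpa using ⟨hdeg, hH⟩
  | succ m ih =>
    obtain ⟨ih1, ih2⟩ := ih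
    have hc : ∀ n, ((Dk b0 k ^ (m + 1)) P).coeff n =
        ((Dk b0 k ^ m) P).coeff (n + 1) * ((n : R) + 1) + (k : R) * b0 * ((Dk b0 k ^ m) P).coeff n := by
      intro n
      rw [Dk_succ, coeff_add, coeff_derivative, coeff_C_mul]
    refine ⟨fun n hn => ?_, fun n => ?_⟩
    · rw [hc, ih1 n hn, ih1 (n + 1) (by omega)]; simp
    · rw [hc, map_add, map_mul, map_mul, map_mul, map_add, map_natCast, map_natCast, map_one]
      set Z := ((1 + B) * L) ^ m * H with hZ
      have hZ0 : 0 ≤ Z := by positivity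
      have h1 : ‖σ (((Dk b0 k ^ m) P).coeff (n + 1)) * ((n : ℂ) + 1)‖ ≤ Z * L := by
        by_cases hn : n + 1 < L
        · rw [norm_mul]
          have h3 : ‖(n : ℂ) + 1‖ ≤ L := by
            have : (n : ℂ) + 1 = ((n + 1 : ℕ) : ℂ) := by push_cast; rfl
            rw [this, Complex.norm_natCast]
            exact_mod_cast hn.le
          exact mul_le_mul (ih2 _) h3 (norm_nonneg _) hZ0
        · rw [ih1 (n + 1) (by omega)]; simp; positivity
      have h2 : ‖(k : ℂ) * σ b0 * σ (((Dk b0 k ^ m) P).coeff n)‖ ≤ L * B * Z := by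
        rw [norm_mul, norm_mul, Complex.norm_natCast]
        have : (k : ℝ) ≤ L := by exact_mod_cast hk
        gcongr
        exact ih2 n
      calc _ ≤ Z * L + L * B * Z := (norm_add_le _ _).trans (add_le_add h1 h2)
        _ = _ := by rw [hZ]; ring

lemma eval_bound (σ : R →+* ℂ) (L : ℕ) (Q : R[X]) (H r : ℝ) (hdeg : ∀ n ≥ L, Q.coeff n = 0)
    (hH : ∀ n, ‖σ (Q.coeff n)‖ ≤ H) (hr : 1 ≤ r) (z : ℂ) (hz : ‖z‖ ≤ r) :
    ‖(Q.map σ).eval z‖ ≤ L * H * r ^ L := by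
  have hH0 : 0 ≤ H := (norm_nonneg _).trans (hH 0)
  rcases Nat.eq_zero_or_pos L with rfl | hL
  · have : Q = 0 := by ext n; simpa using hdeg n (by omega)
    simp [this]
  have hlt : (Q.map σ).natDegree < L := by
    have : (Q.map σ).natDegree ≤ L - 1 := by
      rw [natDegree_le_iff_coeff_eq_zero]
      intro n hn
      simp [hdeg n (by omega)]
    omega
  rw [eval_eq_sum_range' hlt]
  calc _ ≤ ∑ i ∈ Finset.range L, ‖(Q.map σ).coeff i * z ^ i‖ := norm_sum_le _ _
    _ ≤ ∑ i ∈ Finset.range L, H * r ^ L := by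
      apply Finset.sum_le_sum
      intro i hi
      rw [norm_mul, norm_pow, coeff_map]
      have h1 : ‖z‖ ^ i ≤ r ^ L := by
        calc ‖z‖ ^ i ≤ r ^ i := by gcongr
          _ ≤ r ^ L := pow_le_pow_right₀ hr (Finset.mem_range.1 hi).le
      exact mul_le_mul (hH _) h1 (by positivity) hH0
    _ = _ := by simp; ring

lemma term_bound (σ : R →+* ℂ) (b0 b1 : R) (B : ℝ) (hB0 : ‖σ b0‖ ≤ B) (hB1 : ‖σ b1‖ ≤ B)
    (L j k : ℕ) (hj : j ≤ L) (hk : k ≤ L)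
    (P : R[X]) (H r W : ℝ) (hdeg : ∀ n ≥ L, P.coeff n = 0) (hH : ∀ n, ‖σ (P.coeff n)‖ ≤ H)
    (hr : 1 ≤ r) (z w : ℂ) (hz : ‖z‖ ≤ r) (hw : ‖w‖ ≤ W) (m0 m1 N : ℕ) (hL : 1 ≤ L)
    (hN : m0 + m1 ≤ N) :
    ‖σ ((j : R) + k * b1) ^ m1 * (((Dk b0 k ^ m0) P).map σ).eval z * w‖ ≤
      L * ((1 + B) * L) ^ N * H * r ^ L * W := by
  have hB : 0 ≤ B := (norm_nonneg _).trans hB0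
  have hH0 : 0 ≤ H := (norm_nonneg _).trans (hH 0)
  obtain ⟨h1, h2⟩ := coeff_bound σ b0 B hB0 L k hk P H hdeg hH m0
  have h3 := eval_bound σ L _ _ r h1 h2 hr z hz
  have h4 : ‖σ ((j : R) + k * b1)‖ ≤ (1 + B) * L := by
    rw [map_add, map_mul, map_natCast, map_natCast]
    refine (norm_add_le _ _).trans ?_
    rw [norm_mul, Complex.norm_natCast, Complex.norm_natCast]
    have h5 : (j : ℝ) ≤ L := by exact_mod_cast hj
    have h6 : (k : ℝ) ≤ L := by exact_mod_cast hk
    have : (k : ℝ) * ‖σ b1‖ ≤ L * B := by gcongr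
    linarith
  have hone : 1 ≤ (1 + B) * L := by
    have : (1 : ℝ) ≤ L := by exact_mod_cast hL
    nlinarith
  rw [norm_mul, norm_mul, norm_pow]
  calc _ ≤ ((1 + B) * L) ^ m1 * (L * (((1 + B) * L) ^ m0 * H) * r ^ L) * W := by gcongr
    _ = L * ((1 + B) * L) ^ (m0 + m1) * H * r ^ L * W := by rw [pow_add]; ring
    _ ≤ _ := by
      have hW : 0 ≤ W := (norm_nonneg _).trans hw
      have := pow_le_pow_right₀ hone hN
      gcongr

/-- Values at integers. -/
noncomputable def val (L : ℕ) (b0 b1 : R) (u v : ℕ) (P : Fin L × Fin L → R[X]) (m0 m1 l : ℕ) : R :=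
  ∑ jk : Fin L × Fin L, (((jk.1 : ℕ) : R) + ((jk.2 : ℕ) : R) * b1) ^ m1 *
    ((Dk b0 jk.2 ^ m0) (P jk)).eval (l : R) *
    ((u : R) ^ ((jk.2 : ℕ) * l) * (v : R) ^ ((L - jk.2) * l))

/-- Auxiliary functions. -/
noncomputable def fn (σ : R →+* ℂ) (lam : ℂ) (L : ℕ) (b0 b1 : R) (P : Fin L × Fin L → R[X])
    (m0 m1 : ℕ) (z : ℂ) : ℂ :=
  ∑ jk : Fin L × Fin L, σ (((jk.1 : ℕ) : R) + ((jk.2 : ℕ) : R) * b1) ^ m1 *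
    (((Dk b0 jk.2 ^ m0) (P jk)).map σ).eval z *
    Complex.exp ((((jk.1 : ℕ) : ℂ) * (2 * Real.pi * Complex.I) + ((jk.2 : ℕ) : ℂ) * lam) * z)

lemma fn_hasDerivAt (σ : R →+* ℂ) (lam : ℂ) (L : ℕ) (b0 b1 : R) (P : Fin L × Fin L → R[X])
    (h : σ b0 + σ b1 * (2 * Real.pi * Complex.I) = lam) (m0 m1 : ℕ) (z : ℂ) :
    HasDerivAt (fn σ lam L b0 b1 P m0 m1)
      (fn σ lam L b0 b1 P (m0 + 1) m1 z
        + (2 * Real.pi * Complex.I) * fn σ lam L b0 b1 P m0 (m1 + 1) z) z := by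
  unfold fn
  rw [Finset.mul_sum, ← Finset.sum_add_distrib]
  refine HasDerivAt.fun_sum fun jk _ => ?_
  set c := ((jk.1 : ℕ) : ℂ) * (2 * Real.pi * Complex.I) + ((jk.2 : ℕ) : ℂ) * lam with hc
  set Q := (Dk b0 jk.2 ^ m0) (P jk) with hQ
  have h1 : HasDerivAt (fun z => Complex.exp (c * z)) (Complex.exp (c * z) * (c * 1)) z :=
    (((hasDerivAt_id z).const_mul c)).cexp
  have h2 := (((Q.map σ).hasDerivAt z).const_mul
    (σ (((jk.1 : ℕ) : R) + ((jk.2 : ℕ) : R) * b1) ^ m1)).mul h1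
  refine h2.congr_deriv ?_
  rw [Dk_succ, ← hQ, Polynomial.map_add, Polynomial.map_mul, Polynomial.map_C, eval_add, eval_mul, eval_C,
    derivative_map, pow_succ, hc, ← h]
  simp only [map_add, map_mul, map_natCast]
  ring

lemma fn_differentiable (σ : R →+* ℂ) (lam : ℂ) (L : ℕ) (b0 b1 : R) (P : Fin L × Fin L → R[X])
    (h : σ b0 + σ b1 * (2 * Real.pi * Complex.I) = lam) (m0 m1 : ℕ) :
    Differentiable ℂ (fn σ lam L b0 b1 P m0 m1) :=
  fun z => (fn_hasDerivAt σ lam L b0 b1 P h m0 m1 z).differentiableAt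

lemma fn_iteratedDeriv (σ : R →+* ℂ) (lam : ℂ) (L : ℕ) (b0 b1 : R) (P : Fin L × Fin L → R[X])
    (h : σ b0 + σ b1 * (2 * Real.pi * Complex.I) = lam) (N : ℕ) (z : ℂ)
    (hz : ∀ m0 < N, ∀ m1 < N, fn σ lam L b0 b1 P m0 m1 z = 0) (t : ℕ) :
    ∀ m0 m1, m0 + t < N → m1 + t < N →
      iteratedDeriv t (fn σ lam L b0 b1 P m0 m1) z = 0 := by
  induction t with
  | zero => intro m0 m1 h0 h1; simpa using hz m0 h0 m1 h1
  | succ t ih =>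
    intro m0 m1 h0 h1
    have hd : deriv (fn σ lam L b0 b1 P m0 m1) = (fn σ lam L b0 b1 P (m0 + 1) m1)
        + (fun z => (2 * Real.pi * Complex.I) * fn σ lam L b0 b1 P m0 (m1 + 1) z) := by
      ext z
      exact (fn_hasDerivAt σ lam L b0 b1 P h m0 m1 z).deriv
    have hcd : ∀ m0 m1, ContDiffAt ℂ t (fn σ lam L b0 b1 P m0 m1) z := fun m0 m1 =>
      ((fn_differentiable σ lam L b0 b1 P h m0 m1).contDiff).contDiffAt
    rw [iteratedDeriv_succ', hd, iteratedDeriv_add (hcd _ _) (contDiffAt_const.mul (hcd _ _)),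
      iteratedDeriv_const_mul_field, ih _ _ (by omega) (by omega), ih _ _ (by omega) (by omega)]
    simp

lemma fn_nat (σ : R →+* ℂ) (lam : ℂ) (L : ℕ) (b0 b1 : R) (P : Fin L × Fin L → R[X])
    (u v : ℕ) (hv : 0 < v) (h : Complex.exp lam = (u : ℂ) / v) (m0 m1 l : ℕ) :
    fn σ lam L b0 b1 P m0 m1 l * (v : ℂ) ^ (L * l) = σ (val L b0 b1 u v P m0 m1 l) := by
  unfold fn val
  rw [map_sum, Finset.sum_mul]
  refine Finset.sum_congr rfl fun jk _ => ?_
  have hv' : (v : ℂ) ≠ 0 := by exact_mod_cast hv.ne'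
  have h1 : Complex.exp ((((jk.1 : ℕ) : ℂ) * (2 * Real.pi * Complex.I) + ((jk.2 : ℕ) : ℂ) * lam) * l)
      = ((u : ℂ) / v) ^ ((jk.2 : ℕ) * l) := by
    rw [← h, ← Complex.exp_nat_mul, add_mul, Complex.exp_add]
    have : Complex.exp (((jk.1 : ℕ) : ℂ) * (2 * Real.pi * Complex.I) * l) = 1 := by
      rw [Complex.exp_eq_one_iff]
      exact ⟨(jk.1 : ℕ) * l, by push_cast; ring⟩
    rw [this, one_mul]
    congr 1
    push_cast; ring
  have h2 : (v : ℂ) ^ (L * l) = (v : ℂ) ^ ((jk.2 : ℕ) * l) * (v : ℂ) ^ ((L - jk.2) * l) := by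
    rw [← pow_add, ← add_mul, Nat.add_sub_cancel' jk.2.2.le]
  have h3 : ((((Dk b0 jk.2 ^ m0) (P jk)).map σ).eval (l : ℂ)) =
      σ (((Dk b0 jk.2 ^ m0) (P jk)).eval (l : R)) := by
    rw [← map_natCast σ l, eval_map_apply]
  rw [h1, h2, h3, div_pow]
  simp only [map_mul, map_pow, map_natCast]
  field_simp

lemma sum_bound (σ : R →+* ℂ) (b0 b1 : R) (B : ℝ) (hB0 : ‖σ b0‖ ≤ B) (hB1 : ‖σ b1‖ ≤ B)
    (L : ℕ) (P : Fin L × Fin L → R[X]) (H r W : ℝ) (hdeg : ∀ jk, ∀ n ≥ L, (P jk).coeff n = 0)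
    (hH : ∀ jk n, ‖σ ((P jk).coeff n)‖ ≤ H)
    (hr : 1 ≤ r) (z : ℂ) (w : Fin L × Fin L → ℂ) (hz : ‖z‖ ≤ r) (hw : ∀ jk, ‖w jk‖ ≤ W)
    (m0 m1 N : ℕ) (hL : 1 ≤ L) (hN : m0 + m1 ≤ N) :
    ‖∑ jk : Fin L × Fin L, σ (((jk.1 : ℕ) : R) + ((jk.2 : ℕ) : R) * b1) ^ m1 *
      (((Dk b0 jk.2 ^ m0) (P jk)).map σ).eval z * w jk‖ ≤
      L ^ 3 * ((1 + B) * L) ^ N * H * r ^ L * W := by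
  calc _ ≤ ∑ jk : Fin L × Fin L, L * ((1 + B) * L) ^ N * H * r ^ L * W := by
        refine (norm_sum_le _ _).trans (Finset.sum_le_sum fun jk _ => ?_)
        exact term_bound σ b0 b1 B hB0 hB1 L jk.1 jk.2 jk.1.2.le jk.2.2.le (P jk) H r W
          (hdeg jk) (hH jk) hr z (w jk) hz (hw jk) m0 m1 N hL hN
    _ = _ := by
      rw [Finset.sum_const, Finset.card_univ, Fintype.card_prod, Fintype.card_fin]
      simp only [nsmul_eq_mul]; push_cast; ring

lemma weight_bound (L u v k l S : ℕ) (hu : 0 < u) (hv : 0 < v) (hk : k ≤ L) (hl : l ≤ S) :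
    ‖(u : ℂ) ^ (k * l) * (v : ℂ) ^ ((L - k) * l)‖ ≤ ((u : ℝ) * v) ^ (L * S) := by
  have hu1 : (1 : ℝ) ≤ u := by exact_mod_cast hu
  have hv1 : (1 : ℝ) ≤ v := by exact_mod_cast hv
  rw [norm_mul, norm_pow, norm_pow, Complex.norm_natCast, Complex.norm_natCast, mul_pow]
  have h1 : k * l ≤ L * S := Nat.mul_le_mul hk hl
  have h2 : (L - k) * l ≤ L * S := Nat.mul_le_mul (Nat.sub_le _ _) hl
  gcongr

lemma val_bound (σ : R →+* ℂ) (b0 b1 : R) (B : ℝ) (hB0 : ‖σ b0‖ ≤ B) (hB1 : ‖σ b1‖ ≤ B)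
    (L u v : ℕ) (hu : 0 < u) (hv : 0 < v)
    (P : Fin L × Fin L → R[X]) (H : ℝ) (hdeg : ∀ jk, ∀ n ≥ L, (P jk).coeff n = 0)
    (hH : ∀ jk n, ‖σ ((P jk).coeff n)‖ ≤ H) (S : ℕ) (hS : 1 ≤ S)
    (m0 m1 l N : ℕ) (hL : 1 ≤ L) (hN : m0 + m1 ≤ N) (hl : l ≤ S) :
    ‖σ (val L b0 b1 u v P m0 m1 l)‖ ≤
      L ^ 3 * ((1 + B) * L) ^ N * H * (S : ℝ) ^ L * ((u : ℝ) * v) ^ (L * S) := by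
  have := sum_bound σ b0 b1 B hB0 hB1 L P H S (((u : ℝ) * v) ^ (L * S)) hdeg hH
    (by exact_mod_cast hS) (l : ℂ)
    (fun jk => (u : ℂ) ^ ((jk.2 : ℕ) * l) * (v : ℂ) ^ ((L - jk.2) * l))
    (by rw [Complex.norm_natCast]; exact_mod_cast hl)
    (fun jk => weight_bound L u v jk.2 l S hu hv jk.2.2.le hl) m0 m1 N hL hN
  convert this using 2
  unfold val
  rw [map_sum]
  refine Finset.sum_congr rfl fun jk _ => ?_
  have h3 : ((((Dk b0 jk.2 ^ m0) (P jk)).map σ).eval (l : ℂ)) =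
      σ (((Dk b0 jk.2 ^ m0) (P jk)).eval (l : R)) := by
    rw [← map_natCast σ l, eval_map_apply]
  rw [h3]
  simp only [map_mul, map_pow, map_natCast]

lemma fn_bound (σ : R →+* ℂ) (lam : ℂ) (b0 b1 : R) (B : ℝ) (hB0 : ‖σ b0‖ ≤ B) (hB1 : ‖σ b1‖ ≤ B)
    (L : ℕ) (P : Fin L × Fin L → R[X]) (H : ℝ) (hdeg : ∀ jk, ∀ n ≥ L, (P jk).coeff n = 0)
    (hH : ∀ jk n, ‖σ ((P jk).coeff n)‖ ≤ H) (r : ℝ) (hr : 1 ≤ r)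
    (m0 m1 N : ℕ) (hL : 1 ≤ L) (hN : m0 + m1 ≤ N) (z : ℂ) (hz : ‖z‖ ≤ r) :
    ‖fn σ lam L b0 b1 P m0 m1 z‖ ≤
      L ^ 3 * ((1 + B) * L) ^ N * H * r ^ L * Real.exp ((2 * Real.pi + ‖lam‖) * L * r) := by
  unfold fn
  refine sum_bound σ b0 b1 B hB0 hB1 L P H r _ hdeg hH hr z _ hz (fun jk => ?_) m0 m1 N hL hN
  refine (Complex.norm_exp_le_exp_norm _).trans (Real.exp_le_exp.2 ?_)
  rw [norm_mul]
  refine mul_le_mul ?_ hz (norm_nonneg _) (by positivity)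
  refine (norm_add_le _ _).trans ?_
  have h1 : ((jk.1 : ℕ) : ℝ) ≤ L := by exact_mod_cast jk.1.2.le
  have h2 : ((jk.2 : ℕ) : ℝ) ≤ L := by exact_mod_cast jk.2.2.le
  have h3 : ‖(2 * Real.pi * Complex.I : ℂ)‖ = 2 * Real.pi := by
    simp [abs_of_pos Real.pi_pos]
  rw [norm_mul _ (2 * Real.pi * Complex.I : ℂ), norm_mul _ lam, Complex.norm_natCast,
    Complex.norm_natCast, h3]
  have h4 : ((jk.1 : ℕ) : ℝ) * (2 * Real.pi) ≤ L * (2 * Real.pi) := by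
    have := Real.pi_pos
    gcongr
  have h5 : ((jk.2 : ℕ) : ℝ) * ‖lam‖ ≤ L * ‖lam‖ := by gcongr
  linarith

end algebra

lemma numeric (B ω c w : ℝ) (hB : 0 ≤ B) (hω : 0 ≤ ω) (hc : 1 ≤ c) (hw : 1 ≤ w) :
    ∃ C : ℝ, 1 ≤ C ∧ ∀ h S L T : ℕ, 1 ≤ h → h ^ 2 ≤ S → L = 2 ^ 9 * h ^ 6 → T = 2 ^ 13 * h ^ 8 →
      ((1 + B) * L) ^ (2 * T) ≤ C ^ (h ^ 7 * S) ∧ (L : ℝ) ^ 3 ≤ C ^ (h ^ 7 * S) ∧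
      ((2 ^ 26 * h ^ 18 : ℕ) : ℝ) ≤ C ^ (h ^ 7 * S) ∧
      (5 * ((S * h : ℕ) : ℝ)) ^ L ≤ C ^ (h ^ 7 * S) ∧
      w ^ (L * (S * h)) ≤ C ^ (h ^ 7 * S) ∧
      Real.exp (ω * L * (5 * ((S * h : ℕ) : ℝ))) ≤ C ^ (h ^ 7 * S) ∧ c ≤ C ^ (h ^ 7 * S) := by
  have hp1 : ∀ (x : ℝ) (n : ℕ), 1 ≤ x → 1 ≤ x ^ n := fun x n hx => one_le_pow₀ hx
  set C1 : ℝ := ((1 + B) * 2 ^ 15) ^ (2 ^ 14) with hC1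
  set C4 : ℝ := 2 ^ (5 * 2 ^ 9) with hC4
  set C5 : ℝ := w ^ (2 ^ 9) with hC5
  set C6 : ℝ := Real.exp (ω * 2 ^ 9 * 5) with hC6
  have hG : (1 : ℝ) ≤ (1 + B) * 2 ^ 15 := by nlinarith
  have h1 : 1 ≤ C1 := hp1 _ _ hG
  have h4 : 1 ≤ C4 := hp1 _ _ (by norm_num)
  have h5 : 1 ≤ C5 := hp1 _ _ hw
  have h6 : 1 ≤ C6 := Real.one_le_exp (by positivity)
  clear_value C4 C5 C6 C1
  refine ⟨C1 + 2 ^ 45 + C4 + C5 + C6 + c, by linarith, ?_⟩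
  intro h S L T hh hS hL hT
  set C := C1 + 2 ^ 45 + C4 + C5 + C6 + c with hC
  have hX : 1 ≤ h ^ 7 * S := Nat.mul_pos (by positivity) (lt_of_lt_of_le (by positivity) hS)
  have hX9 : h ^ 9 ≤ h ^ 7 * S := by
    calc h ^ 9 = h ^ 7 * h ^ 2 := by ring
      _ ≤ _ := Nat.mul_le_mul_left _ hS
  have hXh : h ≤ h ^ 7 * S := by
    refine le_trans ?_ hX9
    calc h = h ^ 1 := by simp
      _ ≤ h ^ 9 := Nat.pow_le_pow_right hh (by norm_num)
  have hle : ∀ x : ℝ, 0 ≤ x → x ≤ C → x ^ (h ^ 7 * S) ≤ C ^ (h ^ 7 * S) := fun x hx hxC => by gcongr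
  have h2h : ∀ n : ℕ, (n : ℝ) ≤ 2 ^ n := fun n => by exact_mod_cast Nat.lt_two_pow_self.le
  have hhR : (h : ℝ) ≤ 2 ^ h := h2h h
  have hLb : (L : ℝ) ≤ (2 ^ 15) ^ h := by
    rw [hL, show ((2 ^ 9 * h ^ 6 : ℕ) : ℝ) = (2 : ℝ) ^ 9 * h ^ 6 by norm_num]
    calc (2 : ℝ) ^ 9 * h ^ 6 ≤ (2 ^ 9) ^ h * (2 ^ h) ^ 6 := by
          gcongr
          exact le_self_pow₀ (by norm_num) (by omega)
      _ = (2 ^ 15) ^ h := by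
        rw [← pow_mul, ← pow_mul, ← pow_add, ← pow_mul]; congr 1; ring
  refine ⟨?_, ?_, ?_, ?_, ?_, ?_, ?_⟩
  · refine le_trans ?_ (hle C1 (by linarith) (by rw [hC]; linarith))
    calc ((1 + B) * L) ^ (2 * T) ≤ (((1 + B) * 2 ^ 15) ^ h) ^ (2 * T) := by
          gcongr
          rw [mul_pow]
          gcongr
          exact le_self_pow₀ (by linarith) (by omega)
      _ = C1 ^ (h ^ 9) := by
          rw [hC1, ← pow_mul, ← pow_mul, hT]; congr 1; ring
      _ ≤ _ := pow_le_pow_right₀ h1 hX9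
  · refine le_trans ?_ (hle (2 ^ 45) (by positivity) (by rw [hC]; linarith))
    calc (L : ℝ) ^ 3 ≤ ((2 ^ 15) ^ h) ^ 3 := by gcongr
      _ = (2 ^ 45) ^ h := by rw [← pow_mul, mul_comm h 3, pow_mul]; norm_num
      _ ≤ _ := pow_le_pow_right₀ (by norm_num) hXh
  · refine le_trans ?_ (hle (2 ^ 45) (by positivity) (by rw [hC]; linarith))
    rw [show ((2 ^ 26 * h ^ 18 : ℕ) : ℝ) = (2 : ℝ) ^ 26 * h ^ 18 by norm_num]
    calc (2 : ℝ) ^ 26 * h ^ 18 ≤ (2 ^ 26) ^ h * (2 ^ h) ^ 18 := by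
          gcongr
          exact le_self_pow₀ (by norm_num) (by omega)
      _ = (2 ^ 44) ^ h := by
        rw [← pow_mul, ← pow_mul, ← pow_add, ← pow_mul]; congr 1; ring
      _ ≤ (2 ^ 45) ^ h := by gcongr <;> norm_num
      _ ≤ _ := pow_le_pow_right₀ (by norm_num) hXh
  · refine le_trans ?_ (hle C4 (by linarith) (by rw [hC]; linarith))
    calc (5 * ((S * h : ℕ) : ℝ)) ^ L ≤ (2 ^ (5 * (S * h))) ^ L := by
          gcongr
          have := h2h (5 * (S * h))
          push_cast at this ⊢
          exact this
      _ = _ := by rw [hC4, ← pow_mul, ← pow_mul, hL]; congr 1; ring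
  · refine le_trans ?_ (hle C5 (by linarith) (by rw [hC]; linarith))
    rw [hC5, ← pow_mul, hL]
    apply le_of_eq; congr 1; ring
  · refine le_trans ?_ (hle C6 (by linarith) (by rw [hC]; linarith))
    rw [hC6, ← Real.exp_nat_mul, hL]
    apply le_of_eq; congr 1; push_cast; ring
  · refine le_trans ?_ (hle c (by linarith) (by rw [hC]; linarith))
    exact le_self_pow₀ hc (by omega)

section core

variable {K : Type*} [Field K]

/-- Restriction of an embedding to the ring of integers. -/
noncomputable def res (σ : K →+* ℂ) : 𝓞 K →+* ℂ := σ.comp (algebraMap (𝓞 K) K)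

lemma res_apply (σ : K →+* ℂ) (x : 𝓞 K) : res σ x = σ x := rfl

variable [NumberField K]

lemma step (φ : K →+* ℂ) (b0 b1 : 𝓞 K) (B : ℝ)
    (hB0 : ∀ σ : K →+* ℂ, ‖res σ b0‖ ≤ B) (hB1 : ∀ σ : K →+* ℂ, ‖res σ b1‖ ≤ B)
    (u v : ℕ) (hu : 0 < u) (hv : 0 < v) (lam : ℂ)
    (heq : res φ b0 + res φ b1 * (2 * Real.pi * Complex.I) = lam)
    (hexp : Complex.exp lam = (u : ℂ) / v) (L S S' T' : ℕ) (hL : 1 ≤ L) (hS : 1 ≤ S)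
    (hSS' : S ≤ S') (P : Fin L × Fin L → (𝓞 K)[X]) (H : ℝ)
    (hdeg : ∀ jk, ∀ n ≥ L, (P jk).coeff n = 0)
    (hH : ∀ σ : K →+* ℂ, ∀ jk n, ‖res σ ((P jk).coeff n)‖ ≤ H) (Y : ℝ)
    (hY1 : L ^ 3 * ((1 + B) * L) ^ (2 * T') * H * (S' : ℝ) ^ L * ((u : ℝ) * v) ^ (L * S') ≤ Y)
    (hY2 : L ^ 3 * ((1 + B) * L) ^ (2 * T') * H * (5 * (S' : ℝ)) ^ L *
      Real.exp ((2 * Real.pi + ‖lam‖) * L * (5 * S')) * ((u : ℝ) * v) ^ (L * S') ≤ Y)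
    (hbig : Y ^ (Module.finrank ℚ K) < 2 ^ (T' * S))
    (hz : ∀ m0 < 2 * T', ∀ m1 < 2 * T', ∀ l < S, val L b0 b1 u v P m0 m1 l = 0) :
    ∀ m0 < T', ∀ m1 < T', ∀ l < S', val L b0 b1 u v P m0 m1 l = 0 := by
  intro m0 hm0 m1 hm1 l hl
  by_contra hne
  have hB : 0 ≤ B := (norm_nonneg _).trans (hB0 φ)
  have hH0 : 0 ≤ H := (norm_nonneg _).trans (hH φ ⟨⟨0, hL⟩, ⟨0, hL⟩⟩ 0)
  have hu1 : (1 : ℝ) ≤ u := by exact_mod_cast hu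
  have hv1 : (1 : ℝ) ≤ v := by exact_mod_cast hv
  have hS'1 : (1 : ℝ) ≤ S' := by exact_mod_cast hS.trans hSS'
  have hY0 : 0 ≤ Y := le_trans (by positivity) hY1
  have hv' : (v : ℂ) ≠ 0 := by exact_mod_cast hv.ne'
  have hli := liouville (val L b0 b1 u v P m0 m1 l) hne Y (fun σ => by
    rw [← res_apply]
    refine (val_bound (res σ) b0 b1 B (hB0 σ) (hB1 σ) L u v hu hv P H hdeg (hH σ) S'
      (hS.trans hSS') m0 m1 l (2 * T') hL (by omega) hl.le).trans hY1) φ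
  rw [← res_apply, ← fn_nat (res φ) lam L b0 b1 P u v hv hexp, norm_mul, norm_pow,
    Complex.norm_natCast] at hli
  have hfz : ∀ l < S, ∀ m0 < 2 * T', ∀ m1 < 2 * T', fn (res φ) lam L b0 b1 P m0 m1 l = 0 := by
    intro l hl m0 hm0 m1 hm1
    have h := fn_nat (res φ) lam L b0 b1 P u v hv hexp m0 m1 l
    rw [hz m0 hm0 m1 hm1 l hl, map_zero] at h
    exact (mul_eq_zero.1 h).resolve_right (pow_ne_zero _ hv')
  have hsch := schwarz (fn (res φ) lam L b0 b1 P m0 m1)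
    (fn_differentiable (res φ) lam L b0 b1 P heq m0 m1) T' S S'
    (L ^ 3 * ((1 + B) * L) ^ (2 * T') * H * (5 * (S' : ℝ)) ^ L *
      Real.exp ((2 * Real.pi + ‖lam‖) * L * (5 * S'))) (by linarith) (by exact_mod_cast hSS')
    (fun l hl t ht => fn_iteratedDeriv (res φ) lam L b0 b1 P heq (2 * T') l (hfz l hl) t m0 m1
      (by omega) (by omega))
    (fun z hz => fn_bound (res φ) lam b0 b1 B (hB0 φ) (hB1 φ) L P H hdeg (hH φ) (5 * S')
      (by linarith) m0 m1 (2 * T') hL (by omega) z hz) (l : ℂ)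
    (by rw [Complex.norm_natCast]; exact_mod_cast hl.le)
  have hvl : (v : ℝ) ^ (L * l) ≤ ((u : ℝ) * v) ^ (L * S') := by
    calc (v : ℝ) ^ (L * l) ≤ (v : ℝ) ^ (L * S') :=
          pow_le_pow_right₀ hv1 (Nat.mul_le_mul_left _ hl.le)
      _ ≤ _ := by
          gcongr
          nlinarith
  have hD : Module.finrank ℚ K = Module.finrank ℚ K - 1 + 1 := by
    have : 0 < Module.finrank ℚ K := Module.finrank_pos
    omega
  have h2 : ‖fn (res φ) lam L b0 b1 P m0 m1 l‖ * (v : ℝ) ^ (L * l) ≤ Y / 2 ^ (T' * S) := by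
    calc _ ≤ (L ^ 3 * ((1 + B) * L) ^ (2 * T') * H * (5 * (S' : ℝ)) ^ L *
      Real.exp ((2 * Real.pi + ‖lam‖) * L * (5 * S')) / 2 ^ (T' * S)) *
        ((u : ℝ) * v) ^ (L * S') := by
          refine mul_le_mul hsch hvl (by positivity) (by positivity)
      _ = (L ^ 3 * ((1 + B) * L) ^ (2 * T') * H * (5 * (S' : ℝ)) ^ L *
      Real.exp ((2 * Real.pi + ‖lam‖) * L * (5 * S')) * ((u : ℝ) * v) ^ (L * S'))
        / 2 ^ (T' * S) := by ring
      _ ≤ _ := by gcongr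
  have h3 : (1 : ℝ) ≤ Y / 2 ^ (T' * S) * Y ^ (Module.finrank ℚ K - 1) := by
    refine hli.trans ?_
    gcongr
  have h4 : Y / 2 ^ (T' * S) * Y ^ (Module.finrank ℚ K - 1) =
      Y ^ (Module.finrank ℚ K) / 2 ^ (T' * S) := by
    conv_rhs => rw [hD, pow_succ]
    ring
  rw [h4, one_le_div (by positivity)] at h3
  linarith

lemma zero_estimate (b0 b1 : 𝓞 K) (L u v T S : ℕ) (hu : 0 < u) (hv : 0 < v) (huv : u ≠ v)
    (hT : L ≤ T) (hS : L * L ≤ S) (P : Fin L × Fin L → (𝓞 K)[X])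
    (hdeg : ∀ jk, ∀ n ≥ L, (P jk).coeff n = 0) (hT0 : 0 < T)
    (hz : ∀ m0 < T, ∀ m1 < T, ∀ l < S, val L b0 b1 u v P m0 m1 l = 0) :
    ∀ jk, P jk = 0 := by
  have huK : (u : K) ≠ 0 := by exact_mod_cast hu.ne'
  have hvK : (v : K) ≠ 0 := by exact_mod_cast hv.ne'
  have hinj : Function.Injective (fun k : Fin L => ((u : K) / v) ^ (k : ℕ)) := by
    intro k k' hkk
    have hq : Function.Injective (fun n : ℕ => ((u : ℚ) / v) ^ n) := by
      apply pow_right_injective₀ (by positivity)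
      rw [Ne, div_eq_one_iff_eq (by positivity)]
      exact_mod_cast huv
    have : ((u : ℚ) / v) ^ (k : ℕ) = ((u : ℚ) / v) ^ (k' : ℕ) := by
      have h : ((u : K) / v) ^ (k : ℕ) = ((u : K) / v) ^ (k' : ℕ) := hkk
      apply Rat.cast_injective (α := K)
      push_cast
      exact h
    exact Fin.ext (hq this)
  have main : ∀ m1 < T, ∀ k : Fin L, ∑ j : Fin L,
      C ((((j : ℕ) : 𝓞 K) + ((k : ℕ) : 𝓞 K) * b1) ^ m1) * P (j, k) = 0 := by
    intro m1 hm1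
    have := expPoly' L (fun k : Fin L => ((u : K) / v) ^ (k : ℕ)) hinj
      (fun k => pow_ne_zero _ (div_ne_zero huK hvK))
      (fun k => (∑ j : Fin L,
        C ((((j : ℕ) : 𝓞 K) + ((k : ℕ) : 𝓞 K) * b1) ^ m1) * P (j, k)).map (algebraMap (𝓞 K) K))
      (fun k => by
        rw [degree_lt_iff_coeff_zero]
        intro n hn
        rw [coeff_map, finsetSum_coeff, Finset.sum_eq_zero, map_zero]
        intro j _
        rw [coeff_C_mul, hdeg _ n hn, mul_zero])
      (fun l hl => by
        have h := hz 0 hT0 m1 hm1 l (lt_of_lt_of_le hl hS)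
        have h' := congrArg (algebraMap (𝓞 K) K) h
        rw [map_zero] at h'
        have hvl : (v : K) ^ (L * l) ≠ 0 := pow_ne_zero _ hvK
        apply mul_right_cancel₀ hvl
        rw [zero_mul, ← h']
        unfold val
        rw [Fintype.sum_prod_type_right, map_sum, Finset.sum_mul]
        refine Finset.sum_congr rfl fun k _ => ?_
        have h2 : (v : K) ^ (L * l) = (v : K) ^ ((k : ℕ) * l) * (v : K) ^ ((L - k) * l) := by
          rw [← pow_add, ← add_mul, Nat.add_sub_cancel' k.2.le]
        rw [← map_natCast (algebraMap (𝓞 K) K) l, eval_map_apply, eval_finsetSum, map_sum, map_sum,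
          Finset.sum_mul, Finset.sum_mul]
        refine Finset.sum_congr rfl fun j _ => ?_
        rw [h2]
        simp only [pow_zero, Module.End.one_apply, eval_mul, eval_pow, eval_C, map_mul, map_pow, map_natCast,
          ← pow_mul, div_pow]
        field_simp)
    intro k
    have h := this k
    exact (Polynomial.map_eq_zero_iff (RingOfIntegers.coe_injective)).1 h
  rintro ⟨j, k⟩
  refine Polynomial.ext fun n => ?_
  rw [coeff_zero]
  have hvan := Matrix.eq_zero_of_forall_pow_sum_mul_pow_eq_zero
    (f := fun j : Fin L => (((j : ℕ) : 𝓞 K) + ((k : ℕ) : 𝓞 K) * b1))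
    (v := fun j : Fin L => (P (j, k)).coeff n) (by
      intro j j' hjj
      have : ((j : ℕ) : 𝓞 K) = ((j' : ℕ) : 𝓞 K) := add_right_cancel hjj
      exact Fin.ext (by exact_mod_cast this)) (by
      intro i
      have h := congrArg (fun Q => coeff Q n) (main i (lt_of_lt_of_le i.2 hT) k)
      simp only [finsetSum_coeff, coeff_C_mul, coeff_zero] at h
      rw [← h]
      exact Finset.sum_congr rfl fun j _ => mul_comm _ _)
  exact congrFun hvan j

lemma exists_P (b0 b1 : 𝓞 K) (B : ℝ) (hB0 : ∀ σ : K →+* ℂ, ‖res σ b0‖ ≤ B)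
    (hB1 : ∀ σ : K →+* ℂ, ‖res σ b1‖ ≤ B) (u v : ℕ) (hu : 0 < u) (hv : 0 < v) (c : ℝ)
    (hc : ∀ (p : ℕ) (α β : Type) [Fintype α] [Fintype β] (_ : Fintype.card α = p)
      (_ : Fintype.card β = 2 * p) (_ : 0 < p) (a : Matrix α β (𝓞 K)) (_ : a ≠ 0) (A : ℝ)
      (_ : ∀ k l, ∀ σ : K →+* ℂ, ‖σ (a k l)‖ ≤ A),
      ∃ ξ : β → 𝓞 K, ξ ≠ 0 ∧ a.mulVec ξ = 0 ∧
        ∀ l, ∀ σ : K →+* ℂ, ‖σ (ξ l)‖ ≤ c * (p * A))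
    (L T S : ℕ) (hL : 0 < L) (hT : 0 < T) (hS : 0 < S) (hLTS : L ^ 3 = 2 * (T ^ 2 * S)) :
    ∃ P : Fin L × Fin L → (𝓞 K)[X], (∃ jk, P jk ≠ 0) ∧
      (∀ jk, ∀ n ≥ L, (P jk).coeff n = 0) ∧
      (∀ σ : K →+* ℂ, ∀ jk n, ‖res σ ((P jk).coeff n)‖ ≤
        c * ((T ^ 2 * S : ℕ) * (L * ((1 + B) * L) ^ (2 * T) * 1 * (S : ℝ) ^ L *
          ((u : ℝ) * v) ^ (L * S)))) ∧
      (∀ m0 < T, ∀ m1 < T, ∀ l < S, val L b0 b1 u v P m0 m1 l = 0) := by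
  classical
  let a : Matrix (Fin T × Fin T × Fin S) (Fin L × (Fin L × Fin L)) (𝓞 K) := fun r i =>
    (((i.2.1 : ℕ) : 𝓞 K) + ((i.2.2 : ℕ) : 𝓞 K) * b1) ^ (r.2.1 : ℕ) *
      ((Dk b0 i.2.2 ^ (r.1 : ℕ)) (X ^ (i.1 : ℕ))).eval ((r.2.2 : ℕ) : 𝓞 K) *
      ((u : 𝓞 K) ^ ((i.2.2 : ℕ) * (r.2.2 : ℕ)) * (v : 𝓞 K) ^ ((L - i.2.2) * (r.2.2 : ℕ)))
  have ha : a ≠ 0 := by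
    intro h
    have := congrFun (congrFun h (⟨0, hT⟩, ⟨0, hT⟩, ⟨0, hS⟩)) (⟨0, hL⟩, ⟨0, hL⟩, ⟨0, hL⟩)
    simp [a] at this
  obtain ⟨ξ, h1, h2, h3⟩ := hc (T ^ 2 * S) _ _ (by simp; ring)
    (by rw [← hLTS]; simp; ring) (by positivity) a ha
    (L * ((1 + B) * L) ^ (2 * T) * 1 * (S : ℝ) ^ L * ((u : ℝ) * v) ^ (L * S)) (by
      rintro ⟨m0, m1, l⟩ ⟨i, j, k⟩ σ
      have := term_bound (res σ) b0 b1 B (hB0 σ) (hB1 σ) L j k j.2.le k.2.le (X ^ (i : ℕ)) 1 S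
        (((u : ℝ) * v) ^ (L * S)) (by
          intro n hn
          rw [coeff_X_pow, if_neg]
          have := i.2
          omega) (by
          intro n
          rw [coeff_X_pow]
          split_ifs <;> simp) (by exact_mod_cast hS) (l : ℂ)
        ((u : ℂ) ^ ((k : ℕ) * l) * (v : ℂ) ^ ((L - k) * l))
        (by rw [Complex.norm_natCast]; exact_mod_cast l.2.le)
        (weight_bound L u v k l S hu hv k.2.le l.2.le) m0 m1 (2 * T) hL
        (by have := m0.2; have := m1.2; omega)
      convert this using 2
      have h3 : (((Dk b0 (k : ℕ) ^ (m0 : ℕ)) (X ^ (i : ℕ))).map (res σ)).eval ((l : ℕ) : ℂ) =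
          res σ (((Dk b0 (k : ℕ) ^ (m0 : ℕ)) (X ^ (i : ℕ))).eval ((l : ℕ) : 𝓞 K)) := by
        rw [← map_natCast (res σ) l, eval_map_apply]
      rw [h3, ← res_apply]
      simp only [a, map_mul, map_pow, map_natCast])
  refine ⟨fun jk => ∑ i : Fin L, ξ (i, jk) • X ^ (i : ℕ), ?_, ?_, ?_, ?_⟩
  all_goals
    have hcoef : ∀ jk n, (∑ i : Fin L, ξ (i, jk) • (X : (𝓞 K)[X]) ^ (i : ℕ)).coeff n =
        if hn : n < L then ξ (⟨n, hn⟩, jk) else 0 := by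
      intro jk n
      simp only [finsetSum_coeff, coeff_smul, coeff_X_pow, smul_eq_mul, mul_ite, mul_one, mul_zero]
      split_ifs with hn
      · rw [Finset.sum_eq_single ⟨n, hn⟩]
        · simp
        · intro b _ hb
          rw [if_neg]
          intro h; apply hb; ext; exact h.symm
        · simp
      · apply Finset.sum_eq_zero
        intro b _
        rw [if_neg]
        have := b.2
        omega
  · by_contra! hcon
    apply h1
    ext1 ⟨i, jk⟩
    have h := hcoef jk i
    rw [hcon jk, dif_pos i.2] at h
    simpa using h.symm
  · intro jk n hn
    rw [hcoef, dif_neg (by omega)]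
  · intro σ jk n
    rw [hcoef]
    split_ifs with hn
    · exact h3 _ σ
    · rw [map_zero, norm_zero]
      exact (norm_nonneg _).trans (h3 (⟨0, hL⟩, ⟨0, hL⟩, ⟨0, hL⟩) σ)
  · intro m0 hm0 m1 hm1 l hl
    have h := congrFun h2 (⟨m0, hm0⟩, ⟨m1, hm1⟩, ⟨l, hl⟩)
    simp only [Matrix.mulVec, dotProduct, Pi.zero_apply] at h
    rw [← h, Fintype.sum_prod_type_right]
    unfold val
    refine Finset.sum_congr rfl fun jk _ => ?_
    rw [map_sum, eval_finsetSum, Finset.mul_sum, Finset.sum_mul]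
    refine Finset.sum_congr rfl fun i _ => ?_
    simp only [a, map_smul, eval_smul, smul_eq_mul]
    ring

end core

theorem core_contradiction {K : Type*} [Field K] [NumberField K] (φ : K →+* ℂ) (b0 b1 : 𝓞 K)
    (u v : ℕ) (hu : 0 < u) (hv : 0 < v) (huv : u ≠ v)
    (heq : res φ b0 + res φ b1 * (2 * Real.pi * Complex.I) = (Real.log ((u : ℝ) / v) : ℂ)) :
    False := by
  obtain ⟨c, hc1, hc⟩ := siegel K
  set lam : ℂ := (Real.log ((u : ℝ) / v) : ℂ) with hlam
  have hexp : Complex.exp lam = (u : ℂ) / v := by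
    rw [hlam, ← Complex.ofReal_exp, Real.exp_log (by positivity)]
    push_cast; rfl
  set B : ℝ := house (b0 : K) + house (b1 : K) with hBdef
  have hB : 0 ≤ B := add_nonneg (house_nonneg _) (house_nonneg _)
  have hB0 : ∀ σ : K →+* ℂ, ‖res σ b0‖ ≤ B := fun σ =>
    (norm_embedding_le_house (b0 : K) σ).trans (le_add_of_nonneg_right (house_nonneg _))
  have hB1 : ∀ σ : K →+* ℂ, ‖res σ b1‖ ≤ B := fun σ =>
    (norm_embedding_le_house (b1 : K) σ).trans (le_add_of_nonneg_left (house_nonneg _))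
  have hu1 : (1 : ℝ) ≤ u := by exact_mod_cast hu
  have hv1 : (1 : ℝ) ≤ v := by exact_mod_cast hv
  have hw : (1 : ℝ) ≤ (u : ℝ) * v := by nlinarith
  set D := Module.finrank ℚ K with hD
  obtain ⟨C, hC1, hC⟩ := numeric B (2 * Real.pi + ‖lam‖) c ((u : ℝ) * v) hB
    (by have := Real.pi_pos; positivity) hc1 hw
  obtain ⟨n0, hn0⟩ := pow_unbounded_of_one_lt (C ^ (11 * D)) (one_lt_two : (1 : ℝ) < 2)
  obtain ⟨h, hh9, hhC⟩ : ∃ h : ℕ, 2 ^ 9 ≤ h ∧ C ^ (11 * D) < 2 ^ h :=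
    ⟨n0 + 2 ^ 9, by omega, hn0.trans_le (pow_le_pow_right₀ one_le_two (by omega))⟩
  have hh1 : 1 ≤ h := by omega
  obtain ⟨L, hL⟩ : ∃ L, L = 2 ^ 9 * h ^ 6 := ⟨_, rfl⟩
  obtain ⟨T, hT⟩ : ∃ T, T = 2 ^ 13 * h ^ 8 := ⟨_, rfl⟩
  have hL1 : 1 ≤ L := by rw [hL]; exact Nat.mul_pos (by norm_num) (by positivity)
  have hLR : (1 : ℝ) ≤ L := by exact_mod_cast hL1
  have hT1 : 0 < T := by rw [hT]; exact Nat.mul_pos (by norm_num) (by positivity)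
  obtain ⟨P, ⟨jk0, hP0⟩, hdeg, hH, hval⟩ := exists_P b0 b1 B hB0 hB1 u v hu hv c hc L T (h ^ 2) hL1
    hT1 (by positivity) (by rw [hL, hT]; ring)
  have hbase : 1 ≤ (1 + B) * L := by nlinarith
  obtain ⟨H, hHdef⟩ : ∃ H, H = C ^ (6 * (h ^ 7 * h ^ 2)) := ⟨_, rfl⟩
  have hH' : ∀ σ : K →+* ℂ, ∀ jk n, ‖res σ ((P jk).coeff n)‖ ≤ H := by
    intro σ jk n
    refine (hH σ jk n).trans ?_
    obtain ⟨e1, e2, e3, e4, e5, e6, e7⟩ := hC h (h ^ 2) L T hh1 le_rfl hL hT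
    obtain ⟨Z, hZ⟩ : ∃ Z, Z = C ^ (h ^ 7 * h ^ 2) := ⟨_, rfl⟩
    rw [← hZ] at e1 e2 e3 e4 e5 e6 e7
    have hZ0 : 0 ≤ Z := by rw [hZ]; positivity
    have f1 : (L : ℝ) ≤ Z := (le_self_pow₀ hLR (by norm_num)).trans e2
    have f2 : ((h ^ 2 : ℕ) : ℝ) ^ L ≤ Z := by
      refine le_trans ?_ e4
      gcongr
      have : h ^ 2 ≤ 5 * (h ^ 2 * h) := by nlinarith [sq_nonneg h]
      exact_mod_cast this
    have f3 : ((u : ℝ) * v) ^ (L * h ^ 2) ≤ Z := by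
      refine le_trans ?_ e5
      exact pow_le_pow_right₀ hw (Nat.mul_le_mul_left _ (Nat.le_mul_of_pos_right _ hh1))
    have f4 : ((T ^ 2 * h ^ 2 : ℕ) : ℝ) ≤ Z := by
      refine le_trans (le_of_eq ?_) e3
      congr 1
      rw [hT]; ring
    calc c * ((T ^ 2 * h ^ 2 : ℕ) * (L * ((1 + B) * L) ^ (2 * T) * 1 * ((h ^ 2 : ℕ) : ℝ) ^ L *
          ((u : ℝ) * v) ^ (L * h ^ 2))) ≤ Z * (Z * (Z * Z * 1 * Z * Z)) := by gcongr
      _ = H := by rw [hHdef, hZ, mul_comm 6, pow_mul]; ring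
  have hH0 : 0 ≤ H := by rw [hHdef]; positivity
  have ind : ∀ J ≤ 13, ∀ m0 < 2 ^ (13 - J) * h ^ 8, ∀ m1 < 2 ^ (13 - J) * h ^ 8,
      ∀ l < h ^ (2 + J), val L b0 b1 u v P m0 m1 l = 0 := by
    intro J
    induction J with
    | zero =>
      intro _
      simpa [hT] using hval
    | succ J ih =>
      intro hJ
      have ih' := ih (by omega)
      have hpow : 2 ^ (13 - J) * h ^ 8 = 2 * (2 ^ (13 - (J + 1)) * h ^ 8) := by
        rw [show 13 - J = 13 - (J + 1) + 1 by omega, pow_succ]; ring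
      rw [hpow] at ih'
      obtain ⟨T', hT'⟩ : ∃ T', T' = 2 ^ (13 - (J + 1)) * h ^ 8 := ⟨_, rfl⟩
      have hTT : T' ≤ T := by
        rw [hT', hT]
        exact Nat.mul_le_mul_right _ (Nat.pow_le_pow_right (by norm_num) (by omega))
      have hT8 : h ^ 8 ≤ T' := by
        rw [hT']; exact Nat.le_mul_of_pos_left _ (by positivity)
      obtain ⟨S, hS⟩ : ∃ S, S = h ^ (2 + J) := ⟨_, rfl⟩
      rw [show 2 + (J + 1) = 2 + J + 1 by ring, pow_succ h (2 + J), ← hS, ← hT']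
      rw [← hS, ← hT'] at ih'
      have hS2 : h ^ 2 ≤ S := by rw [hS]; exact Nat.pow_le_pow_right hh1 (by omega)
      have hS1 : 1 ≤ S := le_trans (Nat.one_le_pow _ _ hh1) hS2
      obtain ⟨e1, e2, e3, e4, e5, e6, e7⟩ := hC h S L T hh1 hS2 hL hT
      obtain ⟨Z, hZ⟩ : ∃ Z, Z = C ^ (h ^ 7 * S) := ⟨_, rfl⟩
      rw [← hZ] at e1 e2 e3 e4 e5 e6 e7
      have hZ1 : 1 ≤ Z := by rw [hZ]; exact one_le_pow₀ hC1
      have f1 : ((1 + B) * L) ^ (2 * T') ≤ Z :=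
        (pow_le_pow_right₀ hbase (Nat.mul_le_mul_left _ hTT)).trans e1
      have f2 : H ≤ Z ^ 6 := by
        rw [hHdef, hZ, ← pow_mul, mul_comm 6]
        exact pow_le_pow_right₀ hC1 (Nat.mul_le_mul_right _ (Nat.mul_le_mul_left _ hS2))
      have f3 : ((S * h : ℕ) : ℝ) ^ L ≤ Z := by
        refine le_trans ?_ e4
        gcongr
        have : (0 : ℝ) ≤ ((S * h : ℕ) : ℝ) := by positivity
        linarith
      refine step φ b0 b1 B hB0 hB1 u v hu hv lam heq hexp L S (S * h) T' hL1 hS1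
        (Nat.le_mul_of_pos_right _ hh1) P H hdeg hH' (Z ^ 11) ?_ ?_ ?_ ih'
      · calc _ ≤ Z * Z * Z ^ 6 * Z * Z := by gcongr
          _ = Z ^ 10 := by ring
          _ ≤ Z ^ 11 := pow_le_pow_right₀ hZ1 (by norm_num)
      · calc _ ≤ Z * Z * Z ^ 6 * Z * Z * Z := by gcongr
          _ = Z ^ 11 := by ring
      · have hX0 : h ^ 7 * S ≠ 0 := Nat.mul_ne_zero (by positivity) (by omega)
        calc (Z ^ 11) ^ D = (C ^ (11 * D)) ^ (h ^ 7 * S) := by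
              rw [hZ, ← pow_mul, ← pow_mul, ← pow_mul]; congr 1; ring
          _ < (2 ^ h) ^ (h ^ 7 * S) := pow_lt_pow_left₀ hhC (by positivity) hX0
          _ = 2 ^ (h ^ 8 * S) := by rw [← pow_mul]; congr 1; ring
          _ ≤ _ := pow_le_pow_right₀ one_le_two (Nat.mul_le_mul_right _ hT8)
  have hfin := ind 13 le_rfl
  simp only [Nat.sub_self, pow_zero, one_mul] at hfin
  refine hP0 (zero_estimate b0 b1 L u v (h ^ 8) (h ^ (2 + 13)) hu hv huv ?_ ?_ P hdeg (by positivity)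
    hfin jk0)
  · rw [hL]
    calc 2 ^ 9 * h ^ 6 ≤ h * h ^ 6 := Nat.mul_le_mul_right _ hh9
      _ = h ^ 7 := by ring
      _ ≤ h ^ 8 := Nat.pow_le_pow_right hh1 (by norm_num)
  · rw [hL]
    calc 2 ^ 9 * h ^ 6 * (2 ^ 9 * h ^ 6) ≤ h * h ^ 6 * (h * h ^ 6) := by gcongr
      _ = h ^ 14 := by ring
      _ ≤ h ^ (2 + 13) := Nat.pow_le_pow_right hh1 (by norm_num)

theorem main_real (A : ℤ) (u v : ℕ) (hu : 0 < u) (hv : 0 < v) (huv : u ≠ v) (β : ℝ)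
    (hβ : IsAlgebraic ℚ β) (h : β = A * Real.pi + Real.log ((u : ℝ) / v)) : False := by
  have hβ' : IsAlgebraic ℤ β := (IsFractionRing.isAlgebraic_iff ℤ ℚ ℝ).2 hβ
  obtain ⟨N, hN0, hN⟩ := hβ'.exists_integral_multiple
  have hβc : IsIntegral ℚ (β : ℂ) := hβ.isIntegral.map (Complex.ofRealAm.restrictScalars ℚ)
  have hIz : IsIntegral ℤ Complex.I := Complex.isIntegral_int_I
  have hI : IsIntegral ℚ Complex.I := hIz.tower_top
  let K : IntermediateField ℚ ℂ := IntermediateField.adjoin ℚ {(β : ℂ), Complex.I}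
  have hfd : FiniteDimensional ℚ K := IntermediateField.finiteDimensional_adjoin (by
    intro x hx
    rcases hx with rfl | rfl
    · exact hβc
    · exact hI)
  have : NumberField K := { to_charZero := inferInstance, to_finiteDimensional := hfd }
  have hβK : (β : ℂ) ∈ K := IntermediateField.subset_adjoin _ _ (by simp)
  have hIK : Complex.I ∈ K := IntermediateField.subset_adjoin _ _ (by simp)
  let x : K := ⟨β, hβK⟩
  let y : K := ⟨Complex.I, hIK⟩
  have hinj : Function.Injective ((algebraMap K ℂ).toIntAlgHom) := (algebraMap K ℂ).injective
  have hx : IsIntegral ℤ ((N : K) * x) := by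
    rw [← isIntegral_algHom_iff ((algebraMap K ℂ).toIntAlgHom) hinj]
    have := hN.map (Complex.ofRealAm.restrictScalars ℤ)
    simpa [x] using this
  have hy : IsIntegral ℤ y := by
    rw [← isIntegral_algHom_iff ((algebraMap K ℂ).toIntAlgHom) hinj]
    exact hIz
  let M : ℕ := N.natAbs
  have hM0 : 0 < M := Int.natAbs_pos.2 hN0
  have hMN : ((M : ℕ) : ℤ) ^ 1 = N ∨ ((M : ℕ) : ℤ) ^ 1 = -N := by
    simpa [M] using abs_choice N
  -- use `N ^ 2` as a positive multiplier
  let b0 : 𝓞 K := ((2 * N : ℤ) : 𝓞 K) * ⟨(N : K) * x, hx⟩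
  let b1 : 𝓞 K := ((N ^ 2 * A : ℤ) : 𝓞 K) * ⟨y, hy⟩
  refine core_contradiction (algebraMap K ℂ) b0 b1 (u ^ (2 * M ^ 2)) (v ^ (2 * M ^ 2))
    (by positivity) (by positivity) ?_ ?_
  · intro hpow
    exact huv (Nat.pow_left_injective (by positivity) hpow)
  · have h1 : res (algebraMap K ℂ) b0 = 2 * N * (N * β) := by
      simp only [b0, map_mul, map_intCast, res_apply]
      push_cast
      congr 1
    have h2 : res (algebraMap K ℂ) b1 = N ^ 2 * A * Complex.I := by
      simp only [b1, map_mul, map_intCast, res_apply]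
      push_cast
      congr 1
    have hM2 : ((M : ℕ) : ℝ) ^ 2 = (N : ℝ) ^ 2 := by
      have : ((M : ℕ) : ℤ) ^ 2 = N ^ 2 := Int.natAbs_sq N
      exact_mod_cast this
    have h3 : Real.log (((u ^ (2 * M ^ 2) : ℕ) : ℝ) / ((v ^ (2 * M ^ 2) : ℕ) : ℝ)) =
        2 * N ^ 2 * (β - A * Real.pi) := by
      rw [h]
      push_cast
      rw [← div_pow, Real.log_pow]
      push_cast
      rw [hM2]; ring
    rw [h1, h2, h3]
    push_cast
    linear_combination (2 * N ^ 2 * A * Real.pi : ℂ) * Complex.I_sq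

end BakerTwo

theorem transcendental_of_mul_indep_discr
    (K L : Type*) [Field K] [NumberField K] [Field L] [NumberField L]
    (hindep : ∀ a b : ℤ, (|NumberField.discr K| : ℝ) ^ a = (|NumberField.discr L| : ℝ) ^ b →
      a = 0 ∧ b = 0) :
    Transcendental ℚ
      ((1 / 2) * ((NumberField.InfinitePlace.nrRealPlaces K : ℝ) * (Real.pi / 2) +
        (Module.finrank ℚ K : ℝ) * (Real.log (8 * Real.pi) + Real.eulerMascheroniConstant) -
        Real.log |(NumberField.discr K : ℝ)|)) ∨
    Transcendental ℚ
      ((1 / 2) * ((NumberField.InfinitePlace.nrRealPlaces L : ℝ) * (Real.pi / 2) +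
        (Module.finrank ℚ L : ℝ) * (Real.log (8 * Real.pi) + Real.eulerMascheroniConstant) -
        Real.log |(NumberField.discr L : ℝ)|)) := by
  by_contra hcon
  rw [not_or] at hcon
  obtain ⟨hK, hL⟩ := hcon
  unfold Transcendental at hK hL
  rw [not_not] at hK hL
  set n := Module.finrank ℚ K with hn
  set m := Module.finrank ℚ L with hm
  set r := NumberField.InfinitePlace.nrRealPlaces K
  set s := NumberField.InfinitePlace.nrRealPlaces L
  have hm0 : 0 < m := Module.finrank_pos
  obtain ⟨a, ha⟩ : ∃ a, a = (NumberField.discr K).natAbs := ⟨_, rfl⟩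
  obtain ⟨b, hb⟩ : ∃ b, b = (NumberField.discr L).natAbs := ⟨_, rfl⟩
  have haR : |(NumberField.discr K : ℝ)| = a := by
    rw [ha, ← Int.cast_abs, Int.abs_eq_natAbs, Int.cast_natCast]
  have hbR : |(NumberField.discr L : ℝ)| = b := by
    rw [hb, ← Int.cast_abs, Int.abs_eq_natAbs, Int.cast_natCast]
  have ha0 : 0 < a := ha ▸ Int.natAbs_pos.2 (NumberField.discr_ne_zero K)
  have hb0 : 0 < b := hb ▸ Int.natAbs_pos.2 (NumberField.discr_ne_zero L)
  rw [haR] at hK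
  rw [hbR] at hL
  simp only [haR, hbR] at hindep
  have hnat : ∀ k : ℕ, IsAlgebraic ℚ (k : ℝ) := fun k => isAlgebraic_natCast k
  have halg := ((hnat (4 * m)).mul hK).sub ((hnat (4 * n)).mul hL)
  refine BakerTwo.main_real ((m : ℤ) * r - n * s) (b ^ (2 * n)) (a ^ (2 * m)) (by positivity)
    (by positivity) ?_ _ halg ?_
  · intro h
    have := (hindep ((2 * m : ℕ) : ℤ) ((2 * n : ℕ) : ℤ) (by
      rw [zpow_natCast, zpow_natCast]; exact_mod_cast h.symm)).1
    omega
  · push_cast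
    rw [Real.log_div (by positivity) (by positivity), Real.log_pow, Real.log_pow]
    push_cast
    ring
end
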